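/- Let ψ be the (σ,λ)-GFF on V_N and let f_N^ψ(β) = (1/log N²) log Σ_{v∈V_N} e^{βψ_v} for β > 0. Then, as N → ∞, f_N^ψ(β) converges, both in probability and in L^p for every 1 ≤ p < ∞, to f^ψ(β) := max_{γ∈[0,γ*]} (βγ + 𝓔(γ)) = Σ_{j=1}^m f^{REM(σ̄_j)}(β) ∇λ^j, where f^{REM(σ)}(β) = 2β/β_c(σ) if β > β_c(σ) and f^{REM(σ)}(β) = 1 + (β/β_c(σ))² if β ≤ β_c(σ), with β_c(σ) = 2/σ. -/

import Mathlib

open Filter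
open scoped Classical

noncomputable section GFFCommon

abbrev Vtx : Type := ℤ × ℤ

abbrev FieldSp : Type := Vtx → ℝ

def VN (N : ℕ) : Finset Vtx := Finset.Icc (0, 0) ((N : ℤ), (N : ℤ))

def bdry (B : Finset Vtx) : Finset Vtx :=
  B.filter fun v =>
    ¬((v.1 + 1, v.2) ∈ B ∧ (v.1 - 1, v.2) ∈ B ∧ (v.1, v.2 + 1) ∈ B ∧ (v.1, v.2 - 1) ∈ B)

def intr (B : Finset Vtx) : Finset Vtx := B \ bdry B

def nbhd (N : ℕ) (lam : ℝ) (v : Vtx) : Finset Vtx :=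
  if lam = 0 then VN N
  else if lam = 1 then {v}
  else (VN N).filter fun w =>
    |(w.1 : ℝ) - (v.1 : ℝ)| ≤ (N : ℝ) ^ ((1 : ℝ) - lam) / 2 ∧
    |(w.2 : ℝ) - (v.2 : ℝ)| ≤ (N : ℝ) ^ ((1 : ℝ) - lam) / 2

def scaleAlg (N : ℕ) (lam : ℝ) (v : Vtx) : MeasurableSpace FieldSp :=
  ⨆ w ∈ {w : Vtx | w ∈ VN N ∧ w ∉ intr (nbhd N lam v)},
    MeasurableSpace.comap (fun ω : FieldSp => ω w) inferInstance

def IsGreenFn (B : Finset Vtx) (G : Vtx → Vtx → ℝ) : Prop :=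
  (∀ x y : Vtx, x ∉ intr B ∨ y ∉ intr B → G x y = 0) ∧
  ∀ y ∈ intr B, ∀ x ∈ intr B,
    G x y = (G (x.1 + 1, x.2) y + G (x.1 - 1, x.2) y
        + G (x.1, x.2 + 1) y + G (x.1, x.2 - 1) y) / 4
      + (Real.pi / 2) * (if x = y then 1 else 0)

def IsGFF (N : ℕ) (P : MeasureTheory.Measure FieldSp) : Prop :=
  MeasureTheory.IsProbabilityMeasure P ∧
  ∃ G : Vtx → Vtx → ℝ, IsGreenFn (VN N) G ∧
    ∀ c : Vtx → ℝ,
      P.map (fun ω => ∑ v ∈ VN N, c v * ω v) =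
        ProbabilityTheory.gaussianReal 0 (Real.toNNReal (∑ v ∈ VN N, ∑ w ∈ VN N, c v * c w * G v w))

open MeasureTheory in
def phiScale (N : ℕ) (P : MeasureTheory.Measure FieldSp) (v : Vtx) (lam : ℝ) : FieldSp → ℝ :=
  P[fun ω : FieldSp => ω v | scaleAlg N lam v]

def ScaleParams (M : ℕ) (sigv lamv : ℕ → ℝ) : Prop :=
  1 ≤ M ∧ (∀ i ∈ Finset.Icc 1 M, 0 < sigv i) ∧
  lamv 0 = 0 ∧ lamv M = 1 ∧ ∀ i, i < M → lamv i < lamv (i + 1)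

def psiFld (N M : ℕ) (sigv lamv : ℕ → ℝ) (P : MeasureTheory.Measure FieldSp) (v : Vtx) : FieldSp → ℝ :=
  fun ω => ∑ i ∈ Finset.Icc 1 M, sigv i * (phiScale N P v (lamv i) ω - phiScale N P v (lamv (i - 1)) ω)

open MeasureTheory in
def psiScale (N M : ℕ) (sigv lamv : ℕ → ℝ) (P : MeasureTheory.Measure FieldSp) (v : Vtx) (lam : ℝ) :
    FieldSp → ℝ :=
  P[psiFld N M sigv lamv P v | scaleAlg N lam v]

def psiInc (N M : ℕ) (sigv lamv : ℕ → ℝ) (P : MeasureTheory.Measure FieldSp) (v : Vtx) (lam lam' : ℝ) :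
    FieldSp → ℝ :=
  fun ω => psiScale N M sigv lamv P v lam' ω - psiScale N M sigv lamv P v lam ω

def stepFn (M : ℕ) (sigv lamv : ℕ → ℝ) (s : ℝ) : ℝ :=
  (if s = 0 then sigv 1 else 0) +
  ∑ i ∈ Finset.Icc 1 M, if lamv (i - 1) < s ∧ s ≤ lamv i then sigv i else 0

def Jint (f : ℝ → ℝ) (s : ℝ) : ℝ := ∫ r in (0:ℝ)..s, f r

def Jint2 (f : ℝ → ℝ) (s₁ s₂ : ℝ) : ℝ := ∫ r in s₁..s₂, f r

def Jsig2 (M : ℕ) (sigv lamv : ℕ → ℝ) (s : ℝ) : ℝ := Jint (fun r => (stepFn M sigv lamv r) ^ 2) s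

def JsigBar (M : ℕ) (sigv lamv : ℕ → ℝ) (s : ℝ) : ℝ := Jsig2 M sigv lamv s / Jsig2 M sigv lamv 1

def concaveHull (f : ℝ → ℝ) (s : ℝ) : ℝ :=
  sInf {y | ∃ g : ℝ → ℝ, ConcaveOn ℝ (Set.Icc (0:ℝ) 1) g ∧
    (∀ t ∈ Set.Icc (0:ℝ) 1, f t ≤ g t) ∧ y = g s}

def EffParams (M : ℕ) (sigv lamv : ℕ → ℝ) (m : ℕ) (sigb lamb : ℕ → ℝ) (sigbar : ℝ → ℝ) : Prop :=
  1 ≤ m ∧ m ≤ M ∧ lamb 0 = 0 ∧ lamb m = 1 ∧ (∀ j, j < m → lamb j < lamb (j + 1)) ∧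
  (∀ l, 1 ≤ l → l < m → sigb (l + 1) < sigb l) ∧ (∀ l ∈ Finset.Icc 1 m, 0 < sigb l) ∧
  sigbar 0 = sigb 1 ∧
  (∀ l ∈ Finset.Icc 1 m, ∀ s : ℝ, lamb (l - 1) < s → s ≤ lamb l → sigbar s = sigb l) ∧
  (∀ s : ℝ, 0 < s → s ≤ 1 →
    concaveHull (Jsig2 M sigv lamv) s = ∫ r in (0:ℝ)..s, (sigbar r) ^ 2)

def gammaStar (M : ℕ) (sigv lamv : ℕ → ℝ) (sigbar : ℝ → ℝ) : ℝ :=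
  ∫ s in (0:ℝ)..1, (stepFn M sigv lamv s) ^ 2 / sigbar s

def gammaL (M : ℕ) (sigv lamv : ℕ → ℝ) (lamb : ℕ → ℝ) (sigbar : ℝ → ℝ) (l : ℕ) : ℝ :=
  if l = 0 then 0 else ∫ s in (0:ℝ)..1, (stepFn M sigv lamv s) ^ 2 / sigbar (min s (lamb l))

def IsEntropy (M : ℕ) (sigv lamv : ℕ → ℝ) (m : ℕ) (lamb : ℕ → ℝ) (sigbar : ℝ → ℝ)
    (EntE : ℝ → ℝ) : Prop :=
  EntE 0 = 1 ∧
  ∀ l ∈ Finset.Icc 1 m, ∀ γ : ℝ,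
    gammaL M sigv lamv lamb sigbar (l - 1) < γ → γ ≤ gammaL M sigv lamv lamb sigbar l →
      EntE γ = (1 - lamb (l - 1)) -
        (γ - ∫ s in (0:ℝ)..(lamb (l - 1)), (stepFn M sigv lamv s) ^ 2 / sigbar s) ^ 2 /
          Jint2 (fun r => (stepFn M sigv lamv r) ^ 2) (lamb (l - 1)) 1

def fREM (σ β : ℝ) : ℝ :=
  if (2 / σ) < β then 2 * (β / (2 / σ)) else 1 + (β / (2 / σ)) ^ 2

def lbeta (m : ℕ) (sigb : ℕ → ℝ) (β : ℝ) : ℕ :=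
  if β ≤ 2 / sigb m then sInf {l : ℕ | 1 ≤ l ∧ β ≤ 2 / sigb l} else m + 1

def fpsiLim (m : ℕ) (sigb lamb : ℕ → ℝ) (β : ℝ) : ℝ :=
  (∑ j ∈ Finset.Icc 1 (lbeta m sigb β - 1), (2 * β / (2 / sigb j)) * (lamb j - lamb (j - 1))) +
  ∑ j ∈ Finset.Icc (lbeta m sigb β) m, (1 + β ^ 2 / (2 / sigb j) ^ 2) * (lamb j - lamb (j - 1))

def critSet (m : ℕ) (sigb : ℕ → ℝ) : Set ℝ :=
  {β | 0 < β ∧ ∀ j ∈ Finset.Icc 1 m, β ≠ 2 / sigb j}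

def ZN (N M : ℕ) (sigv lamv : ℕ → ℝ) (P : MeasureTheory.Measure FieldSp) (β : ℝ) (ω : FieldSp) : ℝ :=
  ∑ v ∈ VN N, Real.exp (β * psiFld N M sigv lamv P v ω)

def freeEnergy (N M : ℕ) (sigv lamv : ℕ → ℝ) (P : MeasureTheory.Measure FieldSp) (β : ℝ) (ω : FieldSp) : ℝ :=
  (Real.log ((N : ℝ) ^ 2))⁻¹ * Real.log (ZN N M sigv lamv P β ω)

def AN (N : ℕ) (ρ : ℝ) : Finset Vtx :=
  (VN N).filter fun v => ∀ z : Vtx, z ∉ VN N →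
    (N : ℝ) ^ ((1 : ℝ) - ρ) ≤ Real.sqrt (((v.1 : ℝ) - (z.1 : ℝ)) ^ 2 + ((v.2 : ℝ) - (z.2 : ℝ)) ^ 2)

def ZNres (N M : ℕ) (sigv lamv : ℕ → ℝ) (P : MeasureTheory.Measure FieldSp) (β ρ : ℝ) (ω : FieldSp) : ℝ :=
  ∑ v ∈ AN N ρ, Real.exp (β * psiFld N M sigv lamv P v ω)

def freeEnergyRes (N M : ℕ) (sigv lamv : ℕ → ℝ) (P : MeasureTheory.Measure FieldSp) (β ρ : ℝ)
    (ω : FieldSp) : ℝ :=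
  (Real.log ((N : ℝ) ^ 2))⁻¹ * Real.log (ZNres N M sigv lamv P β ρ ω)

def gibbsW (N M : ℕ) (sigv lamv : ℕ → ℝ) (P : MeasureTheory.Measure FieldSp) (β : ℝ) (v : Vtx)
    (ω : FieldSp) : ℝ :=
  Real.exp (β * psiFld N M sigv lamv P v ω) / ZN N M sigv lamv P β ω

def gibbsWres (N M : ℕ) (sigv lamv : ℕ → ℝ) (P : MeasureTheory.Measure FieldSp) (β ρ : ℝ) (v : Vtx)
    (ω : FieldSp) : ℝ :=
  Real.exp (β * psiFld N M sigv lamv P v ω) / ZNres N M sigv lamv P β ρ ω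

def gibbsExp (N M : ℕ) (sigv lamv : ℕ → ℝ) (P : MeasureTheory.Measure FieldSp) (β : ℝ) (s : ℕ)
    (F : (Fin s → Vtx) → ℝ) : ℝ :=
  ∫ ω, (∑ vv ∈ Fintype.piFinset (fun _ : Fin s => VN N),
    (∏ i, gibbsW N M sigv lamv P β (vv i) ω) * F vv) ∂P

def gibbsExpRes (N M : ℕ) (sigv lamv : ℕ → ℝ) (P : MeasureTheory.Measure FieldSp) (β ρ : ℝ) (s : ℕ)
    (F : (Fin s → Vtx) → FieldSp → ℝ) : ℝ :=
  ∫ ω, (∑ vv ∈ Fintype.piFinset (fun _ : Fin s => AN N ρ),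
    (∏ i, gibbsWres N M sigv lamv P β ρ (vv i) ω) * F vv ω) ∂P

def gibbsExpW (N M : ℕ) (sigv lamv : ℕ → ℝ) (P : MeasureTheory.Measure FieldSp) (β : ℝ) (s : ℕ)
    (F : (Fin s → Vtx) → FieldSp → ℝ) : ℝ :=
  ∫ ω, (∑ vv ∈ Fintype.piFinset (fun _ : Fin s => VN N),
    (∏ i, gibbsW N M sigv lamv P β (vv i) ω) * F vv ω) ∂P

def psiCov (N M : ℕ) (sigv lamv : ℕ → ℝ) (P : MeasureTheory.Measure FieldSp) (v v' : Vtx) : ℝ :=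
  ∫ ω, psiFld N M sigv lamv P v ω * psiFld N M sigv lamv P v' ω ∂P

def IsVarBound (M : ℕ) (sigv lamv : ℕ → ℝ) (P : ℕ → MeasureTheory.Measure FieldSp) (C₀ : ℝ) : Prop :=
  0 < C₀ ∧ ∃ N₀ : ℕ, ∀ N ≥ N₀, ∀ v ∈ VN N,
    psiCov N M sigv lamv (P N) v v ≤ Jsig2 M sigv lamv 1 * Real.log N + C₀

def overlapQ (N M : ℕ) (sigv lamv : ℕ → ℝ) (P : MeasureTheory.Measure FieldSp) (C₀ : ℝ) (v v' : Vtx) : ℝ :=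
  psiCov N M sigv lamv P v v' / (Jsig2 M sigv lamv 1 * Real.log N + C₀)

def TendstoInProb (P : ℕ → MeasureTheory.Measure FieldSp) (X : ℕ → FieldSp → ℝ) (c : ℝ) : Prop :=
  ∀ ε : ℝ, 0 < ε → Tendsto (fun N => P N {ω | ε < |X N ω - c|}) atTop (nhds 0)

def TendstoLp (P : ℕ → MeasureTheory.Measure FieldSp) (X : ℕ → FieldSp → ℝ) (p c : ℝ) : Prop :=
  Tendsto (fun N => ∫ ω, |X N ω - c| ^ p ∂(P N)) atTop (nhds 0)

def bScale (N : ℕ) (v v' : Vtx) : ℝ :=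
  sSup {lam : ℝ | lam ∈ Set.Icc (0:ℝ) 1 ∧ ((nbhd N lam v) ∩ (nbhd N lam v')).Nonempty}

end GFFCommon
section mine
open Finset (sum_div sum_add_distrib mem_filter sum_sub_distrib sum_congr mul_sum mem_Icc sum_comm sum_mul range mem_range sum_le_sum sum_range_succ sum_le_sum_of_subset_of_nonneg sum_nonneg Icc card_product mem_image mem_product sum_range_sub sum_filter card_le_card Ico mem_Ico sum_neg_distrib single_le_sum sum_range_add_sum_Ico mem_union sum_Ico_sub range_eq_Ico)
open Real (norm_eq_abs log log_le_log exp exp_nat_mul log_mul rpow_le_rpow_of_exponent_le toNNReal exp_pos exp_le_exp sqrt sqrt_pos sq_sqrt exp_log exp_add log_nonneg)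

noncomputable def navg (f : Vtx → ℝ) (x : Vtx) : ℝ :=
  (f (x.1 + 1, x.2) + f (x.1 - 1, x.2) + f (x.1, x.2 + 1) + f (x.1, x.2 - 1)) / 4
lemma navg_add (f g : Vtx → ℝ) (x : Vtx) : navg (fun y => f y + g y) x = navg f x + navg g x := by
  simp only [navg]; ring
lemma navg_sub (f g : Vtx → ℝ) (x : Vtx) : navg (fun y => f y - g y) x = navg f x - navg g x := by
  simp only [navg]; ring
lemma navg_smul (c : ℝ) (f : Vtx → ℝ) (x : Vtx) : navg (fun y => c * f y) x = c * navg f x := by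
  simp only [navg]; ring
lemma navg_neg (f : Vtx → ℝ) (x : Vtx) : navg (fun y => - f y) x = - navg f x := by
  simp only [navg]; ring
lemma navg_const (c : ℝ) (x : Vtx) : navg (fun _ => c) x = c := by
  simp only [navg]; ring
lemma navg_sum {ι : Type*} (s : Finset ι) (f : ι → Vtx → ℝ) (x : Vtx) :
    navg (fun y => ∑ i ∈ s, f i y) x = ∑ i ∈ s, navg (f i) x := by
  simp only [navg]; rw [← sum_div]; simp only [sum_add_distrib]
def nbr (x y : Vtx) : Prop :=
  y = (x.1 + 1, x.2) ∨ y = (x.1 - 1, x.2) ∨ y = (x.1, x.2 + 1) ∨ y = (x.1, x.2 - 1)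
lemma max_principle (D : Finset Vtx) (f : Vtx → ℝ) (A : ℝ)
    (hsub : ∀ x ∈ D, f x ≤ navg f x)
    (hb : ∀ x ∈ D, ∀ y, nbr x y → y ∉ D → f y ≤ A) : ∀ x ∈ D, f x ≤ A := by
  intro x0 hx0
  by_contra hcon
  push Not at hcon
  obtain ⟨x1, hx1, hmax⟩ := Finset.exists_max_image D f ⟨x0, hx0⟩
  set S := D.filter (fun x => f x = f x1) with hS
  obtain ⟨x, hxS, hxmax⟩ := Finset.exists_max_image S (fun x => x.1) ⟨x1, by simp [hS, hx1]⟩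
  have hxD : x ∈ D := (mem_filter.1 hxS).1
  have hfx : f x = f x1 := (mem_filter.1 hxS).2
  have hA : A < f x := by rw [hfx]; exact lt_of_lt_of_le hcon (hmax x0 hx0)
  have hn : ∀ y, nbr x y → f y ≤ f x := by
    intro y hy
    by_cases hyD : y ∈ D
    · rw [hfx]; exact hmax y hyD
    · exact (hb x hxD y hy hyD).trans hA.le
  have h1 := hn (x.1 + 1, x.2) (by simp [nbr])
  have h2 := hn (x.1 - 1, x.2) (by simp [nbr])
  have h3 := hn (x.1, x.2 + 1) (by simp [nbr])
  have h4 := hn (x.1, x.2 - 1) (by simp [nbr])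
  have h5 := hsub x hxD
  unfold navg at h5
  have h6 : f (x.1 + 1, x.2) = f x := by linarith
  by_cases hr : (x.1 + 1, x.2) ∈ D
  · have := hxmax (x.1 + 1, x.2) (by simp [hS, hr, h6, hfx])
    simp at this
  · have := hb x hxD (x.1 + 1, x.2) (by simp [nbr]) hr
    linarith
lemma min_principle (D : Finset Vtx) (f : Vtx → ℝ) (A : ℝ)
    (hsub : ∀ x ∈ D, navg f x ≤ f x)
    (hb : ∀ x ∈ D, ∀ y, nbr x y → y ∉ D → A ≤ f y) : ∀ x ∈ D, A ≤ f x := by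
  intro x hx
  have := max_principle D (fun y => - f y) (-A) (fun y hy => by
    rw [navg_neg]; linarith [hsub y hy]) (fun x hx y h1 h2 => by linarith [hb x hx y h1 h2]) x hx
  linarith
lemma harm_unique (D : Finset Vtx) (f g : Vtx → ℝ) (hf : ∀ x ∈ D, f x = navg f x)
    (hg : ∀ x ∈ D, g x = navg g x) (hfg : ∀ x ∉ D, f x = g x) : f = g := by
  have h1 := max_principle D (fun y => f y - g y) 0 (fun x hx => by
    rw [navg_sub, ← hf x hx, ← hg x hx]) (fun x _ y _ hy => by rw [hfg y hy]; simp)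
  have h2 := min_principle D (fun y => f y - g y) 0 (fun x hx => by
    rw [navg_sub, ← hf x hx, ← hg x hx]) (fun x _ y _ hy => by rw [hfg y hy]; simp)
  funext x
  by_cases hx : x ∈ D
  · linarith [h1 x hx, h2 x hx]
  · exact hfg x hx
lemma exists_dirichlet (D : Finset Vtx) (g : Vtx → ℝ) :
    ∃ f : Vtx → ℝ, (∀ x ∉ D, f x = g x) ∧ ∀ x ∈ D, f x = navg f x := by
  let e : (D → ℝ) → Vtx → ℝ := fun u x => if h : x ∈ D then u ⟨x, h⟩ else 0
  have e_in : ∀ u (x : D), e u x = u x := fun u x => by simp [e]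
  have e_out : ∀ u x, x ∉ D → e u x = 0 := fun u x hx => by simp [e, hx]
  have e_add : ∀ u w x, e (u + w) x = e u x + e w x := fun u w x => by
    by_cases hx : x ∈ D <;> simp [e, hx]
  have e_smul : ∀ (c : ℝ) u x, e (c • u) x = c * e u x := fun c u x => by
    by_cases hx : x ∈ D <;> simp [e, hx]
  let T : (D → ℝ) →ₗ[ℝ] (D → ℝ) :=
    { toFun := fun u x => u x - navg (e u) x
      map_add' := fun u w => by
        funext x
        have : e (u + w) = fun y => e u y + e w y := funext fun y => e_add u w y
        simp only [this, navg_add, Pi.add_apply]; ring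
      map_smul' := fun c u => by
        funext x
        have : e (c • u) = fun y => c * e u y := funext fun y => e_smul c u y
        simp only [this, navg_smul, Pi.smul_apply, smul_eq_mul, RingHom.id_apply]; ring }
  have hinj : Function.Injective T := by
    rw [← LinearMap.ker_eq_bot, LinearMap.ker_eq_bot']
    intro u hu
    have h0 : e u = fun _ => 0 := by
      apply harm_unique D
      · intro x hx
        have := congrFun hu ⟨x, hx⟩
        have h2 := e_in u ⟨x, hx⟩
        simp only [T, LinearMap.coe_mk, AddHom.coe_mk, Pi.zero_apply] at this h2
        linarith
      · intro x _; rw [navg_const]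
      · exact fun x hx => e_out u x hx
    funext x
    rw [← e_in u x, h0]; rfl
  have hsurj : Function.Surjective T := LinearMap.injective_iff_surjective.1 hinj
  obtain ⟨u, hu⟩ := hsurj (fun x => navg g x - g x)
  refine ⟨fun x => g x + e u x, fun x hx => by simp [e_out u x hx], fun x hx => ?_⟩
  have := congrFun hu ⟨x, hx⟩
  have h2 := e_in u ⟨x, hx⟩
  simp only [T, LinearMap.coe_mk, AddHom.coe_mk] at this h2
  rw [navg_add]; linarith
noncomputable def hD (D : Finset Vtx) (v z : Vtx) : ℝ :=
  (exists_dirichlet D (fun x => if x = z ∧ z ∉ D then 1 else 0)).choose v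
lemma hD_out {D : Finset Vtx} {v : Vtx} (hv : v ∉ D) (z : Vtx) :
    hD D v z = if v = z then 1 else 0 := by
  have := (exists_dirichlet D (fun x => if x = z ∧ z ∉ D then 1 else 0)).choose_spec.1 v hv
  rw [hD, this]
  by_cases h : v = z
  · subst h; simp [hv]
  · simp [h]
lemma hD_harm {D : Finset Vtx} {v : Vtx} (hv : v ∈ D) (z : Vtx) :
    hD D v z = navg (fun y => hD D y z) v :=
  (exists_dirichlet D (fun x => if x = z ∧ z ∉ D then 1 else 0)).choose_spec.2 v hv
lemma hD_support {D : Finset Vtx} (z : Vtx) (hz : ∀ x ∈ D, nbr x z → z ∈ D) {v : Vtx} (hv : v ∈ D) :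
    hD D v z = 0 := by
  have hb : ∀ x ∈ D, ∀ y, nbr x y → y ∉ D → hD D y z = 0 := by
    intro x hx y hxy hy
    rw [hD_out hy]
    split_ifs with h
    · subst h; exact absurd (hz x hx hxy) hy
    · rfl
  have h1 := max_principle D (fun y => hD D y z) 0 (fun x hx => (hD_harm hx z).le)
    (fun x hx y h h' => (hb x hx y h h').le) v hv
  have h2 := min_principle D (fun y => hD D y z) 0 (fun x hx => (hD_harm hx z).ge)
    (fun x hx y h h' => (hb x hx y h h').ge) v hv
  exact le_antisymm h1 h2
lemma hD_in {D : Finset Vtx} {z : Vtx} (hz : z ∈ D) (v : Vtx) : hD D v z = 0 := by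
  by_cases hv : v ∈ D
  · exact hD_support z (fun _ _ _ => hz) hv
  · rw [hD_out hv, if_neg]; rintro rfl; exact hv hz
lemma tsum_navg (f g : Vtx → ℝ) (hf : f.support.Finite) :
    ∑' x, f x * navg g x = ∑' x, navg f x * g x := by
  have key : ∀ (u w : Vtx → ℝ) (a b : ℤ), u.support.Finite →
      (Summable fun x : Vtx => u x * w (x.1 + a, x.2 + b)) := by
    intro u w a b hu
    exact summable_of_hasFiniteSupport
      (hu.subset (fun x hx => by
        simp only [Function.mem_support] at hx ⊢; exact left_ne_zero_of_mul hx))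
  have shift : ∀ (u w : Vtx → ℝ) (a b : ℤ),
      ∑' x : Vtx, u x * w (x.1 + a, x.2 + b) = ∑' x : Vtx, w x * u (x.1 + (-a), x.2 + (-b)) := by
    intro u w a b
    rw [← (Equiv.addRight ((-a, -b) : Vtx)).tsum_eq (fun x : Vtx => u x * w (x.1 + a, x.2 + b))]
    congr 1; funext x
    simp only [Equiv.coe_addRight, Prod.fst_add, Prod.snd_add, neg_add_cancel_right, mul_comm]
    rfl
  have key2 : ∀ (u w : Vtx → ℝ) (a b : ℤ), u.support.Finite →
      (Summable fun x : Vtx => w x * u (x.1 + a, x.2 + b)) := by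
    intro u w a b hu
    have h2 := (Equiv.addRight ((a, b) : Vtx)).summable_iff.2 (key u w (-a) (-b) hu)
    convert h2 using 1
    funext x
    simp only [Function.comp, Equiv.coe_addRight, Prod.fst_add, Prod.snd_add,
      add_neg_cancel_right]
    exact mul_comm _ _
  have e1 : ∀ (u w : Vtx → ℝ), (∀ a b : ℤ, Summable fun x : Vtx => u x * w (x.1 + a, x.2 + b)) →
      ∑' x, u x * navg w x =
      (∑' x : Vtx, u x * w (x.1 + 1, x.2 + 0) + ∑' x : Vtx, u x * w (x.1 + (-1), x.2 + 0)
       + ∑' x : Vtx, u x * w (x.1 + 0, x.2 + 1) + ∑' x : Vtx, u x * w (x.1 + 0, x.2 + (-1))) / 4 := by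
    intro u w h
    rw [← (h 1 0).tsum_add (h (-1) 0), ← ((h 1 0).add (h (-1) 0)).tsum_add (h 0 1),
      ← (((h 1 0).add (h (-1) 0)).add (h 0 1)).tsum_add (h 0 (-1)), ← tsum_div_const]
    congr 1; funext x
    simp only [navg, add_zero, ← sub_eq_add_neg]; ring
  have h1 := e1 f g (fun a b => key f g a b hf)
  have h2 := e1 g f (fun a b => key2 f g a b hf)
  rw [shift f g 1 0, shift f g (-1) 0, shift f g 0 1, shift f g 0 (-1)] at h1
  simp only [neg_zero, neg_neg] at h1
  simp_rw [mul_comm (navg f _)]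
  rw [h1, h2]; ring
lemma tsum_dirichlet_nonneg (f : Vtx → ℝ) (hf : f.support.Finite) :
    0 ≤ ∑' x, f x * (f x - navg f x) := by
  have hs : ∀ w : Vtx → ℝ, Summable fun x => f x * w x := fun w =>
    summable_of_hasFiniteSupport (hf.subset (fun x hx => by
        simp only [Function.mem_support] at hx ⊢; exact left_ne_zero_of_mul hx))
  have hs2 : Summable fun x => f x * navg f x := hs _
  have h1 := tsum_navg (fun x => f x * f x) (fun _ => 1) (by
    simpa [Function.support] using hf)
  simp only [navg_const, mul_one] at h1
  have hsq : Summable fun x => f x * f x := hs f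
  have hav : Summable fun x => navg (fun y => f y * f y) x := by
    by_contra hcon
    rw [tsum_eq_zero_of_not_summable hcon] at h1
    have h0 : ∀ x, f x * f x = 0 := by
      have := (hasSum_zero_iff_of_nonneg (fun x => mul_self_nonneg (f x))).1 (h1 ▸ hsq.hasSum)
      exact fun x => congrFun this x
    exact hcon (by simp only [h0, navg_const]; exact summable_zero)
  have h2 : ∑' x, (f x * f x + navg (fun y => f y * f y) x - 2 * (f x * navg f x)) =
      2 * ∑' x, f x * (f x - navg f x) := by
    rw [(hsq.add hav).tsum_sub (hs2.mul_left 2), hsq.tsum_add hav, ← h1, tsum_mul_left]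
    simp_rw [mul_sub]
    rw [hsq.tsum_sub hs2]; ring
  have h3 : 0 ≤ ∑' x, (f x * f x + navg (fun y => f y * f y) x - 2 * (f x * navg f x)) := by
    apply tsum_nonneg
    intro x
    simp only [navg]
    nlinarith [sq_nonneg (f x - f (x.1 + 1, x.2)), sq_nonneg (f x - f (x.1 - 1, x.2)),
      sq_nonneg (f x - f (x.1, x.2 + 1)), sq_nonneg (f x - f (x.1, x.2 - 1))]
  linarith
def IsGr (D : Finset Vtx) (G : Vtx → Vtx → ℝ) : Prop :=
  (∀ x y : Vtx, x ∉ D ∨ y ∉ D → G x y = 0) ∧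
  ∀ y ∈ D, ∀ x ∈ D, G x y = navg (fun z => G z y) x + Real.pi / 2 * (if x = y then 1 else 0)
lemma IsGreenFn.isGr {B : Finset Vtx} {G : Vtx → Vtx → ℝ} (h : IsGreenFn B G) : IsGr (intr B) G :=
  ⟨h.1, fun y hy x hx => by simpa [navg] using h.2 y hy x hx⟩
lemma IsGr.finsupp {D : Finset Vtx} {G : Vtx → Vtx → ℝ} (h : IsGr D G) (y : Vtx) :
    (Function.support fun x => G x y).Finite :=
  D.finite_toSet.subset fun x hx => by
    by_contra hc; exact hx (h.1 x y (Or.inl hc))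
lemma IsGr.lap {D : Finset Vtx} {G : Vtx → Vtx → ℝ} (h : IsGr D G) (y : Vtx) (u : Vtx → ℝ)
    (hu : ∀ x ∉ D, u x = 0) (x : Vtx) :
    u x * (G x y - navg (fun z => G z y) x) = if x = y then Real.pi / 2 * u y else 0 := by
  by_cases hx : x ∈ D
  · by_cases hy : y ∈ D
    · rw [h.2 y hy x hx]; split_ifs with hxy
      · subst hxy; ring
      · ring
    · have : (fun z => G z y) = fun _ => 0 := funext fun z => h.1 z y (Or.inr hy)
      rw [this, navg_const, h.1 x y (Or.inr hy), hu y hy]; simp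
  · rw [hu x hx]; split_ifs with hxy
    · subst hxy; rw [hu x hx]; ring
    · ring
lemma IsGr.symm {D : Finset Vtx} {G : Vtx → Vtx → ℝ} (h : IsGr D G) (a b : Vtx) : G a b = G b a := by
  have hu : ∀ c, ∀ x ∉ D, G x c = 0 := fun c x hx => h.1 x c (Or.inl hx)
  have hval : ∀ a b, ∑' x, G x a * (G x b - navg (fun z => G z b) x) = Real.pi / 2 * G b a := by
    intro a b
    simp_rw [h.lap b (fun x => G x a) (hu a)]
    rw [tsum_ite_eq]
  have hs : ∀ (a : Vtx) (w : Vtx → ℝ), Summable fun x => G x a * w x := fun a w =>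
    summable_of_hasFiniteSupport ((h.finsupp a).subset (fun x hx => by
        simp only [Function.mem_support] at hx ⊢; exact left_ne_zero_of_mul hx))
  have e : ∀ a b, ∑' x, G x a * (G x b - navg (fun z => G z b) x) =
      ∑' x, G x a * G x b - ∑' x, G x a * navg (fun z => G z b) x := by
    intro a b; simp_rw [mul_sub]; rw [(hs a _).tsum_sub (hs a _)]
  have h1 := hval a b
  have h2 := hval b a
  rw [e] at h1 h2
  have h3 := tsum_navg (fun x => G x a) (fun x => G x b) (h.finsupp a)
  simp_rw [mul_comm (navg (fun x => G x a) _)] at h3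
  simp_rw [mul_comm (G _ b) (G _ a)] at h2
  have : Real.pi / 2 * G a b = Real.pi / 2 * G b a := by linarith
  exact mul_left_cancel₀ (by positivity) this
lemma IsGr.psd {D : Finset Vtx} {G : Vtx → Vtx → ℝ} (h : IsGr D G) (V : Finset Vtx) (c : Vtx → ℝ) :
    0 ≤ ∑ v ∈ V, ∑ w ∈ V, c v * c w * G v w := by
  set f : Vtx → ℝ := fun x => ∑ w ∈ V, c w * G x w with hf
  have hfout : ∀ x ∉ D, f x = 0 := fun x hx =>
    Finset.sum_eq_zero fun w _ => by rw [h.1 x w (Or.inl hx), mul_zero]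
  have hfin : f.support.Finite := D.finite_toSet.subset fun x hx => by
    by_contra hc; exact hx (hfout x hc)
  have h0 := tsum_dirichlet_nonneg f hfin
  have : ∀ x, f x * (f x - navg f x) = ∑ w ∈ V, if x = w then Real.pi / 2 * (c w * f w) else 0 := by
    intro x
    have e1 : f x - navg f x = ∑ w ∈ V, c w * (G x w - navg (fun z => G z w) x) := by
      have := navg_sum V (fun w x => c w * G x w) x
      simp only [navg_smul] at this
      rw [hf, this, ← sum_sub_distrib]
      exact sum_congr rfl fun w _ => by ring
    rw [e1, mul_sum]
    refine sum_congr rfl fun w _ => ?_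
    have := h.lap w f hfout x
    rw [mul_left_comm, this]; split_ifs <;> ring
  simp_rw [this] at h0
  rw [Summable.tsum_finsetSum (fun w _ => (hasSum_ite_eq w _).summable)] at h0
  simp_rw [tsum_ite_eq] at h0
  rw [← mul_sum] at h0
  have h1 : 0 ≤ ∑ w ∈ V, c w * f w := by
    by_contra hc; push Not at hc
    nlinarith [Real.pi_pos]
  convert h1 using 2 with v _
  rw [hf, mul_sum]
  exact sum_congr rfl fun w _ => by ring
section potential
open Real MeasureTheory intervalIntegral
noncomputable def rhoP (t : ℝ) : ℝ := cos t / (1 + sin t)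
noncomputable def FP (u : ℤ) (n : ℕ) (t : ℝ) : ℝ := (1 - cos (u * t) * rhoP t ^ n) / sin t
noncomputable def aP (x : Vtx) : ℝ := ∫ t in (0:ℝ)..(π / 2), FP (x.1 + x.2) (x.1 - x.2).natAbs t
lemma trig_facts {t : ℝ} (h0 : 0 < t) (h1 : t ≤ π / 2) :
    0 < sin t ∧ 0 ≤ cos t ∧ 2 / π * t ≤ sin t ∧ sin t ^ 2 + cos t ^ 2 = 1 :=
  ⟨sin_pos_of_pos_of_lt_pi h0 (by linarith [pi_pos]),
   cos_nonneg_of_neg_pi_div_two_le_of_le (by linarith [pi_pos]) h1,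
   mul_le_sin h0.le h1, sin_sq_add_cos_sq t⟩
lemma rhoP_facts {t : ℝ} (h0 : 0 < t) (h1 : t ≤ π / 2) :
    0 ≤ rhoP t ∧ rhoP t ≤ 1 ∧ 1 - rhoP t ≤ 2 * sin t ∧ rhoP t * (1 + sin t) ≤ 1 := by
  obtain ⟨hs, hc, _, h⟩ := trig_facts h0 h1
  have hc1 : cos t ≤ 1 := cos_le_one t
  have hs1 := sin_le_one t
  have h2 : rhoP t * (1 + sin t) = cos t := by unfold rhoP; field_simp
  have h3 : 0 ≤ rhoP t := by unfold rhoP; positivity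
  refine ⟨h3, ?_, ?_, ?_⟩
  · nlinarith
  · nlinarith
  · linarith
lemma FP_bound (u : ℤ) (n : ℕ) {t : ℝ} (h0 : 0 < t) (h1 : t ≤ π / 2) :
    |FP u n t| ≤ π / 2 * |(u : ℝ)| + 2 * n := by
  obtain ⟨hs, hc, hj, h⟩ := trig_facts h0 h1
  obtain ⟨r0, r1, r2, _⟩ := rhoP_facts h0 h1
  unfold FP
  rw [abs_div, abs_of_pos hs, div_le_iff₀ hs]
  have e1 : |1 - cos (u * t)| ≤ |(u:ℝ)| * t := by
    have : |1 - cos (u*t)| = 1 - cos (u*t) := abs_of_nonneg (by linarith [cos_le_one (u*t)])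
    rw [this]
    by_cases hx : |(u:ℝ) * t| ≤ 2
    · have := one_sub_sq_div_two_le_cos (x := u * t)
      have h5 : |(u:ℝ)*t| = |(u:ℝ)| * t := by rw [abs_mul, abs_of_pos h0]
      rw [← h5]
      nlinarith [sq_abs ((u:ℝ)*t), abs_nonneg ((u:ℝ)*t)]
    · push Not at hx
      have h5 : |(u:ℝ)*t| = |(u:ℝ)| * t := by rw [abs_mul, abs_of_pos h0]
      rw [← h5]; linarith [neg_one_le_cos (u*t)]
  have e2 : 1 - rhoP t ^ n ≤ n * (2 * sin t) := by
    have := one_add_mul_le_pow (a := rhoP t - 1) (by linarith) n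
    simp only [add_sub_cancel] at this
    have hn : (0:ℝ) ≤ n := n.cast_nonneg
    nlinarith
  have e3 : 0 ≤ 1 - rhoP t ^ n := by linarith [pow_le_one₀ r0 r1 (n := n)]
  have e4 : 1 - cos (u*t) * rhoP t ^ n = (1 - cos (u*t)) + cos (u*t) * (1 - rhoP t ^ n) := by ring
  have e5 : |cos (u*t) * (1 - rhoP t ^ n)| ≤ 1 - rhoP t ^ n := by
    rw [abs_mul, abs_of_nonneg e3]
    exact mul_le_of_le_one_left e3 (abs_cos_le_one _)
  rw [e4]
  have ht : t ≤ π / 2 * sin t := by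
    have := mul_le_mul_of_nonneg_left hj (show 0 ≤ π / 2 by positivity)
    field_simp at this ⊢; linarith
  calc _ ≤ |1 - cos (u*t)| + |cos (u*t) * (1 - rhoP t ^ n)| := abs_add_le _ _
    _ ≤ |(u:ℝ)| * t + n * (2 * sin t) := by linarith
    _ ≤ |(u:ℝ)| * (π / 2 * sin t) + n * (2 * sin t) := by gcongr
    _ = _ := by ring
lemma FP_meas (u : ℤ) (n : ℕ) : Measurable (FP u n) := by
  unfold FP rhoP; fun_prop
lemma FP_int (u : ℤ) (n : ℕ) {a b : ℝ} (ha : 0 ≤ a) (hab : a ≤ b) (hb : b ≤ π / 2) :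
    IntervalIntegrable (FP u n) volume a b := by
  rw [intervalIntegrable_iff_integrableOn_Ioc_of_le hab]
  refine Measure.integrableOn_of_bounded (M := π / 2 * |(u : ℝ)| + 2 * n) (by simp)
    (FP_meas u n).aestronglyMeasurable ?_
  rw [ae_restrict_iff' measurableSet_Ioc]
  refine ae_of_all _ fun t ht => ?_
  exact FP_bound u n (lt_of_le_of_lt ha ht.1) (ht.2.trans hb)
lemma FP_avg (u v : ℤ) {t : ℝ} (h0 : 0 < t) (h1 : t ≤ π / 2) :
    (FP (u+1) (v+1).natAbs t + FP (u-1) (v-1).natAbs t + FP (u+1) (v-1).natAbs t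
      + FP (u-1) (v+1).natAbs t) / 4 = FP u v.natAbs t + (if v = 0 then cos (u * t) else 0) := by
  obtain ⟨hs, hc, hj, h⟩ := trig_facts h0 h1
  have hs' : sin t ≠ 0 := hs.ne'
  have hr : rhoP t * (1 + sin t) = cos t := by unfold rhoP; field_simp
  have hrc : rhoP t * cos t = 1 - sin t := by
    have h1s : (1 + sin t) ≠ 0 := by positivity
    unfold rhoP; field_simp; nlinarith
  have hr2 : (rhoP t ^ 2 + 1) * cos t = 2 * rhoP t := by
    have : rhoP t ^ 2 * cos t = rhoP t * (1 - sin t) := by rw [← hrc]; ring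
    nlinarith
  have c1 : cos (((u+1 : ℤ):ℝ) * t) + cos (((u-1 : ℤ):ℝ) * t) = 2 * cos (u*t) * cos t := by
    push_cast
    rw [add_mul, sub_mul, one_mul, cos_add, cos_sub]; ring
  have key : (rhoP t ^ (v+1).natAbs + rhoP t ^ (v-1).natAbs) * cos t =
      2 * rhoP t ^ v.natAbs - (if v = 0 then 2 * sin t else 0) := by
    by_cases hv : v = 0
    · subst hv; simp; linarith
    · rw [if_neg hv]
      obtain ⟨k, hk⟩ : ∃ k, v.natAbs = k + 1 := ⟨v.natAbs - 1, by omega⟩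
      have h2 : (rhoP t ^ (v+1).natAbs + rhoP t ^ (v-1).natAbs) = rhoP t ^ (k+2) + rhoP t ^ k := by
        rcases lt_or_gt_of_ne hv with hv | hv
        · rw [show (v+1).natAbs = k by omega, show (v-1).natAbs = k+2 by omega]; ring
        · rw [show (v+1).natAbs = k+2 by omega, show (v-1).natAbs = k by omega]
      rw [h2, hk, show (rhoP t ^ (k+2) + rhoP t ^ k) * cos t =
        rhoP t ^ k * ((rhoP t ^ 2 + 1) * cos t) by ring, hr2]; ring
  have e : (FP (u+1) (v+1).natAbs t + FP (u-1) (v-1).natAbs t + FP (u+1) (v-1).natAbs t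
      + FP (u-1) (v+1).natAbs t) / 4 = (1 - cos (u*t) * ((rhoP t ^ (v+1).natAbs + rhoP t ^ (v-1).natAbs) * cos t) / 2) / sin t := by
    unfold FP
    rw [show cos (u*t) * ((rhoP t ^ (v+1).natAbs + rhoP t ^ (v-1).natAbs) * cos t) =
      (2 * cos (u*t) * cos t) / 2 * (rhoP t ^ (v+1).natAbs + rhoP t ^ (v-1).natAbs) by ring, ← c1]
    field_simp; ring
  rw [e, key]; unfold FP
  split_ifs <;> field_simp <;> ring
lemma aP_avg (x : Vtx) : navg aP x = aP x + π / 2 * (if x = 0 then 1 else 0) := by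
  have hpi : (0:ℝ) ≤ π / 2 := by positivity
  have I := fun u n => FP_int u n le_rfl hpi le_rfl
  set u := x.1 + x.2 with hu
  set v := x.1 - x.2 with hv
  have e : navg aP x = ∫ t in (0:ℝ)..(π/2), (FP (u+1) (v+1).natAbs t + FP (u-1) (v-1).natAbs t + FP (u+1) (v-1).natAbs t
      + FP (u-1) (v+1).natAbs t) / 4 := by
    rw [intervalIntegral.integral_div, integral_add (((I _ _).add (I _ _)).add (I _ _)) (I _ _),
      integral_add ((I _ _).add (I _ _)) (I _ _), integral_add (I _ _) (I _ _)]
    simp only [navg, aP]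
    rw [show x.1 + 1 + x.2 = u + 1 by omega, show x.1 + 1 - x.2 = v + 1 by omega,
      show x.1 - 1 + x.2 = u - 1 by omega, show x.1 - 1 - x.2 = v - 1 by omega,
      show x.1 + (x.2 + 1) = u + 1 by omega, show x.1 - (x.2 + 1) = v - 1 by omega,
      show x.1 + (x.2 - 1) = u - 1 by omega, show x.1 - (x.2 - 1) = v + 1 by omega]
  have e2 : navg aP x = ∫ t in (0:ℝ)..(π/2), (FP u v.natAbs t + (if v = 0 then cos (u * t) else 0)) := by
    rw [e]
    refine intervalIntegral.integral_congr_ae (ae_of_all _ fun t ht => ?_)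
    rw [Set.uIoc_of_le hpi] at ht
    exact FP_avg u v ht.1 ht.2
  rw [e2, integral_add (I _ _) (by split_ifs <;> exact Continuous.intervalIntegrable (by fun_prop) _ _)]
  congr 1
  by_cases hv0 : v = 0
  · simp only [hv0, if_true]
    by_cases hx : x = 0
    · have : u = 0 := by rw [hu, hx]; rfl
      simp [this, hx]
    · have hu0 : x.1 ≠ 0 := by
        intro h; apply hx; ext <;> simp <;> omega
      have hu2 : u = 2 * x.1 := by omega
      rw [if_neg hx, mul_zero]
      have hne : (u:ℝ) ≠ 0 := by exact_mod_cast (by omega : u ≠ 0)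
      rw [intervalIntegral.integral_comp_mul_left (fun y => cos y) hne, integral_cos, hu2]
      push_cast
      rw [show 2 * (x.1:ℝ) * (π/2) = x.1 * π by ring, sin_int_mul_pi]; simp
  · have hx : x ≠ 0 := by rintro rfl; exact hv0 rfl
    simp [hv0, hx]
end potential
section pb2
open Real MeasureTheory intervalIntegral
lemma aP_zero : aP 0 = 0 := by
  simp [aP, FP]
lemma inv_sin_bound {t : ℝ} (h0 : 0 < t) (h1 : t ≤ π / 2) : |1 / sin t - 1 / t| ≤ 2 := by
  obtain ⟨hs, hc, hj, h⟩ := trig_facts h0 h1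
  have hst : sin t ≤ t := (sin_lt h0).le
  have h3 : 1 / t ≤ 1 / sin t := one_div_le_one_div_of_le hs hst
  rw [abs_of_nonneg (by linarith)]
  have hpi := pi_pos
  have hpi4 := pi_lt_four
  by_cases ht : t ≤ 1
  · have hc := sin_gt_sub_cube h0
    rw [div_sub_div _ _ hs.ne' h0.ne', div_le_iff₀ (by positivity)]
    have : t / 2 ≤ sin t := by
      refine le_trans ?_ hj
      rw [div_mul_eq_mul_div, div_le_div_iff₀ (by norm_num) hpi]; nlinarith
    nlinarith [mul_le_mul_of_nonneg_right this h0.le, mul_nonneg (sq_nonneg t) (sub_nonneg.2 ht), sq_nonneg t]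
  · push Not at ht
    have : 1 / 2 ≤ sin t := by
      refine le_trans ?_ hj
      rw [div_mul_eq_mul_div, div_le_div_iff₀ (by norm_num) hpi]; nlinarith
    have : 1 / sin t ≤ 2 := by rw [div_le_iff₀ hs]; linarith
    have : 0 < 1 / t := by positivity
    linarith
noncomputable def gP (n : ℕ) (t : ℝ) : ℝ := rhoP t ^ n / sin t
noncomputable def gP' (n : ℕ) (t : ℝ) : ℝ :=
  ((n * rhoP t ^ (n - 1) * (-1 / (1 + sin t))) * sin t - rhoP t ^ n * cos t) / sin t ^ 2
lemma rhoP_deriv {t : ℝ} (h0 : 0 < t) (h1 : t ≤ π / 2) :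
    HasDerivAt rhoP (-1 / (1 + sin t)) t := by
  obtain ⟨hs, hc, hj, h⟩ := trig_facts h0 h1
  have h1s : (1 + sin t) ≠ 0 := by positivity
  have := (hasDerivAt_cos t).div ((hasDerivAt_sin t).const_add 1) h1s
  refine this.congr_deriv ?_
  field_simp; nlinarith
lemma gP_deriv (n : ℕ) {t : ℝ} (h0 : 0 < t) (h1 : t ≤ π / 2) :
    HasDerivAt (gP n) (gP' n t) t := by
  have := ((rhoP_deriv h0 h1).pow n).div (hasDerivAt_sin t) (trig_facts h0 h1).1.ne'
  exact this
lemma gP'_nonpos (n : ℕ) {t : ℝ} (h0 : 0 < t) (h1 : t ≤ π / 2) : gP' n t ≤ 0 := by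
  obtain ⟨hs, hc, hj, h⟩ := trig_facts h0 h1
  obtain ⟨r0, r1, r2, _⟩ := rhoP_facts h0 h1
  unfold gP'
  refine div_nonpos_of_nonpos_of_nonneg ?_ (by positivity)
  have e : (n * rhoP t ^ (n - 1) * (-1 / (1 + sin t))) * sin t =
    - (n * rhoP t ^ (n - 1) * (1 / (1 + sin t)) * sin t) := by ring
  have : 0 ≤ (n * rhoP t ^ (n - 1) * (1 / (1 + sin t)) * sin t) := by positivity
  have : 0 ≤ rhoP t ^ n * cos t := by positivity
  linarith
lemma gP'_cont (n : ℕ) {a : ℝ} (ha : 0 < a) : ContinuousOn (gP' n) (Set.Icc a (π/2)) := by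
  unfold gP' rhoP
  have hs : ∀ t ∈ Set.Icc a (π/2), sin t ≠ 0 := fun t ht => (trig_facts (ha.trans_le ht.1) ht.2).1.ne'
  have hs' : ∀ t ∈ Set.Icc a (π/2), 1 + sin t ≠ 0 := fun t ht => by
    have := (trig_facts (ha.trans_le ht.1) ht.2).1; positivity
  have hs2 : ∀ t ∈ Set.Icc a (π/2), sin t ^ 2 ≠ 0 := fun t ht => pow_ne_zero _ (hs t ht)
  refine ContinuousOn.div ?_ (by fun_prop) hs2
  have c1 : ContinuousOn (fun t => cos t / (1 + sin t)) (Set.Icc a (π/2)) :=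
    ContinuousOn.div (by fun_prop) (by fun_prop) hs'
  have c2 : ContinuousOn (fun t => -1 / (1 + sin t)) (Set.Icc a (π/2)) :=
    ContinuousOn.div (by fun_prop) (by fun_prop) hs'
  fun_prop
lemma gP_cont (n : ℕ) {a : ℝ} (ha : 0 < a) : ContinuousOn (gP n) (Set.Icc a (π/2)) :=
  fun t ht => ((gP_deriv n (ha.trans_le ht.1) ht.2).continuousAt).continuousWithinAt
lemma gP_nonneg (n : ℕ) {t : ℝ} (h0 : 0 < t) (h1 : t ≤ π / 2) : 0 ≤ gP n t := by
  obtain ⟨hs, _⟩ := trig_facts h0 h1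
  obtain ⟨r0, _⟩ := rhoP_facts h0 h1
  unfold gP; positivity
lemma gP_le (n : ℕ) {t : ℝ} (h0 : 0 < t) (h1 : t ≤ π / 2) : gP n t ≤ π / 2 / t := by
  obtain ⟨hs, _, hj, _⟩ := trig_facts h0 h1
  obtain ⟨r0, r1, _⟩ := rhoP_facts h0 h1
  unfold gP
  rw [div_le_div_iff₀ hs h0]
  have h2 := pow_le_one₀ r0 r1 (n := n)
  have h3 : t ≤ π / 2 * sin t := by
    have := mul_le_mul_of_nonneg_left hj (show 0 ≤ π / 2 by positivity)
    have hp := pi_pos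
    field_simp at this ⊢; linarith
  nlinarith
lemma osc1 (u : ℤ) (n : ℕ) {a : ℝ} (ha : 0 < a) (ha2 : a ≤ π / 2) (hu : |(u:ℝ)| = 1 / a) :
    |∫ t in a..(π/2), cos (u * t) * gP n t| ≤ 4 := by
  have hIcc : Set.uIcc a (π/2) = Set.Icc a (π/2) := Set.uIcc_of_le ha2
  have hu0 : (u:ℝ) ≠ 0 := by
    intro h; rw [h, abs_zero] at hu; have : 0 < 1 / a := by positivity
    linarith
  have I1 : IntervalIntegrable (gP' n) volume a (π/2) := by
    apply ContinuousOn.intervalIntegrable; rw [hIcc]; exact gP'_cont n ha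
  have dv : ∀ x ∈ Set.uIcc a (π/2), HasDerivAt (fun t => sin (u*t) / u) (cos (u * x)) x := by
    intro x _
    have := (((hasDerivAt_id x).const_mul (u:ℝ)).sin).div_const (u:ℝ)
    refine this.congr_deriv ?_
    field_simp; simp
  have dg : ∀ x ∈ Set.uIcc a (π/2), HasDerivAt (gP n) (gP' n x) x := by
    intro x hx; rw [hIcc] at hx; exact gP_deriv n (ha.trans_le hx.1) hx.2
  have ibp := integral_mul_deriv_eq_deriv_mul dg dv I1
    (Continuous.intervalIntegrable (by fun_prop) _ _)
  have ftc := integral_eq_sub_of_hasDerivAt dg I1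
  simp_rw [mul_comm (cos _)]
  rw [ibp]
  have hsb : ∀ t, |sin (u*t) / u| ≤ a := fun t => by
    rw [abs_div, hu, div_div_eq_mul_div, div_one]
    exact mul_le_of_le_one_left ha.le (abs_sin_le_one _)
  have hb : |∫ x in a..(π/2), gP' n x * (sin (u*x) / u)| ≤ ∫ x in a..(π/2), a * (- gP' n x) := by
    rw [← norm_eq_abs]
    refine norm_integral_le_of_norm_le ha2 (ae_of_all _ fun t ht => ?_) (I1.neg.const_mul a)
    have := gP'_nonpos n (ha.trans ht.1) ht.2
    rw [norm_eq_abs, abs_mul, abs_of_nonpos this, mul_comm]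
    exact mul_le_mul_of_nonneg_right (hsb t) (by linarith)
  rw [intervalIntegral.integral_const_mul, intervalIntegral.integral_neg, ftc] at hb
  have hg1 := gP_le n ha ha2
  have hg0 := gP_nonneg n ha ha2
  have hgb := gP_nonneg n (show 0 < π/2 by positivity) le_rfl
  have e1 : |gP n (π/2) * (sin (u * (π/2)) / u)| ≤ gP n (π/2) * a := by
    rw [abs_mul, abs_of_nonneg hgb]; exact mul_le_mul_of_nonneg_left (hsb _) hgb
  have e2 : |gP n a * (sin (u * a) / u)| ≤ gP n a * a := by
    rw [abs_mul, abs_of_nonneg hg0]; exact mul_le_mul_of_nonneg_left (hsb _) hg0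
  have e3 : gP n a * a ≤ π / 2 := by rwa [le_div_iff₀ ha] at hg1
  have hp := pi_lt_four
  rw [abs_le] at *
  constructor <;> nlinarith
lemma osc2 (u : ℤ) (n : ℕ) {a : ℝ} (ha : 0 < a) (ha2 : a ≤ π / 2) (hn : (n:ℝ) = 1 / a) :
    |∫ t in a..(π/2), cos (u * t) * gP n t| ≤ 4 := by
  have hp := pi_lt_four
  have hpp := pi_pos
  have dv : ∀ x ∈ Set.uIcc a (π/2), HasDerivAt (fun t => -(4 * a / t)) (4 * a / x^2) x := by
    intro x hx; rw [Set.uIcc_of_le ha2] at hx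
    have hx0 : x ≠ 0 := (ha.trans_le hx.1).ne'
    have := ((hasDerivAt_inv hx0).const_mul (4*a)).neg
    refine (this.congr_deriv ?_)
    field_simp
  have I : IntervalIntegrable (fun x => 4 * a / x^2) volume a (π/2) := by
    apply ContinuousOn.intervalIntegrable; rw [Set.uIcc_of_le ha2]
    exact ContinuousOn.div (by fun_prop) (by fun_prop) fun x hx => pow_ne_zero _ (ha.trans_le hx.1).ne'
  have ftc := integral_eq_sub_of_hasDerivAt dv I
  rw [← norm_eq_abs]
  refine (norm_integral_le_of_norm_le ha2 (g := fun x => 4 * a / x^2) (ae_of_all _ fun t ht => ?_) I).trans ?_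
  · have t0 := ha.trans ht.1
    obtain ⟨hs, _, hj, _⟩ := trig_facts t0 ht.2
    obtain ⟨r0, r1, _, r3⟩ := rhoP_facts t0 ht.2
    rw [norm_eq_abs, abs_mul, abs_of_nonneg (gP_nonneg n t0 ht.2)]
    refine (mul_le_of_le_one_left (gP_nonneg n t0 ht.2) (abs_cos_le_one _)).trans ?_
    unfold gP
    have h1 : rhoP t ^ n * (n * sin t) ≤ 1 := by
      have b := one_add_mul_le_pow (a := sin t) (by linarith) n
      have c : rhoP t ^ n * (1 + sin t) ^ n ≤ 1 := by
        rw [← mul_pow]; exact pow_le_one₀ (by positivity) r3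
      have d : 0 ≤ rhoP t ^ n := by positivity
      nlinarith
    rw [hn] at h1
    have h2 : rhoP t ^ n * sin t ≤ a := by
      have := mul_le_mul_of_nonneg_left h1 ha.le
      field_simp at this; linarith
    rw [div_le_div_iff₀ hs (by positivity)]
    have h3 : t / 2 ≤ sin t := by
      refine le_trans ?_ hj
      rw [div_mul_eq_mul_div, div_le_div_iff₀ (by norm_num) hpp]; nlinarith
    have d : 0 ≤ rhoP t ^ n := by positivity
    have h4 : t^2 ≤ 4 * sin t * sin t := by nlinarith
    calc rhoP t ^ n * t^2 ≤ rhoP t ^ n * (4 * sin t * sin t) := by gcongr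
      _ = 4 * (rhoP t ^ n * sin t) * sin t := by ring
      _ ≤ 4 * a * sin t := by gcongr
  · rw [ftc]
    have : 4 * a / a = 4 := by field_simp
    rw [this]
    have : 0 ≤ 4 * a / (π/2) := by positivity
    linarith
lemma aP_log {x : Vtx} (hx : x ≠ 0) : |aP x - log (|(x.1:ℝ)| + |(x.2:ℝ)|)| ≤ 30 := by
  have hp := pi_lt_four
  have hp3 := pi_gt_three
  set L : ℝ := |(x.1:ℝ)| + |(x.2:ℝ)| with hL
  set u := x.1 + x.2 with hu
  set n := (x.1 - x.2).natAbs with hn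
  have q1 := Int.abs_eq_natAbs x.1
  have q2 := Int.abs_eq_natAbs x.2
  have q3 := Int.abs_eq_natAbs u
  have hLz : L = ((|x.1| + |x.2| : ℤ) : ℝ) := by push_cast; rfl
  have hL1 : 1 ≤ L := by
    rw [hLz]; norm_cast
    by_contra hc
    apply hx; ext <;> simp <;> omega
  have hcase : |(u:ℝ)| = L ∨ (n:ℝ) = L := by
    rw [hLz]
    have : |u| = |x.1| + |x.2| ∨ (n:ℤ) = |x.1| + |x.2| := by omega
    rcases this with h | h
    · left; exact_mod_cast congrArg (Int.cast (R := ℝ)) h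
    · right; exact_mod_cast congrArg (Int.cast (R := ℝ)) h
  have huL : |(u:ℝ)| ≤ L := by
    rw [hLz]; exact_mod_cast (show |u| ≤ |x.1| + |x.2| by omega)
  have hnL : (n:ℝ) ≤ L := by
    rw [hLz]; exact_mod_cast (show (n:ℤ) ≤ |x.1| + |x.2| by omega)
  have hL0 : 0 < L := by linarith
  set a := 1 / L with ha
  have ha0 : 0 < a := by positivity
  have ha1 : a ≤ 1 := by rw [ha, div_le_one hL0]; exact hL1
  have ha2 : a ≤ π / 2 := by linarith
  have haL : L = 1 / a := by rw [ha]; simp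
  have split : aP x = (∫ t in (0:ℝ)..a, FP u n t) + ∫ t in a..(π/2), FP u n t :=
    (integral_add_adjacent_intervals (FP_int u n le_rfl ha0.le ha2) (FP_int u n ha0.le ha2 le_rfl)).symm
  have b1 : |∫ t in (0:ℝ)..a, FP u n t| ≤ 8 := by
    have : ∀ t ∈ Set.uIoc 0 a, ‖FP u n t‖ ≤ 4 * L := by
      intro t ht
      rw [Set.uIoc_of_le ha0.le] at ht
      refine (FP_bound u n ht.1 (ht.2.trans ha2)).trans ?_
      have : π / 2 * |(u:ℝ)| ≤ 2 * L := mul_le_mul (by linarith) huL (abs_nonneg _) (by norm_num)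
      linarith
    have := norm_integral_le_of_norm_le_const this
    rw [norm_eq_abs, sub_zero, abs_of_pos ha0] at this
    refine this.trans ?_
    rw [ha]; field_simp; norm_num
  have hIcc : Set.uIcc a (π/2) = Set.Icc a (π/2) := Set.uIcc_of_le ha2
  have I1 : IntervalIntegrable (fun t => 1 / sin t) volume a (π/2) := by
    apply ContinuousOn.intervalIntegrable; rw [hIcc]
    exact ContinuousOn.div (by fun_prop) (by fun_prop) fun t ht => (trig_facts (ha0.trans_le ht.1) ht.2).1.ne'
  have I2 : IntervalIntegrable (fun t => 1 / t) volume a (π/2) := by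
    apply ContinuousOn.intervalIntegrable; rw [hIcc]
    exact ContinuousOn.div (by fun_prop) (by fun_prop) fun t ht => (ha0.trans_le ht.1).ne'
  have I3 : IntervalIntegrable (fun t => cos (u*t) * gP n t) volume a (π/2) := by
    apply ContinuousOn.intervalIntegrable; rw [hIcc]
    exact ContinuousOn.mul (by fun_prop) (gP_cont n ha0)
  have s2 : (∫ t in a..(π/2), FP u n t) = (∫ t in a..(π/2), (1 / sin t - 1 / t)) +
      (∫ t in a..(π/2), 1 / t) - ∫ t in a..(π/2), cos (u*t) * gP n t := by
    rw [← integral_add (I1.sub I2) I2, ← integral_sub ((I1.sub I2).add I2) I3]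
    congr 1; ext t; unfold FP gP; ring
  have b2 : |∫ t in a..(π/2), (1 / sin t - 1 / t)| ≤ 8 := by
    have : ∀ t ∈ Set.uIoc a (π/2), ‖1 / sin t - 1 / t‖ ≤ 2 := by
      intro t ht
      rw [Set.uIoc_of_le ha2] at ht
      exact inv_sin_bound (ha0.trans ht.1) ht.2
    have := norm_integral_le_of_norm_le_const this
    rw [norm_eq_abs, abs_of_nonneg (by linarith : 0 ≤ π/2 - a)] at this
    linarith
  have b3 : (∫ t in a..(π/2), 1 / t) = log (π/2) + log L := by
    rw [integral_one_div_of_pos ha0 (by positivity), ha, div_div_eq_mul_div, div_one,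
      log_mul (by positivity) (by positivity)]
  have b4 : |log (π/2)| ≤ 1 := by
    have : 0 ≤ log (π/2) := log_nonneg (by linarith)
    rw [abs_of_nonneg this]
    have := log_le_sub_one_of_pos (show 0 < π/2 by positivity)
    linarith
  have b5 : |∫ t in a..(π/2), cos (u * t) * gP n t| ≤ 4 := by
    rcases hcase with h | h
    · exact osc1 u n ha0 ha2 (h.trans haL)
    · exact osc2 u n ha0 ha2 (h.trans haL)
  rw [split, s2, b3]
  rw [abs_le] at *
  constructor <;> linarith
end pb2
def n1 (x : Vtx) : ℕ := x.1.natAbs + x.2.natAbs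
noncomputable def lg (n : ℕ) : ℝ := log ((max 1 n : ℕ) : ℝ)
lemma lg_mono {n m : ℕ} (h : n ≤ m) : lg n ≤ lg m := by
  unfold lg
  exact log_le_log (by positivity) (by exact_mod_cast max_le_max le_rfl h)
lemma lg_le {n m : ℕ} (h : n ≤ 8 * m) : lg n ≤ lg m + 3 := by
  unfold lg
  have h8 : log 8 ≤ 3 := by
    rw [Real.log_le_iff_le_exp (by norm_num)]
    have := Real.add_one_le_exp (1:ℝ)
    have e : exp 3 = exp 1 ^ 3 := by rw [← exp_nat_mul]; norm_num
    rw [e]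
    calc (8:ℝ) = 2 ^ 3 := by norm_num
      _ ≤ _ := by gcongr; linarith
  have hm : (0:ℝ) < ((max 1 m : ℕ) : ℝ) := by positivity
  have : log ((max 1 n : ℕ) : ℝ) ≤ log (((max 1 m : ℕ) : ℝ) * 8) :=
    log_le_log (by positivity) (by exact_mod_cast (by omega : max 1 n ≤ max 1 m * 8))
  rw [log_mul hm.ne' (by norm_num)] at this
  linarith
lemma aP_lg (x : Vtx) : |aP x - lg (n1 x)| ≤ 30 := by
  by_cases hx : x = 0
  · subst hx; rw [aP_zero]; simp [lg, n1]
  · have := aP_log hx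
    have h1 : 1 ≤ n1 x := by
      unfold n1; by_contra hc; apply hx; ext <;> simp <;> omega
    unfold lg
    rw [max_eq_right h1]
    simpa [n1, Nat.cast_natAbs] using this
lemma mem_VN {N : ℕ} {v : Vtx} : v ∈ VN N ↔ 0 ≤ v.1 ∧ v.1 ≤ N ∧ 0 ≤ v.2 ∧ v.2 ≤ N := by
  unfold VN; rw [mem_Icc, Prod.le_def, Prod.le_def]; simp; tauto
lemma mem_intr {B : Finset Vtx} {v : Vtx} : v ∈ intr B ↔ v ∈ B ∧ (v.1 + 1, v.2) ∈ B ∧ (v.1 - 1, v.2) ∈ B ∧ (v.1, v.2 + 1) ∈ B ∧ (v.1, v.2 - 1) ∈ B := by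
  unfold intr bdry; rw [Finset.mem_sdiff, mem_filter]; tauto
lemma mem_iVN {N : ℕ} {v : Vtx} : v ∈ intr (VN N) ↔ 0 < v.1 ∧ v.1 < N ∧ 0 < v.2 ∧ v.2 < N := by
  rw [mem_intr]; simp only [mem_VN]; omega
noncomputable def DD (N : ℕ) (v : Vtx) (r : ℕ) : Finset Vtx :=
  (intr (VN N)).filter fun w => (w.1 - v.1).natAbs < r ∧ (w.2 - v.2).natAbs < r
lemma mem_DD {N : ℕ} {v w : Vtx} {r : ℕ} : w ∈ DD N v r ↔
    (0 < w.1 ∧ w.1 < N ∧ 0 < w.2 ∧ w.2 < N) ∧ (w.1 - v.1).natAbs < r ∧ (w.2 - v.2).natAbs < r := by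
  unfold DD; rw [mem_filter, mem_iVN]
noncomputable def rad (N : ℕ) (lam : ℝ) : ℕ := if lam = 0 then N else ⌊(N:ℝ) ^ (1 - lam) / 2⌋₊
lemma intr_nbhd {N : ℕ} {lam : ℝ} {v : Vtx} (hv : v ∈ VN N) :
    intr (nbhd N lam v) = DD N v (rad N lam) := by
  ext w
  rw [mem_DD]
  unfold nbhd rad
  rw [mem_VN] at hv
  split_ifs with h0 h1
  · rw [mem_iVN]; omega
  · rw [mem_intr]
    simp [h1]
    have : ⌊(2:ℝ)⁻¹⌋₊ = 0 := by rw [Nat.floor_eq_zero]; norm_num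
    rw [this]; simp
    rintro rfl
    simp [Prod.ext_iff]
  · have key : ∀ a b : ℤ, |(a:ℝ) - (b:ℝ)| ≤ (N:ℝ) ^ (1 - lam) / 2 ↔ (a - b).natAbs ≤ ⌊(N:ℝ) ^ (1 - lam) / 2⌋₊ := by
      intro a b
      rw [Nat.le_floor_iff (by positivity), Nat.cast_natAbs]; push_cast; rfl
    rw [mem_intr]
    simp only [mem_filter, mem_VN, key]
    omega
def dst (N : ℕ) (v : Vtx) : ℕ := (min (min v.1 v.2) (min (N - v.1) (N - v.2))).toNat
section green
variable {N : ℕ} {G : Vtx → Vtx → ℝ}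
noncomputable def QD (N : ℕ) (G : Vtx → Vtx → ℝ) (D : Finset Vtx) (v w : Vtx) : ℝ :=
  ∑ z ∈ VN N, hD D v z * G z w
lemma QD_out (hG : IsGr (intr (VN N)) G) {D : Finset Vtx} {v : Vtx} (hv : v ∉ D) (w : Vtx) :
    QD N G D v w = G v w := by
  unfold QD
  simp_rw [hD_out hv]
  simp only [ite_mul, one_mul, zero_mul, Finset.sum_ite_eq]
  split_ifs with h
  · rfl
  · rw [hG.1 v w (Or.inl (fun hc => h (mem_intr.1 hc).1))]
lemma QD_harm {D : Finset Vtx} {v : Vtx} (hv : v ∈ D) (w : Vtx) :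
    QD N G D v w = navg (fun x => QD N G D x w) v := by
  unfold QD
  rw [navg_sum]
  refine sum_congr rfl fun z _ => ?_
  rw [hD_harm hv]
  simp only [navg]; ring
lemma QD_eq (hG : IsGr (intr (VN N)) G) {D : Finset Vtx} (hD : D ⊆ intr (VN N)) {w : Vtx} (hw : w ∉ D) (v : Vtx) :
    QD N G D v w = G v w := by
  have := harm_unique D (fun x => QD N G D x w) (fun x => G x w) (fun x hx => QD_harm hx w)
    (fun x hx => by
      by_cases hwB : w ∈ intr (VN N)
      · have h := hG.2 w hwB x (hD hx)
        rw [if_neg (by rintro rfl; exact hw hx), mul_zero, add_zero] at h; exact h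
      · have : (fun z => G z w) = fun _ => 0 := by ext z; exact hG.1 z w (Or.inr hwB)
        rw [this, navg_const]; exact hG.1 x w (Or.inr hwB))
    (fun x hx => QD_out hG hx w)
  exact congrFun this v
noncomputable def KD (N : ℕ) (G : Vtx → Vtx → ℝ) (D : Finset Vtx) (v w : Vtx) : ℝ := G v w - QD N G D v w
lemma KD_isGr (hG : IsGr (intr (VN N)) G) {D : Finset Vtx} (hD : D ⊆ intr (VN N)) : IsGr D (KD N G D) := by
  refine ⟨?_, ?_⟩
  · rintro x y (h | h)
    · simp [KD, QD_out hG h]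
    · simp [KD, QD_eq hG hD h]
  · intro y hy x hx
    unfold KD
    rw [navg_sub, ← QD_harm hx, hG.2 y (hD hy) x (hD hx)]; ring
noncomputable def CV (N : ℕ) (G : Vtx → Vtx → ℝ) (c d : Vtx → ℝ) : ℝ := ∑ v ∈ VN N, ∑ w ∈ VN N, c v * d w * G v w
lemma CV_eq (hG : IsGr (intr (VN N)) G) (D : Finset Vtx) (v : Vtx) (d : Vtx → ℝ) :
    CV N G (hD D v) d = ∑ w ∈ VN N, d w * QD N G D v w := by
  unfold CV QD
  rw [sum_comm]
  refine sum_congr rfl fun w _ => ?_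
  rw [mul_sum]
  exact sum_congr rfl fun z _ => by ring
lemma CV_nested (hG : IsGr (intr (VN N)) G) {D E : Finset Vtx} (hD' : D ⊆ intr (VN N)) (hDE : D ⊆ E) (v w : Vtx) :
    CV N G (hD D v) (hD E w) = QD N G E w v := by
  rw [CV_eq hG]
  unfold QD
  refine sum_congr rfl fun z _ => ?_
  by_cases hz : z ∈ E
  · rw [hD_in hz]; ring
  · have := QD_eq hG hD' (fun h => hz (hDE h)) v
    unfold QD at this
    rw [this, hG.symm v z]
lemma aP_neg_diff_harm (y x : Vtx) : navg (fun z => aP (z - y)) x = aP (x - y) + Real.pi / 2 * (if x = y then 1 else 0) := by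
  have := aP_avg (x - y)
  simp only [sub_eq_zero] at this
  rw [← this]
  simp only [navg, Prod.fst_sub, Prod.snd_sub]
  congr 3 <;> congr 2 <;> simp [Prod.ext_iff] <;> ring
lemma Gr_nonneg {D : Finset Vtx} {K : Vtx → Vtx → ℝ} (hK : IsGr D K) (x y : Vtx) : 0 ≤ K x y := by
  by_cases hy : y ∈ D
  · by_cases hx : x ∈ D
    · refine min_principle D (fun z => K z y) 0 (fun x hx => ?_) (fun x _ z _ hz => (hK.1 z y (Or.inl hz)).ge) x hx
      have := hK.2 y hy x hx
      have : 0 ≤ Real.pi / 2 * (if x = y then (1:ℝ) else 0) := by split_ifs <;> positivity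
      linarith
    · exact (hK.1 x y (Or.inl hx)).ge
  · exact (hK.1 x y (Or.inr hy)).ge
lemma Gr_harm {D : Finset Vtx} {K : Vtx → Vtx → ℝ} (hK : IsGr D K) {y : Vtx} (hy : y ∈ D) {x : Vtx} (hx : x ∈ D) :
    K x y + aP (x - y) = navg (fun z => K z y + aP (z - y)) x := by
  rw [navg_add, aP_neg_diff_harm, hK.2 y hy x hx]; ring
lemma Gr_diag_lower {D : Finset Vtx} {K : Vtx → Vtx → ℝ} (hK : IsGr D K) {y : Vtx} (hy : y ∈ D) (μ : ℕ)
    (h : ∀ x ∈ D, ∀ z, nbr x z → z ∉ D → μ ≤ n1 (z - y)) : lg μ - 30 ≤ K y y := by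
  have := min_principle D (fun x => K x y + aP (x - y)) (lg μ - 30) (fun x hx => (Gr_harm hK hy hx).ge)
    (fun x hx z hxz hz => by
      have h1 := aP_lg (z - y)
      have h2 := lg_mono (h x hx z hxz hz)
      rw [hK.1 z y (Or.inl hz)]
      rw [abs_le] at h1; linarith) y hy
  simpa [aP_zero] using this
lemma Gr_diag_upper {D : Finset Vtx} {K : Vtx → Vtx → ℝ} (hK : IsGr D K) {y : Vtx} (hy : y ∈ D) (μ : ℕ)
    (h : ∀ x ∈ D, ∀ z, nbr x z → z ∉ D → n1 (z - y) ≤ μ) : K y y ≤ lg μ + 30 := by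
  have := max_principle D (fun x => K x y + aP (x - y)) (lg μ + 30) (fun x hx => (Gr_harm hK hy hx).le)
    (fun x hx z hxz hz => by
      have h1 := aP_lg (z - y)
      have h2 := lg_mono (h x hx z hxz hz)
      rw [hK.1 z y (Or.inl hz)]
      rw [abs_le] at h1; linarith) y hy
  simpa [aP_zero] using this
lemma Gr_reflect {D : Finset Vtx} {K : Vtx → Vtx → ℝ} (hK : IsGr D K) {y : Vtx} (hy : y ∈ D) (y' : Vtx)
    (hy' : y' ∉ D) (V : Finset Vtx) (hV : ∀ x ∈ D, ∀ z, nbr x z → z ∈ V)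
    (h : ∀ z ∈ V, n1 (z - y) ≤ n1 (z - y')) : ∀ x ∈ V, K x y ≤ aP (x - y') - aP (x - y) + 60 := by
  have key : ∀ z ∈ V, aP (z - y) - aP (z - y') ≤ 60 := by
    intro z hz
    have h1 := aP_lg (z - y)
    have h2 := aP_lg (z - y')
    have := lg_mono (h z hz)
    rw [abs_le] at h1 h2; linarith
  have := max_principle D (fun x => (K x y + aP (x - y)) - aP (x - y')) 60 (fun x hx => by
      rw [navg_sub, ← Gr_harm hK hy hx, aP_neg_diff_harm, if_neg (by rintro rfl; exact hy' hx)]; simp)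
    (fun x hx z hxz hz => by
      rw [hK.1 z y (Or.inl hz)]
      have := key z (hV x hx z hxz); linarith)
  intro x hx
  by_cases hxD : x ∈ D
  · have := this x hxD; linarith
  · rw [hK.1 x y (Or.inl hxD)]
    have := key x hx; linarith
lemma exists_refl {y : Vtx} (hy : y ∈ intr (VN N)) : ∃ y' : Vtx, y' ∉ intr (VN N) ∧
    (∀ z ∈ VN N, n1 (z - y) ≤ n1 (z - y')) ∧ n1 (y - y') = 2 * dst N y := by
  rw [mem_iVN] at hy
  have hd : (dst N y = y.1 ∨ (dst N y : ℤ) = N - y.1) ∨ (dst N y : ℤ) = y.2 ∨ (dst N y : ℤ) = N - y.2 := by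
    unfold dst; omega
  rcases hd with (h | h) | (h | h)
  · refine ⟨(-y.1, y.2), by rw [mem_iVN]; simp; omega, fun z hz => ?_, ?_⟩
    · rw [mem_VN] at hz; simp only [n1, Prod.fst_sub, Prod.snd_sub]; omega
    · simp only [n1, Prod.fst_sub, Prod.snd_sub]; omega
  · refine ⟨(2 * N - y.1, y.2), by rw [mem_iVN]; simp; omega, fun z hz => ?_, ?_⟩
    · rw [mem_VN] at hz; simp only [n1, Prod.fst_sub, Prod.snd_sub]; omega
    · simp only [n1, Prod.fst_sub, Prod.snd_sub]; omega
  · refine ⟨(y.1, -y.2), by rw [mem_iVN]; simp; omega, fun z hz => ?_, ?_⟩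
    · rw [mem_VN] at hz; simp only [n1, Prod.fst_sub, Prod.snd_sub]; omega
    · simp only [n1, Prod.fst_sub, Prod.snd_sub]; omega
  · refine ⟨(y.1, 2 * N - y.2), by rw [mem_iVN]; simp; omega, fun z hz => ?_, ?_⟩
    · rw [mem_VN] at hz; simp only [n1, Prod.fst_sub, Prod.snd_sub]; omega
    · simp only [n1, Prod.fst_sub, Prod.snd_sub]; omega
lemma nbr_VN {x z : Vtx} (hx : x ∈ intr (VN N)) (h : nbr x z) : z ∈ VN N := by
  rw [mem_iVN] at hx
  rw [mem_VN]
  rcases h with rfl | rfl | rfl | rfl <;> simp <;> omega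
lemma DD_sub (v : Vtx) (r : ℕ) : DD N v r ⊆ intr (VN N) := Finset.filter_subset _ _
lemma KD_diag (hG : IsGr (intr (VN N)) G) (v : Vtx) (r : ℕ) (hv : v ∈ VN N) :
    |KD N G (DD N v r) v v - lg (min (dst N v) r)| ≤ 100 := by
  have hK := KD_isGr hG (DD_sub v r)
  by_cases hvD : v ∈ DD N v r
  · have hvB := DD_sub v r hvD
    have low := Gr_diag_lower hK hvD (min (dst N v) r) (fun x hx z hxz hz => by
      have hzV := nbr_VN (DD_sub v r hx) hxz
      rw [mem_VN] at hzV
      rw [mem_DD] at hz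
      simp only [n1, Prod.fst_sub, Prod.snd_sub, dst]; omega)
    have up1 := Gr_diag_upper hK hvD (2 * r) (fun x hx z hxz hz => by
      rw [mem_DD] at hx
      simp only [n1, Prod.fst_sub, Prod.snd_sub]
      rcases hxz with rfl | rfl | rfl | rfl <;> simp only <;> omega)
    obtain ⟨v', hv', hz', hd⟩ := exists_refl hvB
    have up2 := Gr_reflect hK hvD v' (fun h => hv' (DD_sub v r h)) (VN N)
      (fun x hx z hxz => nbr_VN (DD_sub v r hx) hxz) hz' v hv
    rw [sub_self, aP_zero] at up2
    have h2 := aP_lg (v - v')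
    rw [hd] at h2
    have h3 : lg (2 * dst N v) ≤ lg (dst N v) + 3 := lg_le (by omega)
    have h4 : lg (2 * r) ≤ lg r + 3 := lg_le (by omega)
    rw [abs_le] at h2 ⊢
    rcases le_total (dst N v) r with h | h
    · rw [min_eq_left h] at *; constructor <;> linarith
    · rw [min_eq_right h] at *; constructor <;> linarith
  · rw [hK.1 v v (Or.inl hvD)]
    have : min (dst N v) r = 0 := by
      rw [mem_DD] at hvD; rw [mem_VN] at hv; unfold dst; omega
    rw [this]; simp [lg]
end green
section green2
variable {N : ℕ} {G : Vtx → Vtx → ℝ}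
lemma CV_symm (hG : IsGr (intr (VN N)) G) (c d : Vtx → ℝ) : CV N G c d = CV N G d c := by
  unfold CV; rw [sum_comm]
  exact sum_congr rfl fun v _ => sum_congr rfl fun w _ => by rw [hG.symm w v]; ring
lemma CV_add_left (c c' d : Vtx → ℝ) : CV N G (fun x => c x + c' x) d = CV N G c d + CV N G c' d := by
  unfold CV; simp only [add_mul, sum_add_distrib]
lemma CV_sub_left (c c' d : Vtx → ℝ) : CV N G (fun x => c x - c' x) d = CV N G c d - CV N G c' d := by
  unfold CV; simp only [sub_mul, sum_sub_distrib]
lemma CV_sub_right (c d d' : Vtx → ℝ) : CV N G c (fun x => d x - d' x) = CV N G c d - CV N G c d' := by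
  unfold CV; simp only [mul_sub, sub_mul, sum_sub_distrib]
lemma CV_smul_left (a : ℝ) (c d : Vtx → ℝ) : CV N G (fun x => a * c x) d = a * CV N G c d := by
  unfold CV; simp only [mul_sum]
  exact sum_congr rfl fun v _ => sum_congr rfl fun w _ => by ring
lemma CV_smul_right (a : ℝ) (c d : Vtx → ℝ) : CV N G c (fun x => a * d x) = a * CV N G c d := by
  unfold CV; simp only [mul_sum]
  exact sum_congr rfl fun v _ => sum_congr rfl fun w _ => by ring
lemma CV_sum_left {ι : Type*} (s : Finset ι) (c : ι → Vtx → ℝ) (d : Vtx → ℝ) :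
    CV N G (fun x => ∑ i ∈ s, c i x) d = ∑ i ∈ s, CV N G (c i) d := by
  induction s using Finset.induction_on with
  | empty => simp [CV]
  | insert a s ha ih => simp only [Finset.sum_insert ha, CV_add_left, ih]
lemma CV_sum_right (hG : IsGr (intr (VN N)) G) {ι : Type*} (s : Finset ι) (c : ι → Vtx → ℝ) (d : Vtx → ℝ) :
    CV N G d (fun x => ∑ i ∈ s, c i x) = ∑ i ∈ s, CV N G d (c i) := by
  rw [CV_symm hG, CV_sum_left]; exact sum_congr rfl fun i _ => CV_symm hG _ _
lemma CV_nonneg (hG : IsGr (intr (VN N)) G) (c : Vtx → ℝ) : 0 ≤ CV N G c c := hG.psd _ _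
lemma CV_tri (hG : IsGr (intr (VN N)) G) (a b c : Vtx → ℝ) :
    CV N G (fun x => a x - c x) (fun x => a x - c x) ≤
      2 * CV N G (fun x => a x - b x) (fun x => a x - b x) + 2 * CV N G (fun x => b x - c x) (fun x => b x - c x) := by
  have := CV_nonneg hG (fun x => (a x - b x) - (b x - c x))
  have s1 := CV_symm hG a b
  have s2 := CV_symm hG a c
  have s3 := CV_symm hG b c
  simp only [CV_sub_left, CV_sub_right] at *
  linarith
lemma var_incr (hG : IsGr (intr (VN N)) G) {D E : Finset Vtx} (hE : E ⊆ intr (VN N)) (hDE : D ⊆ E) (v : Vtx) :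
    CV N G (fun x => hD D v x - hD E v x) (fun x => hD D v x - hD E v x) = KD N G E v v - KD N G D v v := by
  simp only [CV_sub_left, CV_sub_right]
  rw [CV_nested hG (hDE.trans hE) le_rfl, CV_nested hG (hDE.trans hE) hDE, CV_nested hG hE le_rfl,
    CV_symm hG (hD E v), CV_nested hG (hDE.trans hE) hDE]
  unfold KD; ring
lemma KD_mono (hG : IsGr (intr (VN N)) G) {D E : Finset Vtx} (hE : E ⊆ intr (VN N)) (hDE : D ⊆ E) (v : Vtx) :
    KD N G D v v ≤ KD N G E v v := by
  have := CV_nonneg hG (fun x => hD D v x - hD E v x)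
  rw [var_incr hG hE hDE] at this; linarith
lemma n1_cmp {v w z : Vtx} {r : ℕ}
    (h1 : 8 * (v.1 - w.1).natAbs ≤ r) (h2 : 8 * (v.2 - w.2).natAbs ≤ r)
    (hz : r ≤ (z.1 - v.1).natAbs ∨ r ≤ (z.2 - v.2).natAbs) :
    n1 (z - v) ≤ 8 * n1 (z - w) ∧ n1 (z - w) ≤ 8 * n1 (z - v) := by
  simp only [n1, Prod.fst_sub, Prod.snd_sub]
  have a1 : (z.1 - v.1).natAbs ≤ (z.1 - w.1).natAbs + (v.1 - w.1).natAbs := by omega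
  have a2 : (z.2 - v.2).natAbs ≤ (z.2 - w.2).natAbs + (v.2 - w.2).natAbs := by omega
  have a3 : (z.1 - w.1).natAbs ≤ (z.1 - v.1).natAbs + (v.1 - w.1).natAbs := by omega
  have a4 : (z.2 - w.2).natAbs ≤ (z.2 - v.2).natAbs + (v.2 - w.2).natAbs := by omega
  generalize (z.1 - v.1).natAbs = p at *
  generalize (z.2 - v.2).natAbs = q at *
  generalize (z.1 - w.1).natAbs = p' at *
  generalize (z.2 - w.2).natAbs = q' at *
  generalize (v.1 - w.1).natAbs = a at *
  generalize (v.2 - w.2).natAbs = b at *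
  omega
lemma n1_ge {v w z : Vtx} {r : ℕ}
    (h1 : 8 * (v.1 - w.1).natAbs ≤ r) (h2 : 8 * (v.2 - w.2).natAbs ≤ r)
    (hz : 2 * r ≤ (z.1 - v.1).natAbs ∨ 2 * r ≤ (z.2 - v.2).natAbs) :
    r ≤ n1 (z - v) ∧ r ≤ n1 (z - w) := by
  simp only [n1, Prod.fst_sub, Prod.snd_sub]
  have a1 : (z.1 - v.1).natAbs ≤ (z.1 - w.1).natAbs + (v.1 - w.1).natAbs := by omega
  have a2 : (z.2 - v.2).natAbs ≤ (z.2 - w.2).natAbs + (v.2 - w.2).natAbs := by omega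
  generalize (z.1 - v.1).natAbs = p at *
  generalize (z.2 - v.2).natAbs = q at *
  generalize (z.1 - w.1).natAbs = p' at *
  generalize (z.2 - w.2).natAbs = q' at *
  generalize (v.1 - w.1).natAbs = a at *
  generalize (v.2 - w.2).natAbs = b at *
  omega
lemma dst_lip {v w : Vtx} : dst N w ≤ dst N v + (v.1 - w.1).natAbs + (v.2 - w.2).natAbs := by
  unfold dst; omega
lemma n1_refl {y y' z : Vtx} : n1 (z - y') ≤ n1 (z - y) + n1 (y - y') := by
  simp only [n1, Prod.fst_sub, Prod.snd_sub]; omega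
lemma dst_pos {v : Vtx} : v ∈ intr (VN N) ↔ 0 < dst N v := by
  rw [mem_iVN]; unfold dst; omega
lemma Gdiff_bound (hG : IsGr (intr (VN N)) G) {v w : Vtx} (hv : v ∈ VN N) (hw : w ∈ VN N) {r : ℕ}
    (h1 : 8 * (v.1 - w.1).natAbs ≤ r) (h2 : 8 * (v.2 - w.2).natAbs ≤ r) {z : Vtx} (hz : z ∈ VN N)
    (hzv : 2 * r ≤ (z.1 - v.1).natAbs ∨ 2 * r ≤ (z.2 - v.2).natAbs) :
    |G z v - G z w| ≤ 200 := by
  by_cases hr0 : r = 0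
  · have : v = w := by ext <;> omega
    rw [this]; simp
  by_cases hd : dst N v ≤ r
  · have bd : ∀ y ∈ VN N, dst N y ≤ 2 * r → r ≤ n1 (z - y) → 0 ≤ G z y ∧ G z y ≤ 200 := by
      intro y hy hdy hn
      refine ⟨Gr_nonneg hG z y, ?_⟩
      by_cases hyB : y ∈ intr (VN N)
      · obtain ⟨y', hy', hz', hdd⟩ := exists_refl hyB
        have := Gr_reflect hG hyB y' hy' (VN N) (fun x hx z hxz => nbr_VN hx hxz) hz' z hz
        have A := aP_lg (z - y)
        have B := aP_lg (z - y')
        have : lg (n1 (z - y')) ≤ lg (n1 (z - y)) + 3 := by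
          apply lg_le
          have := n1_refl (y := y) (y' := y') (z := z); omega
        rw [abs_le] at A B; linarith
      · rw [hG.1 z y (Or.inr hyB)]; norm_num
    have b1 := bd v hv (by omega) (n1_ge h1 h2 hzv).1
    have b2 := bd w hw (by have := dst_lip (N := N) (v := v) (w := w); omega) (n1_ge h1 h2 hzv).2
    rw [abs_le]; constructor <;> linarith
  · have hvB : v ∈ intr (VN N) := dst_pos.2 (by omega)
    have hwB : w ∈ intr (VN N) := dst_pos.2 (by
      have := dst_lip (N := N) (v := w) (w := v); omega)
    have cmp : ∀ z, (r ≤ (z.1 - v.1).natAbs ∨ r ≤ (z.2 - v.2).natAbs) → |aP (z - v) - aP (z - w)| ≤ 63 := by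
      intro z hz
      have A := aP_lg (z - v)
      have B := aP_lg (z - w)
      have C1 : lg (n1 (z - v)) ≤ lg (n1 (z - w)) + 3 := lg_le (n1_cmp h1 h2 hz).1
      have C2 : lg (n1 (z - w)) ≤ lg (n1 (z - v)) + 3 := lg_le (n1_cmp h1 h2 hz).2
      rw [abs_le] at *; constructor <;> linarith
    have bdr : ∀ z ∈ VN N, z ∉ intr (VN N) → (r ≤ (z.1 - v.1).natAbs ∨ r ≤ (z.2 - v.2).natAbs) := by
      intro z hz hz'
      rw [mem_iVN] at hz'; rw [mem_VN] at hz; unfold dst at hd; omega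
    by_cases hzB : z ∈ intr (VN N)
    · have harm : ∀ x ∈ intr (VN N), (G x v + aP (x - v)) - (G x w + aP (x - w)) =
          navg (fun x => (G x v + aP (x - v)) - (G x w + aP (x - w))) x := by
        intro x hx
        rw [navg_sub, ← Gr_harm hG hvB hx, ← Gr_harm hG hwB hx]
      have bd : ∀ x ∈ intr (VN N), ∀ y, nbr x y → y ∉ intr (VN N) →
          |(G y v + aP (y - v)) - (G y w + aP (y - w))| ≤ 63 := by
        intro x hx y hxy hy
        rw [hG.1 y v (Or.inl hy), hG.1 y w (Or.inl hy), zero_add, zero_add]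
        exact cmp y (bdr y (nbr_VN hx hxy) hy)
      have u1 := max_principle _ _ 63 (fun x hx => (harm x hx).le) (fun x hx y hxy hy => (abs_le.1 (bd x hx y hxy hy)).2) z hzB
      have u2 := min_principle _ _ (-63) (fun x hx => (harm x hx).ge) (fun x hx y hxy hy => (abs_le.1 (bd x hx y hxy hy)).1) z hzB
      have u3 := cmp z (by omega)
      rw [abs_le] at u3 ⊢; constructor <;> linarith
    · rw [hG.1 z v (Or.inl hzB), hG.1 z w (Or.inl hzB)]; simp
lemma var_near_U (hG : IsGr (intr (VN N)) G) {v w : Vtx} (hv : v ∈ VN N) (hw : w ∈ VN N) {r : ℕ}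
    (h1 : 8 * (v.1 - w.1).natAbs ≤ r) (h2 : 8 * (v.2 - w.2).natAbs ≤ r) :
    CV N G (fun x => hD (DD N v (2 * r)) v x - hD (DD N v (2 * r)) w x)
      (fun x => hD (DD N v (2 * r)) v x - hD (DD N v (2 * r)) w x) ≤ 400 := by
  set U := DD N v (2 * r) with hU
  have hUB : U ⊆ intr (VN N) := DD_sub _ _
  have harm : ∀ x ∈ U, QD N G U x v - QD N G U x w = navg (fun x => QD N G U x v - QD N G U x w) x := by
    intro x hx; rw [navg_sub, ← QD_harm hx, ← QD_harm hx]
  have bd : ∀ x ∈ VN N, x ∉ U → |QD N G U x v - QD N G U x w| ≤ 200 := by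
    intro x hxV hx
    rw [QD_out hG hx, QD_out hG hx]
    by_cases hxB : x ∈ intr (VN N)
    · refine Gdiff_bound hG hv hw h1 h2 hxV ?_
      rw [hU, mem_DD] at hx; rw [mem_iVN] at hxB; omega
    · rw [hG.1 x v (Or.inl hxB), hG.1 x w (Or.inl hxB)]; simp
  have all : ∀ x ∈ VN N, |QD N G U x v - QD N G U x w| ≤ 200 := by
    intro x hx
    by_cases hxU : x ∈ U
    · have u1 := max_principle _ _ 200 (fun x hx => (harm x hx).le) (fun x hx y hxy hy => (abs_le.1 (bd y (nbr_VN (hUB hx) hxy) hy)).2) x hxU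
      have u2 := min_principle _ _ (-200) (fun x hx => (harm x hx).ge) (fun x hx y hxy hy => (abs_le.1 (bd y (nbr_VN (hUB hx) hxy) hy)).1) x hxU
      rw [abs_le]; exact ⟨u2, u1⟩
    · exact bd x hx hxU
  have a1 := all v hv
  have a2 := all w hw
  simp only [CV_sub_left, CV_sub_right]
  rw [CV_nested hG hUB le_rfl, CV_nested hG hUB le_rfl, CV_nested hG hUB le_rfl, CV_nested hG hUB le_rfl]
  rw [abs_le] at *; linarith
lemma var_near (hG : IsGr (intr (VN N)) G) {v w : Vtx} (hv : v ∈ VN N) (hw : w ∈ VN N) {r : ℕ}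
    (h1 : 8 * (v.1 - w.1).natAbs ≤ r) (h2 : 8 * (v.2 - w.2).natAbs ≤ r) :
    CV N G (fun x => hD (DD N v r) v x - hD (DD N w r) w x)
      (fun x => hD (DD N v r) v x - hD (DD N w r) w x) ≤ 3000 := by
  have e0 := var_near_U hG hv hw h1 h2
  set U := DD N v (2 * r) with hU
  have hUB : U ⊆ intr (VN N) := DD_sub _ _
  have sv : DD N v r ⊆ U := fun x hx => by rw [hU]; rw [mem_DD] at *; omega
  have sw : DD N w r ⊆ U := fun x hx => by rw [hU]; rw [mem_DD] at *; omega
  have sU : U ⊆ DD N w (3 * r) := fun x hx => by rw [hU] at hx; rw [mem_DD] at *; omega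
  have e1 := var_incr hG hUB sv v
  have e2 := var_incr hG hUB sw w
  have k1 := KD_diag hG v r hv
  have k2 := KD_diag hG v (2 * r) hv
  have k3 := KD_diag hG w r hw
  have k4 := KD_diag hG w (3 * r) hw
  have k5 := KD_mono hG (DD_sub _ _) sU w
  have l1 : lg (min (dst N v) (2 * r)) ≤ lg (min (dst N v) r) + 3 := lg_le (by omega)
  have l2 : lg (min (dst N w) (3 * r)) ≤ lg (min (dst N w) r) + 3 := lg_le (by omega)
  have t1 := CV_tri hG (hD (DD N v r) v) (hD U v) (hD (DD N w r) w)
  have t2 := CV_tri hG (hD U v) (hD U w) (hD (DD N w r) w)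
  have e2' : CV N G (fun x => hD U w x - hD (DD N w r) w x) (fun x => hD U w x - hD (DD N w r) w x) =
      CV N G (fun x => hD (DD N w r) w x - hD U w x) (fun x => hD (DD N w r) w x - hD U w x) := by
    simp only [CV_sub_left, CV_sub_right]; ring
  rw [abs_le] at *
  linarith
lemma lg_ratio {d r r' : ℕ} (h : r' ≤ r) : lg (min d r) - lg (min d r') ≤ lg r - lg r' := by
  have e : lg (min d r) + lg r' ≤ lg r + lg (min d r') := by
    unfold lg
    rw [← log_mul (by positivity) (by positivity), ← log_mul (by positivity) (by positivity)]
    apply log_le_log (by positivity)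
    norm_cast
    rcases le_total d r' with h1 | h1
    · rw [min_eq_left h1, min_eq_left (h1.trans h), mul_comm]; gcongr
    · rw [min_eq_right h1]; gcongr; exact min_le_right _ _
  linarith
lemma rad_lg {lam : ℝ} (h0 : 0 ≤ lam) (h1 : lam ≤ 1) (hN : 1 ≤ N) :
    |lg (rad N lam) - (1 - lam) * log N| ≤ 3 := by
  have hN' : (1:ℝ) ≤ N := by exact_mod_cast hN
  unfold rad
  split_ifs with h
  · subst h; simp [lg, max_eq_right hN]
  · set x := (N:ℝ) ^ (1 - lam) with hx
    have hx1 : 1 ≤ x := Real.one_le_rpow hN' (by linarith)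
    have hlog : (1 - lam) * log N = log x := by rw [hx, Real.log_rpow (by linarith)]
    rw [hlog]
    unfold lg
    have f1 := Nat.floor_le (show 0 ≤ x / 2 by positivity)
    have f2 := Nat.lt_floor_add_one (x / 2)
    set n := ⌊x/2⌋₊
    have p : (0:ℝ) < ((max 1 n : ℕ) : ℝ) := by positivity
    have m1 : ((max 1 n : ℕ):ℝ) ≤ x := by push_cast; exact max_le hx1 (by linarith)
    have m2 : x ≤ ((max 1 n : ℕ):ℝ) * 4 := by
      push_cast
      have a := le_max_left (1:ℝ) n
      have b := le_max_right (1:ℝ) n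
      linarith
    have l1 := log_le_log p m1
    have l2 := log_le_log (by linarith) m2
    rw [log_mul p.ne' (by norm_num)] at l2
    have l4 := Real.log_le_sub_one_of_pos (show (0:ℝ) < 4 by norm_num)
    rw [abs_le]; constructor <;> linarith
lemma rad_anti {lam lam' : ℝ} (h0 : 0 ≤ lam) (h : lam ≤ lam') (hN : 1 ≤ N) : rad N lam' ≤ rad N lam := by
  have hN' : (1:ℝ) ≤ N := by exact_mod_cast hN
  unfold rad
  split_ifs with a b b
  · rfl
  · exact absurd (le_antisymm (h.trans a.le) h0) b
  · have : (N:ℝ) ^ (1 - lam') ≤ (N:ℝ) ^ (1:ℝ) := rpow_le_rpow_of_exponent_le hN' (by linarith)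
    rw [Real.rpow_one] at this
    calc _ ≤ ⌊(N:ℝ)⌋₊ := Nat.floor_mono (by have : (0:ℝ) ≤ (N:ℝ) ^ (1 - lam') := by positivity
                                            linarith)
      _ = N := Nat.floor_natCast N
  · apply Nat.floor_mono
    have : (N:ℝ) ^ (1 - lam') ≤ (N:ℝ) ^ (1 - lam) := rpow_le_rpow_of_exponent_le hN' (by linarith)
    linarith
noncomputable abbrev hS (N : ℕ) (s : ℝ) (v : Vtx) : Vtx → ℝ := hD (DD N v (rad N s)) v
lemma DD_mono {r r' : ℕ} (h : r' ≤ r) (v : Vtx) : DD N v r' ⊆ DD N v r := fun x hx => by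
  rw [mem_DD] at *; omega
lemma var_upper (hG : IsGr (intr (VN N)) G) {v : Vtx} (hv : v ∈ VN N) {s s' : ℝ} (h0 : 0 ≤ s) (h : s ≤ s') (h1 : s' ≤ 1) (hN : 1 ≤ N) :
    CV N G (fun x => hS N s' v x - hS N s v x) (fun x => hS N s' v x - hS N s v x) ≤ (s' - s) * log N + 300 := by
  have hr := rad_anti h0 h hN
  rw [var_incr hG (DD_sub _ _) (DD_mono hr v)]
  have k1 := KD_diag hG v (rad N s) hv
  have k2 := KD_diag hG v (rad N s') hv
  have k3 := lg_ratio (d := dst N v) hr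
  have r1 := rad_lg h0 (h.trans h1) hN
  have r2 := rad_lg (h0.trans h) h1 hN
  rw [abs_le] at *; linarith
lemma var_lower (hG : IsGr (intr (VN N)) G) {v : Vtx} (hv : v ∈ VN N) (hd : N ≤ 8 * dst N v) {s s' : ℝ} (h0 : 0 ≤ s) (h : s ≤ s') (h1 : s' ≤ 1) (hN : 1 ≤ N) :
    (s' - s) * log N - 300 ≤ CV N G (fun x => hS N s' v x - hS N s v x) (fun x => hS N s' v x - hS N s v x) := by
  have hr := rad_anti h0 h hN
  rw [var_incr hG (DD_sub _ _) (DD_mono hr v)]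
  have k1 := KD_diag hG v (rad N s) hv
  have k2 := KD_diag hG v (rad N s') hv
  have r1 := rad_lg h0 (h.trans h1) hN
  have r2 := rad_lg (h0.trans h) h1 hN
  have r3 : rad N s ≤ N := by
    have := rad_anti le_rfl h0 hN
    simpa [rad] using this
  have l1 : lg (rad N s) ≤ lg (min (dst N v) (rad N s)) + 3 := lg_le (by omega)
  have l2 : lg (min (dst N v) (rad N s')) ≤ lg (rad N s') := lg_mono (min_le_right _ _)
  rw [abs_le] at *; linarith
lemma CV_incr_zero (hG : IsGr (intr (VN N)) G) {D E : Finset Vtx} (hE : E ⊆ intr (VN N)) (hDE : D ⊆ E) (w : Vtx)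
    (d : Vtx → ℝ) (hd : ∀ z ∈ E, d z = 0) :
    CV N G (fun x => hD D w x - hD E w x) d = 0 := by
  rw [CV_sub_left, CV_eq hG, CV_eq hG, ← sum_sub_distrib]
  refine Finset.sum_eq_zero fun z _ => ?_
  by_cases hz : z ∈ E
  · rw [hd z hz]; ring
  · rw [QD_eq hG (hDE.trans hE) (fun h => hz (hDE h)), QD_eq hG hE hz]; ring
lemma hD_supp {v z : Vtx} {r : ℕ} (h : hD (DD N v r) v z ≠ 0) :
    z ∉ DD N v r ∧ (z.1 - v.1).natAbs ≤ r ∧ (z.2 - v.2).natAbs ≤ r := by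
  refine ⟨fun hz => h (hD_in hz v), ?_⟩
  by_cases hv : v ∈ DD N v r
  · by_contra hc
    apply h
    refine hD_support z (fun x hx hxz => ?_) hv
    exfalso; apply hc
    rw [mem_DD] at hx
    rcases hxz with rfl | rfl | rfl | rfl <;> simp only <;> omega
  · rw [hD_out hv] at h
    have : v = z := by by_contra hc; exact h (if_neg hc)
    subst this; simp
end green2
section gauss
open MeasureTheory ProbabilityTheory
noncomputable def lin (N : ℕ) (c : Vtx → ℝ) (ω : FieldSp) : ℝ := ∑ v ∈ VN N, c v * ω v
structure GF (N : ℕ) (G : Vtx → Vtx → ℝ) (P : Measure FieldSp) : Prop where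
  prob : IsProbabilityMeasure P
  gr : IsGr (intr (VN N)) G
  law : ∀ c : Vtx → ℝ, P.map (lin N c) = gaussianReal 0 (toNNReal (CV N G c c))
lemma IsGFF.gf {N : ℕ} {P : Measure FieldSp} (h : IsGFF N P) : ∃ G, GF N G P := by
  obtain ⟨h1, G, h2, h3⟩ := h
  exact ⟨G, h1, h2.isGr, h3⟩
variable {N : ℕ} {G : Vtx → Vtx → ℝ} {P : Measure FieldSp}
lemma lin_meas (c : Vtx → ℝ) : Measurable (lin N c) := by
  unfold lin; fun_prop
lemma lin_add (c d : Vtx → ℝ) (ω : FieldSp) : lin N (fun x => c x + d x) ω = lin N c ω + lin N d ω := by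
  simp [lin, add_mul, sum_add_distrib]
lemma lin_sub (c d : Vtx → ℝ) (ω : FieldSp) : lin N (fun x => c x - d x) ω = lin N c ω - lin N d ω := by
  simp [lin, sub_mul, sum_sub_distrib]
lemma lin_smul (a : ℝ) (c : Vtx → ℝ) (ω : FieldSp) : lin N (fun x => a * c x) ω = a * lin N c ω := by
  simp [lin, mul_sum, mul_assoc]
lemma lin_sum {ι : Type*} (s : Finset ι) (c : ι → Vtx → ℝ) (ω : FieldSp) :
    lin N (fun x => ∑ i ∈ s, c i x) ω = ∑ i ∈ s, lin N (c i) ω := by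
  simp only [lin, sum_mul]; rw [sum_comm]
lemma lin_ind {v : Vtx} (hv : v ∈ VN N) (ω : FieldSp) : lin N (fun x => if v = x then 1 else 0) ω = ω v := by
  simp [lin, hv]
lemma GF.hl (h : GF N G P) (c : Vtx → ℝ) : HasLaw (lin N c) (gaussianReal 0 (toNNReal (CV N G c c))) P :=
  ⟨(lin_meas c).aemeasurable, h.law c⟩
lemma GF.memLp (h : GF N G P) (c : Vtx → ℝ) : MemLp (lin N c) 2 P := by
  have := memLp_id_gaussianReal (μ := 0) (v := toNNReal (CV N G c c)) 2
  rw [← h.law c] at this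
  exact (memLp_map_measure_iff aestronglyMeasurable_id (lin_meas c).aemeasurable).1 this
lemma GF.mean (h : GF N G P) (c : Vtx → ℝ) : ∫ ω, lin N c ω ∂P = 0 := by
  have := integral_map (μ := P) (lin_meas (N := N) c).aemeasurable (f := fun x => x) aestronglyMeasurable_id
  rw [← this, h.law c]; simp
lemma GF.var (h : GF N G P) (c : Vtx → ℝ) : Var[lin N c; P] = CV N G c c := by
  have := variance_map (X := id) (μ := P) aemeasurable_id (lin_meas (N := N) c).aemeasurable
  rw [h.law c, variance_id_gaussianReal] at this
  simp only [Function.id_comp] at this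
  rw [← this]; simp [CV_nonneg h.gr]
lemma GF.cov (h : GF N G P) (c d : Vtx → ℝ) : cov[lin N c, lin N d; P] = CV N G c d := by
  have := h.prob
  have h1 := variance_add (h.memLp c) (h.memLp d)
  have h2 : lin N c + lin N d = lin N (fun x => c x + d x) := by ext ω; simp [lin_add]
  rw [h2, h.var, h.var, h.var, CV_add_left, CV_symm h.gr c, CV_symm h.gr d, CV_add_left, CV_add_left, CV_symm h.gr d c] at h1
  linarith
lemma GF.hasGaussian (h : GF N G P) {E : Type*} [NormedAddCommGroup E] [NormedSpace ℝ E] [MeasurableSpace E] [BorelSpace E]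
    (X : FieldSp → E) (hX : Measurable X) (hL : ∀ L : StrongDual ℝ E, ∃ c, ∀ ω, L (X ω) = lin N c ω) : HasGaussianLaw X P := by
  refine ⟨⟨fun L => ?_⟩⟩
  obtain ⟨c, hc⟩ := hL L
  have hm : Measurable L := L.continuous.measurable
  have e : (L ∘ X) = lin N c := funext hc
  rw [Measure.map_map hm hX, e, h.law c, integral_map hX.aemeasurable hm.aestronglyMeasurable,
    variance_map hm.aemeasurable hX.aemeasurable, e, h.var]
  simp_rw [hc]
  rw [h.mean]
lemma GF.gauss_fam (h : GF N G P) {ι : Type*} [Fintype ι] (c : ι → Vtx → ℝ) :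
    HasGaussianLaw (fun ω => (fun i => lin N (c i) ω)) P := by
  refine h.hasGaussian _ (measurable_pi_lambda _ fun i => lin_meas _) fun L => ?_
  refine ⟨fun x => ∑ i, L (Pi.single i 1) * c i x, fun ω => ?_⟩
  rw [lin_sum]
  conv_lhs => rw [pi_eq_sum_univ (fun i => lin N (c i) ω)]
  simp only [map_sum, map_smul, smul_eq_mul, lin_smul]
  refine sum_congr rfl fun i _ => ?_
  rw [mul_comm]; congr 2
  ext j; simp [Pi.single_apply, eq_comm]
lemma GF.indep (h : GF N G P) {ι : Type*} (s : Finset ι) (c : ι → Vtx → ℝ) (x : ι → ℝ)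
    (hc : ∀ i ∈ s, ∀ j ∈ s, i ≠ j → CV N G (c i) (c j) = 0) :
    P {ω | ∀ i ∈ s, x i ≤ lin N (c i) ω} = ∏ i ∈ s, P {ω | x i ≤ lin N (c i) ω} := by
  have h1 := (h.gauss_fam (fun i : s => c i)).iIndepFun_of_covariance_eq_zero (fun i j hij => by
    rw [h.cov]; exact hc i i.2 j j.2 (fun e => hij (Subtype.ext e)))
  have h2 := h1.measure_inter_preimage_eq_mul Finset.univ (sets := fun i => Set.Ici (x i)) (fun i _ => measurableSet_Ici)
  rw [← Finset.prod_coe_sort s]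
  convert h2 using 2
  · ext ω; simp
  · rfl
lemma GF.indep_alg (h : GF N G P) {ι : Type*} [Fintype ι] (c : ι → Vtx → ℝ) (d : Vtx → ℝ) (hcd : ∀ i, CV N G d (c i) = 0) :
    IndepFun (lin N d) (fun ω i => lin N (c i) ω) P := by
  have key : HasGaussianLaw (fun ω => ((fun _ : Unit => lin N d ω), (fun i => lin N (c i) ω))) P := by
    have hg := h.gauss_fam (fun o : Option ι => o.elim d c)
    refine h.hasGaussian _ ?_ fun L => ?_
    · exact (measurable_pi_lambda _ fun i => lin_meas _).prodMk (measurable_pi_lambda _ fun i => lin_meas _)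
    refine ⟨fun x => L (fun _ => 1, 0) * d x + ∑ i, L (0, Pi.single i 1) * c i x, fun ω => ?_⟩
    rw [lin_add, lin_sum, lin_smul]
    have e : ((fun _ : Unit => lin N d ω), (fun i => lin N (c i) ω)) =
      lin N d ω • ((fun _ : Unit => (1:ℝ)), (0 : ι → ℝ)) + ∑ i, lin N (c i) ω • ((0 : Unit → ℝ), (Pi.single i (1:ℝ) : ι → ℝ)) := by
      refine Prod.ext ?_ ?_
      · ext u; simp [Prod.fst_sum]
      · ext u; simp [Prod.snd_sum, Pi.single_apply]
    rw [e]; simp only [map_add, map_sum, map_smul, smul_eq_mul, lin_smul]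
    congr 1
    · ring
    · exact sum_congr rfl fun i _ => mul_comm _ _
  have := HasGaussianLaw.indepFun_of_covariance_eval key (fun i j => by rw [h.cov]; exact hcd j)
  exact this.comp (φ := fun f : Unit → ℝ => f ()) (by fun_prop) measurable_id
lemma scaleAlg_le (lam : ℝ) (v : Vtx) : scaleAlg N lam v ≤ MeasurableSpace.pi := by
  unfold scaleAlg
  exact iSup₂_le fun w _ => (measurable_pi_apply w).comap_le
lemma GF.phi_eq (h : GF N G P) {v : Vtx} (hv : v ∈ VN N) (lam : ℝ) :
    phiScale N P v lam =ᵐ[P] lin N (hS N lam v) := by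
  have := h.prob
  have hle := scaleAlg_le (N := N) lam v
  have hI := intr_nbhd (lam := lam) hv
  set D := DD N v (rad N lam) with hDdef
  let d : Vtx → ℝ := fun x => (if v = x then 1 else 0) - hD D v x
  have e1 : (fun ω : FieldSp => ω v) = lin N (hS N lam v) + lin N d := by
    ext ω; simp only [Pi.add_apply, d, lin_sub, lin_ind hv]; ring
  have m1 : StronglyMeasurable[scaleAlg N lam v] (lin N (hS N lam v)) := by
    apply Measurable.stronglyMeasurable
    unfold lin
    refine Finset.measurable_sum _ fun z hz => ?_
    by_cases hzD : z ∈ D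
    · have : hS N lam v z = 0 := hD_in hzD v
      simp only [this, zero_mul]; exact measurable_const
    · refine Measurable.const_mul ?_ _
      have : MeasurableSpace.comap (fun ω : FieldSp => ω z) inferInstance ≤ scaleAlg N lam v := by
        unfold scaleAlg
        exact le_iSup₂_of_le z ⟨hz, by rw [hI]; exact hzD⟩ le_rfl
      exact fun s hs => this _ ⟨s, hs, rfl⟩
  let S := {w : Vtx // w ∈ (VN N).filter (fun w => w ∉ D)}
  have hind : IndepFun (lin N d) (fun ω (i : S) => lin N (fun x => if i.1 = x then 1 else 0) ω) P := by
    refine h.indep_alg _ _ fun i => ?_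
    obtain ⟨w, hw⟩ := i
    rw [mem_filter] at hw
    have h1 := CV_incr_zero h.gr (DD_sub v (rad N lam)) (Finset.empty_subset _) v (fun x => if w = x then 1 else 0)
      (fun z hz => if_neg (fun e : w = z => hw.2 (by rw [e]; exact hz)))
    convert h1 using 2
    ext x; simp only [d]; congr 1
    rw [hD_out (Finset.notMem_empty _)]
  have hind2 : Indep (MeasurableSpace.comap (lin N d) inferInstance) (scaleAlg N lam v) P := by
    have h3 := hind
    rw [IndepFun_iff_Indep] at h3
    refine indep_of_indep_of_le_right h3 ?_
    unfold scaleAlg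
    refine iSup₂_le fun w hw => ?_
    rw [Set.mem_ofPred_eq, hI] at hw
    have hm : Measurable (fun f : S → ℝ => f ⟨w, mem_filter.2 hw⟩) := measurable_pi_apply _
    rintro _ ⟨s, hs, rfl⟩
    refine ⟨_, hm hs, ?_⟩
    ext ω; simp [lin_ind hw.1]
  have i1 := (h.memLp (hS N lam v)).integrable (by norm_num)
  have i2 := (h.memLp d).integrable (by norm_num)
  have c1 := condExp_add i1 i2 (scaleAlg N lam v)
  have c2 := condExp_indep_eq (m₁ := MeasurableSpace.comap (lin N d) inferInstance) (lin_meas (N := N) d).comap_le hle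
    (Measurable.stronglyMeasurable (comap_measurable (lin N d))) hind2
  have c3 := condExp_of_stronglyMeasurable hle m1 i1
  unfold phiScale
  rw [e1]
  filter_upwards [c1, c2] with ω h1 h2
  rw [h1, Pi.add_apply, h2, c3, h.mean, add_zero]
lemma GF.mgf (h : GF N G P) (c : Vtx → ℝ) : ∫ ω, exp (lin N c ω) ∂P = exp (CV N G c c / 2) := by
  have := mgf_gaussianReal (h.law c) 1
  simp only [ProbabilityTheory.mgf, one_mul] at this
  rw [this]; simp [CV_nonneg h.gr]
lemma GF.expInt (h : GF N G P) (c : Vtx → ℝ) : Integrable (fun ω => exp (lin N c ω)) P := by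
  by_contra hc
  have h1 := h.mgf c
  rw [integral_undef hc] at h1
  exact absurd h1.symm (exp_pos _).ne'
lemma GF.tail_le (h : GF N G P) (c : Vtx → ℝ) (x : ℝ) :
    P.real {ω | x ≤ lin N c ω} ≤ exp (CV N G c c / 2 - x) := by
  have := h.prob
  have h1 := mul_meas_ge_le_integral_of_nonneg (μ := P) (f := fun ω => exp (lin N c ω)) (ae_of_all _ fun ω => (exp_pos _).le) (h.expInt c) (exp x)
  rw [h.mgf c] at h1
  simp only [exp_le_exp] at h1
  rw [Real.exp_sub, le_div_iff₀ (exp_pos _), mul_comm]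
  exact h1
lemma gauss_lower (v : NNReal) (hv : v ≠ 0) {x : ℝ} (hx : 0 ≤ x) :
    exp (-(x / sqrt v + 1) ^ 2 / 2) / 3 ≤ (gaussianReal 0 v).real (Set.Ici x) := by
  have hv' : (0:ℝ) < v := by positivity
  set q := sqrt v with hq
  have hq0 : 0 < q := sqrt_pos.2 hv'
  have hqq : q ^ 2 = v := sq_sqrt hv'.le
  have h1 : (gaussianReal 0 v).real (Set.Ici x) ≥ (gaussianReal 0 v).real (Set.Icc x (x + q)) :=
    measureReal_mono Set.Icc_subset_Ici_self
  refine le_trans ?_ h1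
  rw [Measure.real, gaussianReal_apply_eq_integral _ hv, ENNReal.toReal_ofReal (integral_nonneg fun y => gaussianPDFReal_nonneg _ _ _)]
  have h2 : ∀ y ∈ Set.Icc x (x + q), (sqrt (2 * Real.pi * v))⁻¹ * exp (-(x / q + 1) ^ 2 / 2) ≤ gaussianPDFReal 0 v y := by
    intro y hy
    rw [gaussianPDFReal]
    refine mul_le_mul_of_nonneg_left (exp_le_exp.2 ?_) (by positivity)
    rw [← hqq, sub_zero, neg_div, neg_div, neg_le_neg_iff]
    have e : (x / q + 1) ^ 2 / 2 = (x + q) ^ 2 / (2 * q ^ 2) := by field_simp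
    rw [e]
    gcongr
    · linarith [hy.1]
    · exact hy.2
  have h3 := setIntegral_mono_on (μ := volume) (s := Set.Icc x (x + q)) (f := fun _ => (sqrt (2 * Real.pi * v))⁻¹ * exp (-(x / q + 1) ^ 2 / 2))
    (integrableOn_const (by simp) enorm_ne_top) (integrable_gaussianPDFReal 0 v).integrableOn measurableSet_Icc h2
  refine le_trans ?_ h3
  rw [setIntegral_const, Measure.real, Real.volume_Icc, ENNReal.toReal_ofReal (by linarith), smul_eq_mul]
  have h4 : sqrt (2 * Real.pi * v) ≤ 3 * q := by
    rw [Real.sqrt_le_left (by positivity), mul_pow, hqq]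
    nlinarith [Real.pi_lt_d2]
  have h5 : 0 < sqrt (2 * Real.pi * v) := by positivity
  rw [show x + q - x = q by ring, div_eq_inv_mul, ← mul_assoc]
  gcongr
  rw [← div_eq_mul_inv, le_div_iff₀ h5]
  linarith
lemma GF.tail_ge (h : GF N G P) (c : Vtx → ℝ) (hc : 0 < CV N G c c) {x : ℝ} (hx : 0 ≤ x) :
    exp (-(x / sqrt (CV N G c c) + 1) ^ 2 / 2) / 3 ≤ P.real {ω | x ≤ lin N c ω} := by
  have h1 := gauss_lower (toNNReal (CV N G c c)) (by simpa using hc) hx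
  rw [Real.coe_toNNReal _ hc.le, ← h.law c, Measure.real, Measure.map_apply (lin_meas c) measurableSet_Ici] at h1
  exact h1
end gauss
section levels
open MeasureTheory ProbabilityTheory
structure Ptn (n : ℕ) (s : ℕ → ℝ) : Prop where
  zero : s 0 = 0
  one : s n = 1
  lt : ∀ j < n, s j < s (j + 1)
lemma Ptn.mono {n : ℕ} {s : ℕ → ℝ} (h : Ptn n s) {i j : ℕ} (hij : i ≤ j) (hj : j ≤ n) : s i ≤ s j := by
  induction j, hij using Nat.le_induction with
  | base => exact le_rfl
  | succ j hij ih => exact (ih (by omega)).trans (h.lt j (by omega)).le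
lemma Ptn.nonneg {n : ℕ} {s : ℕ → ℝ} (h : Ptn n s) {j : ℕ} (hj : j ≤ n) : 0 ≤ s j := by
  have := h.mono (Nat.zero_le j) hj
  rwa [h.zero] at this
lemma Ptn.le_one {n : ℕ} {s : ℕ → ℝ} (h : Ptn n s) {j : ℕ} (hj : j ≤ n) : s j ≤ 1 := by
  have := h.mono hj le_rfl
  rwa [h.one] at this
noncomputable def inc (N : ℕ) (s : ℕ → ℝ) (v : Vtx) (j : ℕ) : Vtx → ℝ :=
  fun x => hS N (s (j + 1)) v x - hS N (s j) v x
variable {N n : ℕ} {G : Vtx → Vtx → ℝ} {P : Measure FieldSp} {s : ℕ → ℝ}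
lemma rad_part (hs : Ptn n s) (hN : 1 ≤ N) {i j : ℕ} (hij : i ≤ j) (hj : j ≤ n) : rad N (s j) ≤ rad N (s i) :=
  rad_anti (hs.nonneg (hij.trans hj)) (hs.mono hij hj) hN
lemma inc_zero (hs : Ptn n s) (hN : 1 ≤ N) {v z : Vtx} {i : ℕ} (hi : i < n) (hz : z ∈ DD N v (rad N (s (i + 1)))) :
    inc N s v i z = 0 := by
  unfold inc hS
  rw [hD_in hz, hD_in (DD_mono (rad_part hs hN (Nat.le_succ i) hi) v hz), sub_zero]
lemma CV_inc_zero (hG : IsGr (intr (VN N)) G) (hs : Ptn n s) (hN : 1 ≤ N) {w : Vtx} {j : ℕ} (hj : j < n) (d : Vtx → ℝ)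
    (hd : ∀ z ∈ DD N w (rad N (s j)), d z = 0) : CV N G (inc N s w j) d = 0 :=
  CV_incr_zero hG (DD_sub _ _) (DD_mono (rad_part hs hN (Nat.le_succ j) hj) w) w d hd
lemma CV_inc_ne (hG : IsGr (intr (VN N)) G) (hs : Ptn n s) (hN : 1 ≤ N) {v : Vtx} {i j : ℕ} (hi : i < n) (hj : j < n) (hij : i ≠ j) :
    CV N G (inc N s v i) (inc N s v j) = 0 := by
  wlog h : j < i generalizing i j
  · rw [CV_symm hG]; exact this hj hi hij.symm (by omega)
  exact CV_inc_zero hG hs hN hi _ fun z hz => inc_zero hs hN hj (DD_mono (rad_part hs hN h hi.le) v hz)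
noncomputable def SS (N : ℕ) (s : ℕ → ℝ) (a : ℕ → ℝ) (k : ℕ) (v : Vtx) : Vtx → ℝ :=
  fun x => ∑ j ∈ range k, a j * inc N s v j x
lemma lin_SS (a : ℕ → ℝ) (k : ℕ) (v : Vtx) (ω : FieldSp) :
    lin N (SS N s a k v) ω = ∑ j ∈ range k, a j * lin N (inc N s v j) ω := by
  unfold SS; rw [lin_sum]; simp only [lin_smul]
lemma CV_SS (hG : IsGr (intr (VN N)) G) (hs : Ptn n s) (hN : 1 ≤ N) {v : Vtx} (a : ℕ → ℝ) {k : ℕ} (hk : k ≤ n) :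
    CV N G (SS N s a k v) (SS N s a k v) = ∑ j ∈ range k, a j ^ 2 * CV N G (inc N s v j) (inc N s v j) := by
  unfold SS
  rw [CV_sum_left]
  refine sum_congr rfl fun i hi => ?_
  rw [CV_sum_right hG, Finset.sum_eq_single_of_mem i hi]
  · rw [CV_smul_left, CV_smul_right]; ring
  · intro j hj hji
    rw [mem_range] at hi hj
    rw [CV_smul_left, CV_smul_right, CV_inc_ne hG hs hN (by omega) (by omega) hji.symm]; ring
lemma CV_SS_le (hG : IsGr (intr (VN N)) G) (hs : Ptn n s) (hN : 1 ≤ N) {v : Vtx} (hv : v ∈ VN N) (a : ℕ → ℝ) {k : ℕ} (hk : k ≤ n) :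
    CV N G (SS N s a k v) (SS N s a k v) ≤ ∑ j ∈ range k, a j ^ 2 * ((s (j + 1) - s j) * log N + 300) := by
  rw [CV_SS hG hs hN a hk]
  refine sum_le_sum fun j hj => ?_
  rw [mem_range] at hj
  have := var_upper hG hv (hs.nonneg (by omega)) (hs.lt j (by omega)).le (hs.le_one (by omega)) hN
  exact mul_le_mul_of_nonneg_left this (sq_nonneg _)
lemma CV_sum_le (hG : IsGr (intr (VN N)) G) {ι : Type*} (t : Finset ι) (c : ι → Vtx → ℝ) :
    CV N G (fun x => ∑ i ∈ t, c i x) (fun x => ∑ i ∈ t, c i x) ≤ t.card * ∑ i ∈ t, CV N G (c i) (c i) := by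
  rw [CV_sum_left]
  simp only [CV_sum_right hG]
  have : ∀ i ∈ t, ∀ j ∈ t, CV N G (c i) (c j) ≤ (CV N G (c i) (c i) + CV N G (c j) (c j)) / 2 := by
    intro i _ j _
    have h := CV_nonneg hG (fun x => c i x - c j x)
    rw [CV_sub_left, CV_sub_right, CV_sub_right, CV_symm hG (c j) (c i)] at h
    linarith
  refine (sum_le_sum fun i hi => sum_le_sum fun j hj => this i hi j hj).trans (le_of_eq ?_)
  simp only [add_div, sum_add_distrib, Finset.sum_const, nsmul_eq_mul]
  simp only [← mul_sum, ← sum_div]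
  ring
lemma CV_SS_near (hG : IsGr (intr (VN N)) G) (hs : Ptn n s) (hN : 1 ≤ N) {v w : Vtx} (hv : v ∈ VN N) (hw : w ∈ VN N)
    (a : ℕ → ℝ) {k : ℕ} (hk : k ≤ n) (h1 : 8 * (v.1 - w.1).natAbs ≤ rad N (s k)) (h2 : 8 * (v.2 - w.2).natAbs ≤ rad N (s k)) :
    CV N G (fun x => SS N s a k v x - SS N s a k w x) (fun x => SS N s a k v x - SS N s a k w x) ≤
      n * ∑ j ∈ range n, a j ^ 2 * 12000 := by
  have e : (fun x => SS N s a k v x - SS N s a k w x) = fun x => ∑ j ∈ range k, a j * (inc N s v j x - inc N s w j x) := by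
    ext x; simp only [SS, mul_sub, sum_sub_distrib]
  rw [e]
  refine (CV_sum_le hG _ _).trans ?_
  rw [Finset.card_range]
  have key : ∀ j ∈ range k, CV N G (fun x => a j * (inc N s v j x - inc N s w j x)) (fun x => a j * (inc N s v j x - inc N s w j x)) ≤ a j ^ 2 * 12000 := by
    intro j hj
    rw [mem_range] at hj
    rw [CV_smul_left (G := G) (N := N) (a j) (fun x => inc N s v j x - inc N s w j x), CV_smul_right (G := G) (N := N) (a j) _ (fun x => inc N s v j x - inc N s w j x), ← mul_assoc, ← pow_two]
    refine mul_le_mul_of_nonneg_left ?_ (sq_nonneg _)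
    have r1 := rad_part hs hN (show j + 1 ≤ k by omega) hk
    have r2 := rad_part hs hN (show j ≤ k by omega) hk
    have b1 := var_near hG hv hw (h1.trans r1) (h2.trans r1)
    have b2 := var_near hG hv hw (h1.trans r2) (h2.trans r2)
    have e2 : (fun x => inc N s v j x - inc N s w j x) = fun x => ∑ i ∈ range 2,
      (if i = 0 then hS N (s (j+1)) v x - hS N (s (j+1)) w x else (-1) * (hS N (s j) v x - hS N (s j) w x)) := by
      ext x; simp [sum_range_succ, inc]; ring
    rw [e2]
    refine (CV_sum_le hG _ _).trans ?_
    simp only [sum_range_succ, Finset.range_zero, Finset.sum_empty, if_true, one_ne_zero, if_false, zero_add, Finset.card_range]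
    rw [CV_smul_left (-1 : ℝ) (fun x => hS N (s j) v x - hS N (s j) w x), CV_smul_right (-1 : ℝ) _ (fun x => hS N (s j) v x - hS N (s j) w x)]
    push_cast
    linarith
  calc _ ≤ (k:ℝ) * ∑ j ∈ range k, a j ^ 2 * 12000 := mul_le_mul_of_nonneg_left (sum_le_sum key) (Nat.cast_nonneg _)
    _ ≤ _ := by
      have h3 : (k:ℝ) ≤ n := by exact_mod_cast hk
      have h4 : ∑ j ∈ range k, a j ^ 2 * (12000:ℝ) ≤ ∑ j ∈ range n, a j ^ 2 * 12000 :=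
        sum_le_sum_of_subset_of_nonneg (Finset.range_mono hk) (fun _ _ _ => by positivity)
      exact mul_le_mul h3 h4 (sum_nonneg fun _ _ => by positivity) (Nat.cast_nonneg _)
noncomputable def rep (q : ℕ) (v : Vtx) : Vtx := (q * (v.1 / q), q * (v.2 / q))
lemma card_VN : ((VN N).card : ℝ) = (N + 1) ^ 2 := by
  have : (VN N).card = (N + 1) * (N + 1) := by
    unfold VN
    have : Icc ((0:ℤ), (0:ℤ)) ((N:ℤ), (N:ℤ)) = Icc (0:ℤ) N ×ˢ Icc (0:ℤ) N := by
      ext x; simp [Prod.le_def]; tauto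
    rw [this, card_product]
    simp
  rw [this]; push_cast; ring
lemma exp_log_N (hN : 1 ≤ N) : exp (log N) = N := exp_log (by exact_mod_cast hN)
lemma card_VN_le (hN : 1 ≤ N) : ((VN N).card : ℝ) ≤ 4 * exp (2 * log N) := by
  rw [card_VN, two_mul, exp_add, exp_log_N hN]
  have : (1:ℝ) ≤ N := by exact_mod_cast hN
  nlinarith
lemma reps (hN : 1 ≤ N) {lam : ℝ} (h0 : 0 ≤ lam) (h1 : lam ≤ 1) : ∃ R : Finset Vtx, R ⊆ VN N ∧ (R.card : ℝ) ≤ 40000 * exp (2 * lam * log N) ∧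
    ∀ v ∈ VN N, ∃ w ∈ R, 8 * (v.1 - w.1).natAbs ≤ rad N lam ∧ 8 * (v.2 - w.2).natAbs ≤ rad N lam := by
  set r := rad N lam with hr
  set q := r / 8 + 1 with hq
  have hq0 : (0:ℤ) < q := by omega
  have rep_lt : ∀ a : ℤ, (q : ℤ) * (a / q) ≤ a ∧ a < q * (a / q) + q := fun a => ⟨Int.mul_ediv_self_le hq0.ne', Int.lt_mul_ediv_self_add hq0⟩
  let I : Finset ℤ := (Icc (0:ℤ) (N / q)).image (fun i => q * i)
  have hI : ∀ a : ℤ, 0 ≤ a → a ≤ N → (q:ℤ) * (a / q) ∈ I := by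
    intro a ha hb
    refine mem_image.2 ⟨a / q, mem_Icc.2 ⟨Int.ediv_nonneg ha hq0.le, Int.ediv_le_ediv hq0 hb⟩, rfl⟩
  have hcI : (I.card : ℝ) ≤ N / q + 1 := by
    have h1 : I.card ≤ N / q + 1 := by
      refine Finset.card_image_le.trans ?_
      rw [Int.card_Icc]
      have : ((N:ℤ) / q) = ((N / q : ℕ) : ℤ) := by norm_cast
      rw [this]; generalize N / q = y; omega
    have h2 : ((N / q : ℕ) : ℝ) ≤ N / q := Nat.cast_div_le
    have h3 : (I.card : ℝ) ≤ ((N / q + 1 : ℕ) : ℝ) := by exact_mod_cast h1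
    push_cast at h3
    linarith
  refine ⟨(I ×ˢ I).filter (fun x => x ∈ VN N), fun x hx => (mem_filter.1 hx).2, ?_, fun v hv => ?_⟩
  · have hb : (N:ℝ) / q + 1 ≤ 200 * exp (lam * log N) := by
      have hl := rad_lg h0 h1 hN
      rw [abs_le, ← hr] at hl
      have hexp : exp (lg r) = ((max 1 r : ℕ) : ℝ) := exp_log (by exact_mod_cast (show 0 < max 1 r by omega))
      have h2 : exp ((1 - lam) * log N) ≤ ((max 1 r : ℕ) : ℝ) * exp 3 := by
        rw [← hexp, ← exp_add]; exact exp_le_exp.2 (by linarith)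
      have h3 : ((max 1 r : ℕ) : ℝ) ≤ 8 * q := by exact_mod_cast (show max 1 r ≤ 8 * q by omega)
      have h4 : exp 3 ≤ 21 := by
        have := Real.exp_one_lt_d9
        have e : exp 3 = exp 1 ^ 3 := by rw [← exp_nat_mul]; norm_num
        rw [e]
        calc exp 1 ^ 3 ≤ 2.7182818286 ^ 3 := pow_le_pow_left₀ (exp_pos _).le this.le 3
          _ ≤ 21 := by norm_num
      have hqr : (0:ℝ) < q := by exact_mod_cast hq0
      have h5 : exp ((1 - lam) * log N) ≤ 168 * q := by
        have h6 : (0:ℝ) ≤ ((max 1 r : ℕ) : ℝ) := Nat.cast_nonneg _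
        nlinarith [exp_pos 3]
      have h7 : (N:ℝ) = exp ((1 - lam) * log N) * exp (lam * log N) := by
        rw [← exp_add, ← exp_log_N hN]; congr 1; rw [exp_log_N hN]; ring
      have h8 : (N:ℝ) / q ≤ 168 * exp (lam * log N) := by
        rw [div_le_iff₀ hqr]
        nth_rw 1 [h7]
        nlinarith [exp_pos (lam * log N)]
      have h9 : 1 ≤ exp (lam * log N) := Real.one_le_exp (mul_nonneg h0 (log_nonneg (by exact_mod_cast hN)))
      linarith
    have hc : (((I ×ˢ I).filter (fun x => x ∈ VN N)).card : ℝ) ≤ (I.card : ℝ) * I.card := by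
      have := Finset.card_filter_le (I ×ˢ I) (fun x => x ∈ VN N)
      rw [card_product] at this
      exact_mod_cast this
    refine hc.trans ?_
    have hb' := hcI.trans hb
    calc (I.card : ℝ) * I.card ≤ (200 * exp (lam * log N)) * (200 * exp (lam * log N)) :=
          mul_le_mul hb' hb' (Nat.cast_nonneg _) (by positivity)
      _ = 40000 * (exp (lam * log N) * exp (lam * log N)) := by ring
      _ = _ := by rw [← exp_add]; congr 2; ring
  · rw [mem_VN] at hv
    obtain ⟨a1, a2, a3, a4⟩ := hv
    have k1 := rep_lt v.1
    have k2 := rep_lt v.2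
    have p1 : 0 ≤ (q:ℤ) * (v.1 / q) := mul_nonneg hq0.le (Int.ediv_nonneg a1 hq0.le)
    have p2 : 0 ≤ (q:ℤ) * (v.2 / q) := mul_nonneg hq0.le (Int.ediv_nonneg a3 hq0.le)
    refine ⟨rep q v, ?_, ?_, ?_⟩
    · rw [mem_filter, mem_product, mem_VN]
      refine ⟨⟨hI _ a1 a2, hI _ a3 a4⟩, ?_⟩
      simp only [rep]
      omega
    · simp only [rep]; generalize (q:ℤ) * (v.1 / q) = y at *; omega
    · simp only [rep]; generalize (q:ℤ) * (v.2 / q) = y at *; omega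
end levels
section upper
open MeasureTheory ProbabilityTheory
variable {n : ℕ} {s : ℕ → ℝ}
noncomputable def Ak (s a : ℕ → ℝ) (k : ℕ) : ℝ := ∑ j ∈ range k, (2 * (s (j + 1) - s j) + a j ^ 2 * (s (j + 1) - s j) / 2)
lemma Ak_eq (hs : Ptn n s) (a : ℕ → ℝ) (k : ℕ) :
    Ak s a k = 2 * s k + (∑ j ∈ range k, a j ^ 2 * (s (j + 1) - s j)) / 2 := by
  unfold Ak
  rw [sum_add_distrib, ← mul_sum, sum_range_sub, hs.zero, sum_div, sub_zero]
lemma var_half (hs : Ptn n s) (a : ℕ → ℝ) {k N : ℕ} (hk : k ≤ n) (hN : 1 ≤ N) {G : Vtx → Vtx → ℝ}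
    (hG : IsGr (intr (VN N)) G) {v : Vtx} (hv : v ∈ VN N) :
    CV N G (SS N s a k v) (SS N s a k v) / 2 ≤ (Ak s a k - 2 * s k) * log N + 150 * ∑ j ∈ range n, a j ^ 2 := by
  have h := CV_SS_le hG hs hN hv a hk
  have e : ∑ j ∈ range k, a j ^ 2 * ((s (j + 1) - s j) * log N + 300) =
    (∑ j ∈ range k, a j ^ 2 * (s (j + 1) - s j)) * log N + 300 * ∑ j ∈ range k, a j ^ 2 := by
    rw [sum_mul, mul_sum, ← sum_add_distrib]
    exact sum_congr rfl fun j _ => by ring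
  have h2 : ∑ j ∈ range k, a j ^ 2 ≤ ∑ j ∈ range n, a j ^ 2 :=
    sum_le_sum_of_subset_of_nonneg (Finset.range_mono hk) (fun _ _ _ => sq_nonneg _)
  rw [Ak_eq hs, add_sub_cancel_left]
  rw [e] at h
  linarith
lemma union_le {P : Measure FieldSp} [IsProbabilityMeasure P] (R : Finset Vtx) (S : Vtx → Set FieldSp) (b : ℝ) (h : ∀ v ∈ R, P.real (S v) ≤ b) :
    P.real {ω | ∃ v ∈ R, ω ∈ S v} ≤ R.card * b := by
  have e : {ω | ∃ v ∈ R, ω ∈ S v} = ⋃ v ∈ R, S v := by ext ω; simp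
  rw [e]
  refine (measureReal_biUnion_finset_le R S).trans ?_
  refine (sum_le_sum h).trans (by simp)
lemma max_bound (hs : Ptn n s) (a : ℕ → ℝ) {k : ℕ} (hk : k ≤ n) {ε : ℝ} (hε : 0 < ε) :
    ∃ C : ℝ, ∀ N : ℕ, 1 ≤ N → ∀ G P, GF N G P →
      P.real {ω | ∃ v ∈ VN N, (Ak s a k + 2 * ε) * log N < lin N (SS N s a k v) ω} ≤
        C * (exp (- ε * log N) + exp (- log N)) := by
  set B := 150 * ∑ j ∈ range n, a j ^ 2 with hB
  set K := (n:ℝ) * ∑ j ∈ range n, a j ^ 2 * 12000 with hK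
  refine ⟨40000 * exp B + 4 * exp ((3 / ε) ^ 2 * K / 2), fun N hN G P h => ?_⟩
  have := h.prob
  set L := log N with hL
  have hL0 : 0 ≤ L := log_nonneg (by exact_mod_cast hN)
  obtain ⟨R, hR, hRc, hrep⟩ := reps hN (hs.nonneg hk) (hs.le_one hk)
  choose! w hw using hrep
  have b1 : P.real {ω | ∃ v ∈ R, ω ∈ {ω | (Ak s a k + ε) * L ≤ lin N (SS N s a k v) ω}} ≤ 40000 * exp B * exp (-ε * L) := by
    refine (union_le R _ (exp (B - (2 * s k + ε) * L)) fun v hv => ?_).trans ?_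
    · refine (h.tail_le _ _).trans (exp_le_exp.2 ?_)
      have := var_half hs a hk hN h.gr (hR hv)
      linarith
    · calc _ ≤ 40000 * exp (2 * s k * L) * exp (B - (2 * s k + ε) * L) := by gcongr
        _ = 40000 * (exp (2 * s k * L) * exp (B - (2 * s k + ε) * L)) := by ring
        _ = 40000 * (exp B * exp (-ε * L)) := by rw [← exp_add, ← exp_add]; congr 2; ring
        _ = _ := by ring
  have b2 : P.real {ω | ∃ v ∈ VN N, ω ∈ {ω | 3 * L ≤ lin N (fun x => (3 / ε) * (SS N s a k v x - SS N s a k (w v) x)) ω}} ≤ 4 * exp ((3 / ε) ^ 2 * K / 2) * exp (-L) := by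
    refine (union_le (VN N) _ (exp ((3 / ε) ^ 2 * K / 2 - 3 * L)) fun v hv => ?_).trans ?_
    · refine (h.tail_le _ _).trans (exp_le_exp.2 ?_)
      rw [CV_smul_left (G := G) (N := N) (3 / ε) (fun x => SS N s a k v x - SS N s a k (w v) x),
        CV_smul_right (G := G) (N := N) (3 / ε) _ (fun x => SS N s a k v x - SS N s a k (w v) x)]
      obtain ⟨q1, q2, q3⟩ := hw v hv
      have := CV_SS_near h.gr hs hN hv (hR q1) a hk q2 q3
      have : (3 / ε) ^ 2 * CV N G (fun x => SS N s a k v x - SS N s a k (w v) x) (fun x => SS N s a k v x - SS N s a k (w v) x) ≤ (3 / ε) ^ 2 * K :=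
        mul_le_mul_of_nonneg_left this (sq_nonneg _)
      linarith
    · calc _ ≤ 4 * exp (2 * L) * exp ((3 / ε) ^ 2 * K / 2 - 3 * L) :=
            mul_le_mul_of_nonneg_right (card_VN_le hN) (exp_pos _).le
        _ = 4 * (exp (2 * L) * exp ((3 / ε) ^ 2 * K / 2 - 3 * L)) := by ring
        _ = 4 * (exp ((3 / ε) ^ 2 * K / 2) * exp (-L)) := by rw [← exp_add, ← exp_add]; congr 2; ring
        _ = _ := by ring
  have hsub : {ω | ∃ v ∈ VN N, (Ak s a k + 2 * ε) * L < lin N (SS N s a k v) ω} ⊆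
     {ω | ∃ v ∈ R, ω ∈ {ω | (Ak s a k + ε) * L ≤ lin N (SS N s a k v) ω}} ∪
     {ω | ∃ v ∈ VN N, ω ∈ {ω | 3 * L ≤ lin N (fun x => (3 / ε) * (SS N s a k v x - SS N s a k (w v) x)) ω}} := by
    rintro ω ⟨v, hv, hlt⟩
    by_cases hc : (Ak s a k + ε) * L ≤ lin N (SS N s a k (w v)) ω
    · exact Or.inl ⟨w v, (hw v hv).1, hc⟩
    · refine Or.inr ⟨v, hv, ?_⟩
      change 3 * L ≤ lin N (fun x => (3 / ε) * (SS N s a k v x - SS N s a k (w v) x)) ω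
      rw [lin_smul (N := N) (3 / ε) (fun x => SS N s a k v x - SS N s a k (w v) x), lin_sub]
      rw [not_le] at hc
      have : ε * L ≤ lin N (SS N s a k v) ω - lin N (SS N s a k (w v)) ω := by linarith
      calc 3 * L = 3 / ε * (ε * L) := by field_simp
        _ ≤ _ := by gcongr
  refine (measureReal_mono hsub).trans ((measureReal_union_le _ _).trans ?_)
  have e1 := exp_pos B
  have e2 := exp_pos ((3 / ε) ^ 2 * K / 2)
  have e3 := exp_pos (-ε * L)
  have e4 := exp_pos (-L)
  nlinarith [mul_pos e1 e4, mul_pos e2 e3]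
lemma abel_sum (ρ b : ℕ → ℝ) (m : ℕ) : ∑ j ∈ range m, ρ j * b j =
    ρ m * (∑ j ∈ range m, b j) + ∑ k ∈ range m, (ρ k - ρ (k + 1)) * ∑ j ∈ range (k + 1), b j := by
  induction m with
  | zero => simp
  | succ m ih => rw [sum_range_succ, ih, sum_range_succ (fun k => (ρ k - ρ (k + 1)) * _), sum_range_succ b]; ring
lemma upper_bound (hs : Ptn n s) (τ ρ : ℕ → ℝ) (β : ℝ) (hρ : ∀ k < n, ρ (k + 1) ≤ ρ k) (hρn : ρ n = 1)
    {ε : ℝ} (hε : 0 < ε) :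
    ∃ C δ : ℝ, 0 < δ ∧ ∀ N : ℕ, 1 ≤ N → ∀ G P, GF N G P →
      P.real {ω | exp ((∑ j ∈ range n, ρ j * (2 * (s (j + 1) - s j) + (β / ρ j * τ j) ^ 2 * (s (j + 1) - s j) / 2) + ε) * log N)
        < ∑ v ∈ VN N, exp (β * ∑ j ∈ range n, τ j * lin N (inc N s v j) ω)} ≤ C * exp (-δ * log N) := by
  set a : ℕ → ℝ := fun j => β / ρ j * τ j with ha
  have hge : ∀ k ≤ n, 1 ≤ ρ k := by
    intro k hk
    induction hk using Nat.decreasingInduction with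
    | of_succ k hk ih => exact ih.trans (hρ k hk)
    | self => exact hρn.ge
  have hρ0 := hge 0 (Nat.zero_le _)
  set ε' := ε / (2 * ρ 0 + 1) with hε'
  have hε'0 : 0 < ε' := by positivity
  have hmb := fun (k : ℕ) (hk : k ≤ n) => max_bound hs a hk hε'0
  choose! C hC using hmb
  set B := 150 * ∑ j ∈ range n, a j ^ 2 with hB
  refine ⟨(∑ k ∈ range n, 2 * |C (k + 1)|) + 4 * exp B, min ε' 1, by positivity, fun N hN G P h => ?_⟩
  have := h.prob
  set L := log N with hL
  have hL0 : 0 ≤ L := log_nonneg (by exact_mod_cast hN)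
  let bad : ℕ → Set FieldSp := fun k => {ω | ∃ v ∈ VN N, (Ak s a k + 2 * ε') * L < lin N (SS N s a k v) ω}
  let bad3 : Set FieldSp := {ω | exp ((Ak s a n + ε') * L) ≤ ∑ v ∈ VN N, exp (lin N (SS N s a n v) ω)}
  have hbad : ∀ k ∈ range n, P.real (bad (k + 1)) ≤ 2 * |C (k + 1)| * exp (-(min ε' 1) * L) := by
    intro k hk
    refine (hC (k + 1) (mem_range.1 hk) N hN G P h).trans ?_
    have e1 : exp (-ε' * L) ≤ exp (-(min ε' 1) * L) := exp_le_exp.2 (by nlinarith [min_le_left ε' 1])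
    have e2 : exp (-L) ≤ exp (-(min ε' 1) * L) := exp_le_exp.2 (by nlinarith [min_le_right ε' 1])
    calc _ ≤ |C (k + 1)| * (exp (-ε' * L) + exp (-L)) := mul_le_mul_of_nonneg_right (le_abs_self _) (by positivity)
      _ ≤ |C (k + 1)| * (exp (-(min ε' 1) * L) + exp (-(min ε' 1) * L)) := by gcongr
      _ = _ := by ring
  have hbad3 : P.real bad3 ≤ 4 * exp B * exp (-(min ε' 1) * L) := by
    have hi : Integrable (fun ω => ∑ v ∈ VN N, exp (lin N (SS N s a n v) ω)) P := integrable_finsetSum _ fun v _ => h.expInt _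
    have m1 := mul_meas_ge_le_integral_of_nonneg (μ := P) (f := fun ω => ∑ v ∈ VN N, exp (lin N (SS N s a n v) ω))
      (ae_of_all _ fun ω => sum_nonneg fun v _ => (exp_pos _).le) hi (exp ((Ak s a n + ε') * L))
    rw [integral_finsetSum _ (fun v _ => h.expInt _)] at m1
    have m2 : ∑ v ∈ VN N, ∫ ω, exp (lin N (SS N s a n v) ω) ∂P ≤ 4 * exp (2 * L) * exp ((Ak s a n - 2) * L + B) := by
      calc _ ≤ ∑ v ∈ VN N, exp ((Ak s a n - 2) * L + B) := sum_le_sum fun v hv => by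
            rw [h.mgf]
            have := var_half hs a le_rfl hN h.gr hv
            rw [hs.one, mul_one] at this
            exact exp_le_exp.2 this
        _ = ((VN N).card : ℝ) * exp ((Ak s a n - 2) * L + B) := by simp
        _ ≤ _ := mul_le_mul_of_nonneg_right (card_VN_le hN) (exp_pos _).le
    have m3 := m1.trans m2
    change exp ((Ak s a n + ε') * L) * P.real bad3 ≤ _ at m3
    have e1 : exp (-ε' * L) ≤ exp (-(min ε' 1) * L) := exp_le_exp.2 (by nlinarith [min_le_left ε' 1])
    refine le_trans ?_ (mul_le_mul_of_nonneg_left e1 (by positivity))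
    have m4 : 4 * exp (2 * L) * exp ((Ak s a n - 2) * L + B) = exp ((Ak s a n + ε') * L) * (4 * exp B * exp (-ε' * L)) := by
      rw [show 4 * exp (2 * L) * exp ((Ak s a n - 2) * L + B) = 4 * (exp (2 * L) * exp ((Ak s a n - 2) * L + B)) by ring,
        show exp ((Ak s a n + ε') * L) * (4 * exp B * exp (-ε' * L)) = 4 * (exp ((Ak s a n + ε') * L) * exp B * exp (-ε' * L)) by ring,
        ← exp_add, ← exp_add, ← exp_add]
      congr 2; ring
    rw [m4] at m3
    exact le_of_mul_le_mul_left m3 (exp_pos _)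
  have hsub : {ω | exp ((∑ j ∈ range n, ρ j * (2 * (s (j + 1) - s j) + a j ^ 2 * (s (j + 1) - s j) / 2) + ε) * L)
        < ∑ v ∈ VN N, exp (β * ∑ j ∈ range n, τ j * lin N (inc N s v j) ω)} ⊆ (⋃ k ∈ range n, bad (k + 1)) ∪ bad3 := by
    intro ω hω
    by_contra hc
    rw [Set.mem_union, not_or] at hc
    obtain ⟨hc1, hc3⟩ := hc
    have hc3' : ∑ v ∈ VN N, exp (lin N (SS N s a n v) ω) ≤ exp ((Ak s a n + ε') * L) := (not_le.1 hc3).le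
    have hc1' : ∀ k < n, ∀ v ∈ VN N, lin N (SS N s a (k + 1) v) ω ≤ (Ak s a (k + 1) + 2 * ε') * L := by
      intro k hk v hv
      by_contra hlt
      exact hc1 (Set.mem_biUnion (Finset.mem_coe.2 (mem_range.2 hk)) ⟨v, hv, not_le.1 hlt⟩)
    rw [Set.mem_ofPred_eq] at hω
    refine absurd hω (not_lt.2 ?_)
    have hT : ∀ v ∈ VN N, β * ∑ j ∈ range n, τ j * lin N (inc N s v j) ω ≤ lin N (SS N s a n v) ω +
       (∑ j ∈ range n, ρ j * (2 * (s (j + 1) - s j) + a j ^ 2 * (s (j + 1) - s j) / 2) - Ak s a n + 2 * ε' * ρ 0) * L := by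
      intro v hv
      have e1 : β * ∑ j ∈ range n, τ j * lin N (inc N s v j) ω = ∑ j ∈ range n, ρ j * (a j * lin N (inc N s v j) ω) := by
        rw [mul_sum]
        refine sum_congr rfl fun j hj => ?_
        have := hge j (mem_range.1 hj).le
        have : ρ j ≠ 0 := by positivity
        simp only [ha]; field_simp
      have e2 := abel_sum ρ (fun j => 2 * (s (j + 1) - s j) + a j ^ 2 * (s (j + 1) - s j) / 2) n
      rw [e1, abel_sum, e2, hρn, one_mul, one_mul]
      rw [lin_SS]
      have e3 : ∑ k ∈ range n, (ρ k - ρ (k + 1)) * ∑ j ∈ range (k + 1), a j * lin N (inc N s v j) ω ≤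
         ∑ k ∈ range n, (ρ k - ρ (k + 1)) * ((Ak s a (k + 1) + 2 * ε') * L) := by
        refine sum_le_sum fun k hk => ?_
        rw [mem_range] at hk
        rw [← lin_SS]
        exact mul_le_mul_of_nonneg_left (hc1' k hk v hv) (by linarith [hρ k hk])
      have e4 : ∑ k ∈ range n, (ρ k - ρ (k + 1)) * ((Ak s a (k + 1) + 2 * ε') * L) =
        (∑ k ∈ range n, (ρ k - ρ (k + 1)) * Ak s a (k + 1)) * L + 2 * ε' * L * ∑ k ∈ range n, (ρ k - ρ (k + 1)) := by
        rw [sum_mul, mul_sum, ← sum_add_distrib]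
        exact sum_congr rfl fun k _ => by ring
      rw [Finset.sum_range_sub', hρn] at e4
      have e5 : 0 ≤ ε' * L := by positivity
      unfold Ak at *
      nlinarith
    calc ∑ v ∈ VN N, exp (β * ∑ j ∈ range n, τ j * lin N (inc N s v j) ω)
        ≤ ∑ v ∈ VN N, exp (lin N (SS N s a n v) ω) * exp ((∑ j ∈ range n, ρ j * (2 * (s (j + 1) - s j) + a j ^ 2 * (s (j + 1) - s j) / 2) - Ak s a n + 2 * ε' * ρ 0) * L) :=
          sum_le_sum fun v hv => by rw [← exp_add]; exact exp_le_exp.2 (hT v hv)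
      _ ≤ exp ((Ak s a n + ε') * L) * exp ((∑ j ∈ range n, ρ j * (2 * (s (j + 1) - s j) + a j ^ 2 * (s (j + 1) - s j) / 2) - Ak s a n + 2 * ε' * ρ 0) * L) := by
          rw [← sum_mul]; gcongr
      _ = _ := by
          rw [← exp_add]; congr 1
          have : ε = ε' * (2 * ρ 0 + 1) := by rw [hε']; field_simp
          rw [this]; ring
  refine (measureReal_mono hsub).trans ((measureReal_union_le _ _).trans ?_)
  rw [add_mul, sum_mul]
  exact add_le_add ((measureReal_biUnion_finset_le _ _).trans (sum_le_sum hbad)) hbad3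
end upper
section lower
open MeasureTheory ProbabilityTheory
lemma second_moment {P : Measure FieldSp} [IsProbabilityMeasure P] (A : Finset Vtx) (E : Vtx → Set FieldSp) (hE : ∀ v, MeasurableSet (E v))
    {p b : ℝ} (hp : 0 < p) (hpv : ∀ v ∈ A, p ≤ P.real (E v)) (hA : 0 < A.card)
    (h : ∑ v ∈ A, ∑ w ∈ A, P.real (E v ∩ E w) / (P.real (E v) * P.real (E w)) ≤ (A.card : ℝ) ^ 2 * (1 + b)) :
    P.real {ω | ((A.filter (fun v => ω ∈ E v)).card : ℝ) < A.card / 2 * p} ≤ 4 * b := by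
  let X : Vtx → FieldSp → ℝ := fun v => (E v).indicator (fun _ => (P.real (E v))⁻¹)
  let Y : FieldSp → ℝ := fun ω => ∑ v ∈ A, X v ω
  have hA' : (0:ℝ) < A.card := by exact_mod_cast hA
  have iX : ∀ v, Integrable (X v) P := fun v => (integrable_const _).indicator (hE v)
  have iXX : ∀ v w, Integrable (fun ω => X v ω * X w ω) P := by
    intro v w
    have : (fun ω => X v ω * X w ω) = (E v ∩ E w).indicator (fun _ => (P.real (E v))⁻¹ * (P.real (E w))⁻¹) := by
      ext ω; simp only [X, Set.indicator]; by_cases h1 : ω ∈ E v <;> by_cases h2 : ω ∈ E w <;> simp [h1, h2]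
    rw [this]
    exact (integrable_const _).indicator ((hE v).inter (hE w))
  have eXX : ∀ v w, ∫ ω, X v ω * X w ω ∂P = P.real (E v ∩ E w) / (P.real (E v) * P.real (E w)) := by
    intro v w
    have : (fun ω => X v ω * X w ω) = (E v ∩ E w).indicator (fun _ => (P.real (E v))⁻¹ * (P.real (E w))⁻¹) := by
      ext ω; simp only [X, Set.indicator]; by_cases h1 : ω ∈ E v <;> by_cases h2 : ω ∈ E w <;> simp [h1, h2]
    rw [this, integral_indicator_const _ ((hE v).inter (hE w)), smul_eq_mul, div_eq_mul_inv, mul_inv]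
  have eX : ∀ v ∈ A, ∫ ω, X v ω ∂P = 1 := by
    intro v hv
    have : P.real (E v) ≠ 0 := (hp.trans_le (hpv v hv)).ne'
    simp only [X]
    rw [integral_indicator_const _ (hE v), smul_eq_mul, mul_inv_cancel₀ this]
  have eY : ∫ ω, Y ω ∂P = A.card := by
    simp only [Y]; rw [integral_finsetSum _ fun v _ => iX v, sum_congr rfl eX]; simp
  have iY : Integrable Y P := integrable_finsetSum _ fun v _ => iX v
  have hYY : ∀ ω, Y ω ^ 2 = ∑ v ∈ A, ∑ w ∈ A, X v ω * X w ω := fun ω => by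
    simp only [Y, pow_two, Finset.sum_mul_sum]
  have iYY : Integrable (fun ω => Y ω ^ 2) P := by
    simp only [hYY]; exact integrable_finsetSum _ fun v _ => integrable_finsetSum _ fun w _ => iXX v w
  have eYY : ∫ ω, Y ω ^ 2 ∂P ≤ (A.card : ℝ) ^ 2 * (1 + b) := by
    simp only [hYY]
    rw [integral_finsetSum _ fun v _ => integrable_finsetSum _ fun w _ => iXX v w]
    simp only [integral_finsetSum _ fun w _ => iXX _ w, eXX]
    exact h
  have i2 : Integrable (fun ω => (Y ω - A.card) ^ 2) P := by
    have : (fun ω => (Y ω - A.card) ^ 2) = fun ω => Y ω ^ 2 - 2 * A.card * Y ω + (A.card : ℝ) ^ 2 := by ext ω; ring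
    rw [this]; exact (iYY.sub (iY.const_mul _)).add (integrable_const _)
  have e2 : ∫ ω, (Y ω - A.card) ^ 2 ∂P ≤ (A.card : ℝ) ^ 2 * b := by
    have : (fun ω => (Y ω - A.card) ^ 2) = fun ω => Y ω ^ 2 - 2 * A.card * Y ω + (A.card : ℝ) ^ 2 := by ext ω; ring
    have i3 : Integrable (fun ω => Y ω ^ 2 - 2 * A.card * Y ω) P := iYY.sub (iY.const_mul _)
    rw [this, integral_add i3 (integrable_const _), integral_sub iYY (iY.const_mul _), integral_const_mul, eY]
    simp
    nlinarith
  have m := mul_meas_ge_le_integral_of_nonneg (μ := P) (f := fun ω => (Y ω - A.card) ^ 2) (ae_of_all _ fun ω => sq_nonneg _) i2 ((A.card : ℝ) ^ 2 / 4)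
  have hsub : {ω | ((A.filter (fun v => ω ∈ E v)).card : ℝ) < A.card / 2 * p} ⊆ {ω | (A.card : ℝ) ^ 2 / 4 ≤ (Y ω - A.card) ^ 2} := by
    intro ω hω
    rw [Set.mem_ofPred_eq] at hω ⊢
    have hY : Y ω ≤ (A.filter (fun v => ω ∈ E v)).card * p⁻¹ := by
      simp only [Y, X, Set.indicator]
      rw [← sum_filter]
      calc _ ≤ ∑ v ∈ A.filter (fun v => ω ∈ E v), p⁻¹ := sum_le_sum fun v hv =>
            inv_anti₀ hp (hpv v (mem_filter.1 hv).1)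
        _ = _ := by simp
    have : Y ω ≤ A.card / 2 := by
      refine hY.trans ?_
      rw [← div_eq_mul_inv, div_le_iff₀ hp]; exact hω.le
    nlinarith
  have m2 := measureReal_mono (μ := P) hsub
  change (A.card : ℝ) ^ 2 / 4 * P.real {ω | (A.card : ℝ) ^ 2 / 4 ≤ (Y ω - A.card) ^ 2} ≤ _ at m
  have h3 : (A.card : ℝ) ^ 2 / 4 * P.real {ω | (A.card : ℝ) ^ 2 / 4 ≤ (Y ω - A.card) ^ 2} ≤ (A.card : ℝ) ^ 2 / 4 * (4 * b) := by
    refine (m.trans e2).trans (le_of_eq (by ring))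
  exact m2.trans (le_of_mul_le_mul_left h3 (by positivity))
noncomputable def Ain (N : ℕ) : Finset Vtx := (VN N).filter (fun v => N ≤ 8 * dst N v)
lemma card_Ain {N : ℕ} (hN : 2 ≤ N) : (N:ℝ) ^ 2 / 16 ≤ ((Ain N).card : ℝ) := by
  set a : ℤ := ((N:ℤ) + 7) / 8 with ha
  have hsub : Icc a (N - a) ×ˢ Icc a (N - a) ⊆ Ain N := by
    rintro ⟨x, y⟩ h
    rw [mem_product, mem_Icc, mem_Icc] at h
    simp only at h
    rw [Ain, mem_filter, mem_VN]
    refine ⟨by simp only; omega, ?_⟩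
    unfold dst; simp only; omega
  have h1 := card_le_card hsub
  rw [card_product, Int.card_Icc] at h1
  have h2 : (N:ℝ) / 4 ≤ (((N:ℤ) - a + 1 - a).toNat : ℝ) := by
    rw [div_le_iff₀ (by norm_num)]
    exact_mod_cast (show N ≤ (((N:ℤ) - a + 1 - a).toNat) * 4 by omega)
  have h3 : ((((N:ℤ) - a + 1 - a).toNat * ((N:ℤ) - a + 1 - a).toNat : ℕ) : ℝ) ≤ ((Ain N).card : ℝ) := by exact_mod_cast h1
  push_cast at h3
  have : (0:ℝ) ≤ N := Nat.cast_nonneg _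
  nlinarith
def sd (v w : Vtx) : ℕ := max (v.1 - w.1).natAbs (v.2 - w.2).natAbs
lemma card_ball (A : Finset Vtx) (v : Vtx) (r : ℕ) : ((A.filter (fun w => sd v w < 2 * r)).card : ℝ) ≤ 16 * (r:ℝ) ^ 2 := by
  have hsub : A.filter (fun w => sd v w < 2 * r) ⊆ Ico (v.1 - 2 * r) (v.1 + 2 * r) ×ˢ Ico (v.2 - 2 * r) (v.2 + 2 * r) ∪
     Ico (v.1 - 2 * r) (v.1 + 2 * r) ×ˢ Ico (v.2 - 2 * r) (v.2 + 2 * r) := by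
    rintro ⟨x, y⟩ h
    rw [mem_filter] at h
    have := h.2
    unfold sd at this
    rw [Finset.union_idempotent, mem_product, mem_Ico, mem_Ico]
    simp only at *; omega
  rw [Finset.union_idempotent] at hsub
  have h1 := card_le_card hsub
  rw [card_product, Int.card_Ico, Int.card_Ico] at h1
  have e1 : (v.1 + 2 * (r:ℤ) - (v.1 - 2 * r)).toNat = 4 * r := by omega
  have e2 : (v.2 + 2 * (r:ℤ) - (v.2 - 2 * r)).toNat = 4 * r := by omega
  rw [e1, e2] at h1
  have h3 : ((A.filter (fun w => sd v w < 2 * r)).card : ℝ) ≤ ((4 * r * (4 * r) : ℕ) : ℝ) := by exact_mod_cast h1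
  push_cast at h3; linarith
lemma rad_le {N : ℕ} (hN : 1 ≤ N) {lam : ℝ} : (rad N lam : ℝ) ≤ exp ((1 - lam) * log N) := by
  have hN0 : (0:ℝ) < N := by exact_mod_cast hN
  unfold rad
  split_ifs with h
  · rw [h, sub_zero, one_mul, exp_log_N hN]
  · have h1 : (0:ℝ) ≤ (N:ℝ) ^ (1 - lam) / 2 := by positivity
    refine (Nat.floor_le h1).trans ?_
    rw [Real.rpow_def_of_pos hN0, mul_comm]
    have := exp_pos ((1 - lam) * log N)
    linarith
variable {n : ℕ} {s : ℕ → ℝ}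
lemma rad_three (hs : Ptn n s) : ∀ᶠ N : ℕ in atTop, ∀ i < n, 3 * rad N (s (i + 1)) ≤ rad N (s i) := by
  have hL : Tendsto (fun N : ℕ => log N) atTop atTop := Real.tendsto_log_atTop.comp tendsto_natCast_atTop_atTop
  have h : ∀ i ∈ range n, ∀ᶠ N : ℕ in atTop, 3 * rad N (s (i + 1)) ≤ rad N (s i) := by
    intro i hi
    rw [mem_range] at hi
    have hΔ := hs.lt i hi
    filter_upwards [hL.eventually_ge_atTop (8 / (s (i+1) - s i)), eventually_ge_atTop 1] with N h1 hN
    rw [div_le_iff₀ (by linarith)] at h1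
    have r1 := rad_lg (hs.nonneg (by omega)) (hs.le_one (j := i) (by omega)) hN
    have r2 := rad_lg (hs.nonneg (by omega)) (hs.le_one (j := i + 1) (by omega)) hN
    rw [abs_le] at r1 r2
    have h2 : lg (rad N (s (i + 1))) + 2 ≤ lg (rad N (s i)) := by nlinarith
    have h3 := exp_le_exp.2 h2
    have pos : ∀ r : ℕ, exp (lg r) = ((max 1 r : ℕ) : ℝ) := fun r => exp_log (by exact_mod_cast (show 0 < max 1 r by omega))
    rw [exp_add, pos, pos] at h3
    have h4 : (3:ℝ) ≤ exp 2 := by have := Real.add_one_le_exp (2:ℝ); linarith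
    have h5 : ((max 1 (rad N (s (i + 1))) : ℕ) : ℝ) * 3 ≤ ((max 1 (rad N (s i)) : ℕ) : ℝ) :=
      (mul_le_mul_of_nonneg_left h4 (Nat.cast_nonneg _)).trans h3
    have h6 : max 1 (rad N (s (i + 1))) * 3 ≤ max 1 (rad N (s i)) := by exact_mod_cast h5
    omega
  filter_upwards [(eventually_all_finset _).2 h] with N hN i hi
  exact hN i (mem_range.2 hi)
lemma geo_near {a b x : ℤ} {r r' d : ℕ} (h1 : (x - b).natAbs < r) (h2 : (a - b).natAbs ≤ d) (h3 : d < 2 * r) (h4 : 3 * r ≤ r') :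
    (x - a).natAbs < r' := by omega
lemma geo_far {a b x : ℤ} {r : ℕ} (h1 : (x - b).natAbs < r) (h2 : (x - a).natAbs ≤ r) : (a - b).natAbs < 2 * r := by omega
variable {N : ℕ} {G : Vtx → Vtx → ℝ}
lemma cross_zero (hG : IsGr (intr (VN N)) G) (hs : Ptn n s) (hN : 1 ≤ N) (h3 : ∀ i < n, 3 * rad N (s (i + 1)) ≤ rad N (s i))
    {v w : Vtx} {k : ℕ} (hk : k < n) (hd1 : 2 * rad N (s (k + 1)) ≤ sd v w) (hd2 : sd v w < 2 * rad N (s k)) {i j : ℕ} (hi : i < n) (hj : j < n)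
    (hik : i + 2 ≤ k ∨ k < i) (hjk : k < j) :
    CV N G (inc N s v i) (inc N s w j) = 0 := by
  rw [CV_symm hG]
  refine CV_inc_zero hG hs hN hj _ fun z hz => ?_
  have rj := rad_part hs hN (show k + 1 ≤ j by omega) hj.le
  rcases hik with hik | hik
  · refine inc_zero hs hN hi ?_
    have ri := rad_part hs hN (show i + 1 ≤ k - 1 by omega) (by omega)
    have r3 := h3 (k - 1) (by omega)
    rw [show k - 1 + 1 = k by omega] at r3
    have rk := rad_part hs hN (show k ≤ k + 1 by omega) (by omega)
    rw [mem_DD] at hz ⊢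
    refine ⟨hz.1, ?_, ?_⟩
    · exact geo_near (r := rad N (s k)) (by omega) (le_max_left _ _) hd2 (r3.trans ri)
    · exact geo_near (r := rad N (s k)) (by omega) (le_max_right _ _) hd2 (r3.trans ri)
  · by_contra hne
    have ri := rad_part hs hN (show k + 1 ≤ i by omega) hi.le
    have ri2 := rad_part hs hN (show k + 1 ≤ i + 1 by omega) hi
    have hsupp : (z.1 - v.1).natAbs ≤ rad N (s (k + 1)) ∧ (z.2 - v.2).natAbs ≤ rad N (s (k + 1)) := by
      by_cases h0 : hS N (s i) v z = 0
      · have h1 : hS N (s (i + 1)) v z ≠ 0 := fun h1 => hne (by simp only [inc]; rw [h0, h1, sub_zero])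
        have := hD_supp h1
        exact ⟨this.2.1.trans ri2, this.2.2.trans ri2⟩
      · have := hD_supp h0
        exact ⟨this.2.1.trans ri, this.2.2.trans ri⟩
    rw [mem_DD] at hz
    have g1 := geo_far (r := rad N (s (k + 1))) (by omega) hsupp.1 (b := w.1)
    have g2 := geo_far (r := rad N (s (k + 1))) (by omega) hsupp.2 (b := w.2)
    unfold sd at hd1
    omega
end lower
section lower2
open MeasureTheory ProbabilityTheory
lemma tail_event {y Δ c : ℝ} (hy : 0 ≤ y) (hΔ : 0 < Δ) (hc : y ^ 2 / (2 * Δ) < c) :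
    ∀ᶠ L : ℝ in atTop, ∀ V : ℝ, Δ * L - 300 ≤ V → 0 < V ∧ exp (-c * L) ≤ exp (-(y * L / sqrt V + 1) ^ 2 / 2) / 3 := by
  have t1 : Tendsto (fun L : ℝ => Δ - 300 / L) atTop (nhds Δ) := by
    have := (tendsto_const_nhds (x := Δ)).sub ((tendsto_const_nhds (x := (300:ℝ))).div_atTop tendsto_id)
    simpa using this
  have t2 : Tendsto (fun L : ℝ => y / sqrt (Δ - 300 / L)) atTop (nhds (y / sqrt Δ)) :=
    tendsto_const_nhds.div ((Real.continuous_sqrt.tendsto _).comp t1) (sqrt_pos.2 hΔ).ne'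
  have t3 : Tendsto (fun L : ℝ => 1 / sqrt L) atTop (nhds 0) := tendsto_const_nhds.div_atTop Real.tendsto_sqrt_atTop
  have t4 : Tendsto (fun L : ℝ => log 3 / L) atTop (nhds 0) := tendsto_const_nhds.div_atTop tendsto_id
  have t5 : Tendsto (fun L : ℝ => (y / sqrt (Δ - 300 / L) + 1 / sqrt L) ^ 2 / 2 + log 3 / L) atTop (nhds ((y / sqrt Δ + 0) ^ 2 / 2 + 0)) :=
    (((t2.add t3).pow 2).div_const 2).add t4
  have e : (y / sqrt Δ + 0) ^ 2 / 2 + 0 = y ^ 2 / (2 * Δ) := by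
    rw [add_zero, add_zero, div_pow, sq_sqrt hΔ.le]; field_simp
  rw [e] at t5
  filter_upwards [t5.eventually_lt_const hc, t1.eventually_const_lt hΔ, eventually_gt_atTop 0] with L h1 h2 hL V hV
  have hV' : L * (Δ - 300 / L) ≤ V := by
    have : L * (Δ - 300 / L) = Δ * L - 300 := by field_simp
    linarith
  have hp : 0 < L * (Δ - 300 / L) := mul_pos hL h2
  refine ⟨hp.trans_le hV', ?_⟩
  have e3 : exp (-(y * L / sqrt V + 1) ^ 2 / 2) / 3 = exp (-(y * L / sqrt V + 1) ^ 2 / 2 - log 3) := by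
    rw [Real.exp_sub, exp_log (by norm_num)]
  rw [e3]
  refine exp_le_exp.2 ?_
  have h3 : y * L / sqrt V ≤ sqrt L * (y / sqrt (Δ - 300 / L)) := by
    have h4 : sqrt L * sqrt (Δ - 300 / L) ≤ sqrt V := by
      rw [← Real.sqrt_mul hL.le]; exact Real.sqrt_le_sqrt hV'
    have h5 : 0 < sqrt L * sqrt (Δ - 300 / L) := mul_pos (sqrt_pos.2 hL) (sqrt_pos.2 h2)
    calc y * L / sqrt V ≤ y * L / (sqrt L * sqrt (Δ - 300 / L)) := by gcongr
      _ = _ := by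
        have h6 := sqrt_pos.2 h2
        have h7 := sqrt_pos.2 hL
        nth_rw 1 [← sq_sqrt hL.le]
        field_simp
  have h8 : 0 ≤ y * L / sqrt V := by positivity
  have h9 : (y * L / sqrt V + 1) ^ 2 ≤ L * (y / sqrt (Δ - 300 / L) + 1 / sqrt L) ^ 2 := by
    have h7 := sqrt_pos.2 hL
    calc (y * L / sqrt V + 1) ^ 2 ≤ (sqrt L * (y / sqrt (Δ - 300 / L)) + 1) ^ 2 := by gcongr
      _ = (sqrt L * (y / sqrt (Δ - 300 / L) + 1 / sqrt L)) ^ 2 := by congr 1; field_simp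
      _ = _ := by rw [mul_pow, sq_sqrt hL.le]
  have h10 : L * ((y / sqrt (Δ - 300 / L) + 1 / sqrt L) ^ 2 / 2 + log 3 / L) ≤ L * c := mul_le_mul_of_nonneg_left h1.le hL.le
  have h11 : L * ((y / sqrt (Δ - 300 / L) + 1 / sqrt L) ^ 2 / 2 + log 3 / L) = L * (y / sqrt (Δ - 300 / L) + 1 / sqrt L) ^ 2 / 2 + log 3 := by field_simp
  linarith
variable {n : ℕ} {s : ℕ → ℝ}
lemma tendsto_logN : Tendsto (fun N : ℕ => log N) atTop atTop := Real.tendsto_log_atTop.comp tendsto_natCast_atTop_atTop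
lemma level_prob (hs : Ptn n s) {y c : ℕ → ℝ} (hy : ∀ j < n, 0 ≤ y j) (hc : ∀ j < n, y j ^ 2 / (2 * (s (j + 1) - s j)) < c j) :
    ∀ᶠ N : ℕ in atTop, ∀ G P, GF N G P → ∀ v ∈ Ain N, ∀ j < n,
      exp (-c j * log N) ≤ P.real {ω | y j * log N ≤ lin N (inc N s v j) ω} := by
  have h : ∀ j ∈ range n, ∀ᶠ N : ℕ in atTop, ∀ V : ℝ, (s (j + 1) - s j) * log N - 300 ≤ V → 0 < V ∧
      exp (-c j * log N) ≤ exp (-(y j * log N / sqrt V + 1) ^ 2 / 2) / 3 := fun j hj => by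
    rw [mem_range] at hj
    exact tendsto_logN.eventually (tail_event (hy j hj) (sub_pos.2 (hs.lt j hj)) (hc j hj))
  filter_upwards [(eventually_all_finset _).2 h, eventually_ge_atTop 1] with N hN h1 G P hG v hv j hj
  rw [Ain, mem_filter] at hv
  have hV := var_lower hG.gr hv.1 hv.2 (hs.nonneg (by omega)) (hs.lt j hj).le (hs.le_one (by omega)) h1
  obtain ⟨a, b⟩ := hN j (mem_range.2 hj) _ hV
  exact b.trans (hG.tail_ge (inc N s v j) a (mul_nonneg (hy j hj) (log_nonneg (by exact_mod_cast h1))))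
def Ev (N n : ℕ) (s y : ℕ → ℝ) (j0 : ℕ) (v : Vtx) : Set FieldSp := {ω | ∀ j ∈ Ico j0 n, y j * log N ≤ lin N (inc N s v j) ω}
lemma Ev_meas {N : ℕ} (y : ℕ → ℝ) (j0 : ℕ) (v : Vtx) : MeasurableSet (Ev N n s y j0 v) := by
  have : Ev N n s y j0 v = ⋂ j ∈ Ico j0 n, {ω | y j * log N ≤ lin N (inc N s v j) ω} := by
    ext ω; simp [Ev]
  rw [this]
  exact Finset.measurableSet_biInter _ fun j _ => measurableSet_le measurable_const (lin_meas _)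
lemma Ev_prob {N : ℕ} {G : Vtx → Vtx → ℝ} {P : Measure FieldSp} (h : GF N G P) (hs : Ptn n s) (hN : 1 ≤ N) (y : ℕ → ℝ) (j0 : ℕ) (v : Vtx) :
    P.real (Ev N n s y j0 v) = ∏ j ∈ Ico j0 n, P.real {ω | y j * log N ≤ lin N (inc N s v j) ω} := by
  unfold Measure.real Ev
  rw [h.indep (Ico j0 n) (fun j => inc N s v j) (fun j => y j * log N), ENNReal.toReal_prod]
  intro i hi j hj hij
  rw [mem_Ico] at hi hj
  exact CV_inc_ne h.gr hs hN hi.2 hj.2 hij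
lemma rad_one (N : ℕ) : rad N 1 = 0 := by
  unfold rad
  rw [if_neg one_ne_zero, sub_self, Real.rpow_zero]
  exact Nat.floor_eq_zero.2 (by norm_num)
lemma ratio_abs {X A1 A2 D1 D2 a b L : ℝ} (h1 : 0 < A1) (h2 : 0 < A2) (hX : X ≤ A1 * A2) (hD1 : exp (-a * L) ≤ D1) (hD2 : exp (-b * L) ≤ D2) :
    X / ((A1 * D1) * (A2 * D2)) ≤ exp ((a + b) * L) := by
  have p1 := (exp_pos _).trans_le hD1
  have p2 := (exp_pos _).trans_le hD2
  rw [div_le_iff₀ (by positivity)]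
  have b3 : 1 ≤ exp ((a + b) * L) * (D1 * D2) := by
    calc (1:ℝ) = exp ((a + b) * L) * (exp (-a * L) * exp (-b * L)) := by
            rw [← exp_add, ← exp_add, ← Real.exp_zero]; congr 1; ring
      _ ≤ _ := mul_le_mul_of_nonneg_left (mul_le_mul hD1 hD2 (exp_pos _).le p1.le) (exp_pos _).le
  calc X ≤ (A1 * A2) * 1 := by linarith
    _ ≤ (A1 * A2) * _ := mul_le_mul_of_nonneg_left b3 (by positivity)
    _ = _ := by ring
set_option maxHeartbeats 1000000 in
lemma pair_bound {N : ℕ} {G : Vtx → Vtx → ℝ} {P : Measure FieldSp} (h : GF N G P) (hs : Ptn n s) (hN : 1 ≤ N)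
    (h3 : ∀ i < n, 3 * rad N (s (i + 1)) ≤ rad N (s i)) {y c : ℕ → ℝ} {μ : ℝ} (j0 : ℕ) (hc0 : ∀ j < n, 0 ≤ c j) (hμ : ∀ j < n, c j ≤ μ)
    (hn : 0 < n) {v w : Vtx} (hvV : v ∈ VN N) (hwV : w ∈ VN N)
    (hv : ∀ j < n, exp (-c j * log N) ≤ P.real {ω | y j * log N ≤ lin N (inc N s v j) ω})
    (hw : ∀ j < n, exp (-c j * log N) ≤ P.real {ω | y j * log N ≤ lin N (inc N s w j) ω}) :
    P.real (Ev N n s y j0 v ∩ Ev N n s y j0 w) / (P.real (Ev N n s y j0 v) * P.real (Ev N n s y j0 w)) ≤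
      1 + ∑ i ∈ Ico j0 n, if sd v w < 2 * rad N (s i) then exp ((∑ j ∈ range i, c j + 3 * μ) * log N) else 0 := by
  have := h.prob
  set L := log N with hL
  have hL0 : 0 ≤ L := log_nonneg (by exact_mod_cast hN)
  have hex : ∃ m, 2 * rad N (s m) ≤ sd v w := ⟨n, by rw [hs.one, rad_one]; omega⟩
  have hf1 := Nat.find_spec hex
  have hf2 : Nat.find hex ≤ n := Nat.find_min' hex (by rw [hs.one, rad_one]; omega)
  have hf0 : Nat.find hex ≠ 0 := by
    intro e
    rw [e, hs.zero] at hf1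
    simp only [rad, if_true] at hf1
    rw [mem_VN] at hvV hwV
    unfold sd at hf1
    omega
  obtain ⟨k, hk⟩ : ∃ k, Nat.find hex = k + 1 := ⟨Nat.find hex - 1, by omega⟩
  have hd2 : sd v w < 2 * rad N (s k) := not_le.1 (Nat.find_min hex (by omega))
  rw [hk] at hf1
  have hkn : k < n := by omega
  set I := Ico j0 n with hI
  have hIn : ∀ i ∈ I, i < n := fun i hi => (mem_Ico.1 hi).2
  set q : Vtx → ℕ → ℝ := fun u j => P.real {ω | y j * L ≤ lin N (inc N s u j) ω} with hq
  obtain ⟨pv, hpv⟩ : ∃ pv : ℕ → Prop, ∀ i, pv i ↔ (i + 2 ≤ k ∨ k < i) := ⟨_, fun _ => Iff.rfl⟩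
  obtain ⟨pw, hpw⟩ : ∃ pw : ℕ → Prop, ∀ i, pw i ↔ k < i := ⟨_, fun _ => Iff.rfl⟩
  have hkeep : P.real (Ev N n s y j0 v ∩ Ev N n s y j0 w) ≤ (∏ i ∈ I.filter pv, q v i) * ∏ j ∈ I.filter pw, q w j := by
    have hi := h.indep ((I.filter pv).disjSum (I.filter pw)) (Sum.elim (fun i => inc N s v i) (fun j => inc N s w j))
      (Sum.elim (fun i => y i * L) (fun j => y j * L)) ?_
    · rw [Finset.prod_disjSum] at hi
      have hi2 := congrArg ENNReal.toReal hi
      rw [ENNReal.toReal_mul, ENNReal.toReal_prod, ENNReal.toReal_prod] at hi2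
      refine le_trans ?_ (le_of_eq hi2)
      refine measureReal_mono ?_
      rintro ω ⟨h1, h2⟩ i hi
      rw [Finset.mem_disjSum] at hi
      rcases hi with ⟨a, ha, rfl⟩ | ⟨a, ha, rfl⟩
      · exact h1 a (mem_filter.1 ha).1
      · exact h2 a (mem_filter.1 ha).1
    · intro i hi j hj hij
      rw [Finset.mem_disjSum] at hi hj
      rcases hi with ⟨a, ha, rfl⟩ | ⟨a, ha, rfl⟩ <;> rcases hj with ⟨b, hb, rfl⟩ | ⟨b, hb, rfl⟩ <;>
        rw [mem_filter] at ha hb <;> simp only [Sum.elim_inl, Sum.elim_inr]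
      · exact CV_inc_ne h.gr hs hN (hIn a ha.1) (hIn b hb.1) (fun e => hij (by rw [e]))
      · exact cross_zero h.gr hs hN h3 hkn hf1 hd2 (hIn a ha.1) (hIn b hb.1) ((hpv _).1 ha.2) ((hpw _).1 hb.2)
      · rw [CV_symm h.gr]; exact cross_zero h.gr hs hN h3 hkn hf1 hd2 (hIn b hb.1) (hIn a ha.1) ((hpv _).1 hb.2) ((hpw _).1 ha.2)
      · exact CV_inc_ne h.gr hs hN (hIn a ha.1) (hIn b hb.1) (fun e => hij (by rw [e]))
  have qpos : ∀ u, (u = v ∨ u = w) → ∀ j < n, exp (-c j * L) ≤ q u j := by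
    rintro u (rfl | rfl) j hj
    · exact hv j hj
    · exact hw j hj
  have hdrop : ∀ u, (u = v ∨ u = w) → ∀ p : ℕ → Prop, exp (-(∑ i ∈ I.filter (fun i => ¬ p i), c i) * L) ≤ ∏ i ∈ I.filter (fun i => ¬ p i), q u i := by
    intro u hu p
    rw [← sum_neg_distrib, sum_mul, Real.exp_sum]
    exact Finset.prod_le_prod (fun i _ => (exp_pos _).le) fun i hi => qpos u hu i (hIn i (mem_filter.1 hi).1)
  have hkp : ∀ u, (u = v ∨ u = w) → ∀ p : ℕ → Prop, 0 < ∏ i ∈ I.filter p, q u i := by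
    intro u hu p
    exact Finset.prod_pos fun i hi => (exp_pos _).trans_le (qpos u hu i (hIn i (mem_filter.1 hi).1))
  have ratio : P.real (Ev N n s y j0 v ∩ Ev N n s y j0 w) / (P.real (Ev N n s y j0 v) * P.real (Ev N n s y j0 w)) ≤
      exp ((∑ i ∈ I.filter (fun i => ¬ pv i), c i + ∑ i ∈ I.filter (fun i => ¬ pw i), c i) * L) := by
    rw [Ev_prob h hs hN, Ev_prob h hs hN]
    change _ / ((∏ i ∈ I, q v i) * ∏ i ∈ I, q w i) ≤ _
    rw [← Finset.prod_filter_mul_prod_filter_not I pv (q v), ← Finset.prod_filter_mul_prod_filter_not I pw (q w)]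
    exact ratio_abs (hkp v (Or.inl rfl) pv) (hkp w (Or.inr rfl) pw) hkeep (hdrop v (Or.inl rfl) pv) (hdrop w (Or.inr rfl) pw)
  refine ratio.trans ?_
  have hnn : ∀ i ∈ I, (0:ℝ) ≤ if sd v w < 2 * rad N (s i) then exp ((∑ j ∈ range i, c j + 3 * μ) * L) else 0 := by
    intro i _; split_ifs
    · positivity
    · exact le_rfl
  by_cases hj : j0 ≤ k
  · have hkI : k ∈ I := mem_Ico.2 ⟨hj, hkn⟩
    have s1 := single_le_sum hnn hkI
    rw [if_pos hd2] at s1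
    have hμ0 : 0 ≤ μ := (hc0 0 hn).trans (hμ 0 hn)
    have d1 : ∑ i ∈ I.filter (fun i => ¬ pv i), c i ≤ 2 * μ := by
      have hcard : (I.filter (fun i => ¬ pv i)).card ≤ 2 := by
        have : I.filter (fun i => ¬ pv i) ⊆ {k, k - 1} := by
          intro i hi
          rw [mem_filter] at hi
          simp only [hpv, not_or, Finset.mem_insert, Finset.mem_singleton] at hi ⊢
          omega
        exact (card_le_card this).trans Finset.card_le_two
      calc _ ≤ ∑ i ∈ I.filter (fun i => ¬ pv i), μ := sum_le_sum fun i hi => hμ i (hIn i (mem_filter.1 hi).1)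
        _ = ((I.filter (fun i => ¬ pv i)).card : ℝ) * μ := by simp
        _ ≤ _ := mul_le_mul_of_nonneg_right (by exact_mod_cast hcard) hμ0
    have d2 : ∑ i ∈ I.filter (fun i => ¬ pw i), c i ≤ ∑ j ∈ range k, c j + μ := by
      calc _ ≤ ∑ j ∈ range (k + 1), c j := by
            refine sum_le_sum_of_subset_of_nonneg ?_ fun i hi _ => hc0 i (by rw [mem_range] at hi; omega)
            intro i hi
            rw [mem_filter] at hi
            simp only [hpw] at hi
            rw [mem_range]; omega
        _ ≤ _ := by rw [sum_range_succ]; linarith [hμ k hkn]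
    have : exp ((∑ i ∈ I.filter (fun i => ¬ pv i), c i + ∑ i ∈ I.filter (fun i => ¬ pw i), c i) * L) ≤ exp ((∑ j ∈ range k, c j + 3 * μ) * L) :=
      exp_le_exp.2 (mul_le_mul_of_nonneg_right (by linarith) hL0)
    linarith
  · have e1 : I.filter (fun i => ¬ pv i) = ∅ := Finset.filter_eq_empty_iff.2 fun i hi => by
      have := (mem_Ico.1 hi).1
      simp only [hpv, not_not]; omega
    have e2 : I.filter (fun i => ¬ pw i) = ∅ := Finset.filter_eq_empty_iff.2 fun i hi => by
      have := (mem_Ico.1 hi).1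
      simp only [hpw, not_not]; omega
    rw [e1, e2]
    simp only [Finset.sum_empty, add_zero, zero_mul, Real.exp_zero]
    linarith [sum_nonneg hnn]
end lower2
section lower3
open MeasureTheory ProbabilityTheory
variable {n : ℕ} {s : ℕ → ℝ}
lemma tendsto_exp_neg {a : ℝ} (ha : a < 0) : Tendsto (fun N : ℕ => exp (a * log N)) atTop (nhds 0) :=
  Real.tendsto_exp_atBot.comp (tendsto_logN.const_mul_atTop_of_neg ha)
lemma lower_count (hs : Ptn n s) (hn : 0 < n) {y c : ℕ → ℝ} {μ : ℝ} {j0 : ℕ} (hy : ∀ j < n, 0 ≤ y j)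
    (hc : ∀ j < n, y j ^ 2 / (2 * (s (j + 1) - s j)) < c j) (hμ : ∀ j < n, c j ≤ μ)
    (hbr : ∀ i, j0 ≤ i → i < n → ∑ j ∈ range i, c j + 3 * μ < 2 * s i) :
    ∃ b : ℕ → ℝ, Tendsto b atTop (nhds 0) ∧ ∀ᶠ N : ℕ in atTop, ∀ G P, GF N G P →
      P.real {ω | (((Ain N).filter (fun v => ω ∈ Ev N n s y j0 v)).card : ℝ) < (Ain N).card / 2 * exp (-(∑ j ∈ Ico j0 n, c j) * log N)} ≤ b N := by
  refine ⟨fun N => 4 * ∑ i ∈ Ico j0 n, 256 * exp ((∑ j ∈ range i, c j + 3 * μ - 2 * s i) * log N), ?_, ?_⟩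
  · have : Tendsto (fun N : ℕ => 4 * ∑ i ∈ Ico j0 n, 256 * exp ((∑ j ∈ range i, c j + 3 * μ - 2 * s i) * log N)) atTop (nhds (4 * ∑ i ∈ Ico j0 n, 256 * 0)) := by
      refine (tendsto_finsetSum _ fun i hi => ?_).const_mul _
      rw [mem_Ico] at hi
      exact (tendsto_exp_neg (by linarith [hbr i hi.1 hi.2])).const_mul _
    simpa using this
  have hc0 : ∀ j < n, 0 ≤ c j := fun j hj => by
    have h1 := hs.lt j hj
    have : 0 ≤ y j ^ 2 / (2 * (s (j + 1) - s j)) := div_nonneg (sq_nonneg _) (by linarith)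
    exact this.trans (hc j hj).le
  filter_upwards [level_prob hs hy hc, rad_three hs, eventually_ge_atTop 2] with N h1 h3 hN G P h
  have := h.prob
  have hN1 : 1 ≤ N := by omega
  have hcA := card_Ain hN
  set L := log N with hL
  have eN : (N:ℝ) ^ 2 = exp (2 * L) := by
    rw [two_mul, exp_add, exp_log_N hN1]; ring
  have hcp : 0 < (Ain N).card := by
    have : (0:ℝ) < (Ain N).card := lt_of_lt_of_le (by rw [eN]; positivity) hcA
    exact_mod_cast this
  have hAV : ∀ v ∈ Ain N, v ∈ VN N := fun v hv => (mem_filter.1 hv).1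
  refine second_moment (Ain N) (Ev N n s y j0) (fun v => Ev_meas _ _ _) (exp_pos _) ?_ hcp ?_
  · intro v hv
    rw [Ev_prob h hs hN1, ← sum_neg_distrib, sum_mul, Real.exp_sum]
    exact Finset.prod_le_prod (fun i _ => (exp_pos _).le) fun i hi => h1 G P h v hv i (mem_Ico.1 hi).2
  · set K : ℝ := ((Ain N).card : ℝ) with hK
    have row : ∀ v ∈ Ain N, ∑ w ∈ Ain N, P.real (Ev N n s y j0 v ∩ Ev N n s y j0 w) / (P.real (Ev N n s y j0 v) * P.real (Ev N n s y j0 w)) ≤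
        K * (1 + ∑ i ∈ Ico j0 n, 256 * exp ((∑ j ∈ range i, c j + 3 * μ - 2 * s i) * L)) := by
      intro v hv
      calc _ ≤ ∑ w ∈ Ain N, (1 + ∑ i ∈ Ico j0 n, if sd v w < 2 * rad N (s i) then exp ((∑ j ∈ range i, c j + 3 * μ) * L) else 0) :=
            sum_le_sum fun w hw => pair_bound h hs hN1 h3 j0 hc0 hμ hn (hAV v hv) (hAV w hw) (h1 G P h v hv) (h1 G P h w hw)
        _ = K + ∑ i ∈ Ico j0 n, (((Ain N).filter (fun w => sd v w < 2 * rad N (s i))).card : ℝ) * exp ((∑ j ∈ range i, c j + 3 * μ) * L) := by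
            rw [sum_add_distrib, sum_comm]
            congr 1
            · simp [hK]
            · refine sum_congr rfl fun i _ => ?_
              rw [← sum_filter]; simp
        _ ≤ K + ∑ i ∈ Ico j0 n, K * (256 * exp ((∑ j ∈ range i, c j + 3 * μ - 2 * s i) * L)) := by
            refine add_le_add le_rfl (sum_le_sum fun i _ => ?_)
            have q1 := card_ball (Ain N) v (rad N (s i))
            have q2 := rad_le hN1 (lam := s i)
            have q3 : ((rad N (s i) : ℕ) : ℝ) ^ 2 ≤ exp (2 * L) * exp (-2 * s i * L) := by
              calc _ ≤ exp ((1 - s i) * L) ^ 2 := by gcongr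
                _ = _ := by rw [← exp_nat_mul, ← exp_add]; congr 1; push_cast; ring
            have q4 : exp ((∑ j ∈ range i, c j + 3 * μ - 2 * s i) * L) = exp (-2 * s i * L) * exp ((∑ j ∈ range i, c j + 3 * μ) * L) := by
              rw [← exp_add]; congr 1; ring
            rw [q4]
            rw [eN] at hcA
            have q5 : (((Ain N).filter (fun w => sd v w < 2 * rad N (s i))).card : ℝ) ≤ K * 256 * exp (-2 * s i * L) := by
              refine q1.trans ?_
              have := mul_le_mul_of_nonneg_right hcA (exp_pos (-2 * s i * L)).le
              nlinarith
            have := mul_le_mul_of_nonneg_right q5 (exp_pos ((∑ j ∈ range i, c j + 3 * μ) * L)).le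
            linarith
        _ = _ := by rw [← mul_sum]; ring
    calc _ ≤ ∑ v ∈ Ain N, K * (1 + ∑ i ∈ Ico j0 n, 256 * exp ((∑ j ∈ range i, c j + 3 * μ - 2 * s i) * L)) := sum_le_sum row
      _ = _ := by rw [Finset.sum_const, nsmul_eq_mul]; ring
lemma low_levels (hs : Ptn n s) (τ : ℕ → ℝ) {j0 : ℕ} (hj0 : j0 ≤ n) {ε : ℝ} (hε : 0 < ε)
    (hlow : ∑ j ∈ range j0, τ j ^ 2 * (s (j + 1) - s j) ≤ ε ^ 2 / 18) :
    ∃ C : ℝ, ∀ N : ℕ, 1 ≤ N → ∀ G P, GF N G P →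
      P.real {ω | ∃ v ∈ VN N, ω ∈ {ω | ∑ j ∈ range j0, τ j * lin N (inc N s v j) ω < - ε * log N}} ≤ C * exp (-3 * log N) := by
  set a : ℕ → ℝ := fun j => -(6 / ε) * τ j with ha
  set B := 150 * ∑ j ∈ range n, a j ^ 2 with hB
  refine ⟨4 * exp B, fun N hN G P h => ?_⟩
  have := h.prob
  set L := log N with hL
  have hL0 : 0 ≤ L := log_nonneg (by exact_mod_cast hN)
  refine (union_le (VN N) _ (exp (B - 5 * L)) fun v hv => ?_).trans ?_
  · have hsub : {ω | ∑ j ∈ range j0, τ j * lin N (inc N s v j) ω < - ε * L} ⊆ {ω | 6 * L ≤ lin N (SS N s a j0 v) ω} := by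
      intro ω hω
      rw [Set.mem_ofPred_eq] at hω ⊢
      rw [lin_SS]
      have : ∑ j ∈ range j0, a j * lin N (inc N s v j) ω = -(6 / ε) * ∑ j ∈ range j0, τ j * lin N (inc N s v j) ω := by
        rw [mul_sum]; exact sum_congr rfl fun j _ => by simp only [ha]; ring
      rw [this]
      have h6 : 0 < 6 / ε := by positivity
      have := mul_le_mul_of_nonneg_left hω.le h6.le
      have e : 6 / ε * (-ε * L) = -(6 * L) := by field_simp
      linarith
    refine (measureReal_mono hsub).trans ((h.tail_le _ _).trans (exp_le_exp.2 ?_))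
    have hv2 := var_half hs a hj0 hN h.gr hv
    have : Ak s a j0 - 2 * s j0 ≤ 1 := by
      rw [Ak_eq hs, add_sub_cancel_left]
      have e : ∑ j ∈ range j0, a j ^ 2 * (s (j + 1) - s j) = 36 / ε ^ 2 * ∑ j ∈ range j0, τ j ^ 2 * (s (j + 1) - s j) := by
        rw [mul_sum]; exact sum_congr rfl fun j _ => by simp only [ha]; ring
      rw [e]
      have := mul_le_mul_of_nonneg_left hlow (show 0 ≤ 36 / ε ^ 2 by positivity)
      have e2 : 36 / ε ^ 2 * (ε ^ 2 / 18) = 2 := by field_simp; norm_num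
      linarith
    nlinarith
  · calc _ ≤ (4 * exp (2 * L)) * exp (B - 5 * L) := mul_le_mul_of_nonneg_right (card_VN_le hN) (exp_pos _).le
      _ = 4 * (exp (2 * L) * exp (B - 5 * L)) := by ring
      _ = 4 * (exp B * exp (-3 * L)) := by rw [← exp_add, ← exp_add]; congr 2; ring
      _ = _ := by ring
lemma lower_bound (hs : Ptn n s) (hn : 0 < n) {y c τ : ℕ → ℝ} {μ β ε : ℝ} {j0 : ℕ} (hj0 : j0 ≤ n) (hy : ∀ j < n, 0 ≤ y j) (hτ : ∀ j < n, 0 ≤ τ j)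
    (hβ : 0 < β) (hε : 0 < ε)
    (hc : ∀ j < n, y j ^ 2 / (2 * (s (j + 1) - s j)) < c j) (hμ : ∀ j < n, c j ≤ μ)
    (hbr : ∀ i, j0 ≤ i → i < n → ∑ j ∈ range i, c j + 3 * μ < 2 * s i)
    (hlow : ∑ j ∈ range j0, τ j ^ 2 * (s (j + 1) - s j) ≤ ε ^ 2 / 18) :
    ∃ b : ℕ → ℝ, Tendsto b atTop (nhds 0) ∧ ∀ᶠ N : ℕ in atTop, ∀ G P, GF N G P →
      P.real {ω | ∑ v ∈ VN N, exp (β * ∑ j ∈ range n, τ j * lin N (inc N s v j) ω) <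
        exp ((2 - ∑ j ∈ Ico j0 n, c j + β * ∑ j ∈ Ico j0 n, τ j * y j - (β + 1) * ε) * log N)} ≤ b N := by
  obtain ⟨b, hb, hb2⟩ := lower_count hs hn hy hc hμ hbr
  obtain ⟨C, hC⟩ := low_levels hs τ hj0 hε hlow
  refine ⟨fun N => b N + C * exp (-3 * log N), ?_, ?_⟩
  · simpa using hb.add ((tendsto_exp_neg (a := -3) (by norm_num)).const_mul C)
  have t1 := (tendsto_exp_neg (a := -ε) (by linarith)).eventually_lt_const (show (0:ℝ) < 1 / 32 by norm_num)
  filter_upwards [hb2, eventually_ge_atTop 2, t1] with N h1 hN h2 G P h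
  have := h.prob
  have hN1 : 1 ≤ N := by omega
  refine le_trans ?_ (add_le_add (h1 G P h) (hC N hN1 G P h))
  refine le_trans (measureReal_mono ?_) (measureReal_union_le _ _)
  set L := log N with hL
  intro ω hω
  by_contra hcon
  rw [Set.mem_union, not_or] at hcon
  obtain ⟨g1, g2⟩ := hcon
  rw [Set.mem_ofPred_eq] at hω g1 g2
  push Not at g2
  rw [not_lt] at g1
  have hL0 : 0 ≤ L := log_nonneg (by exact_mod_cast hN1)
  have eN : (N:ℝ) ^ 2 = exp (2 * L) := by
    rw [two_mul, exp_add, exp_log_N hN1]; ring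
  have hcA := card_Ain hN
  rw [eN] at hcA
  set F := (Ain N).filter (fun v => ω ∈ Ev N n s y j0 v) with hF
  have hFs : F ⊆ VN N := fun v hv => (mem_filter.1 (mem_filter.1 hv).1).1
  set Y := ∑ j ∈ Ico j0 n, τ j * y j with hY
  have z1 : (F.card : ℝ) * exp (β * (Y - ε) * L) ≤ ∑ v ∈ VN N, exp (β * ∑ j ∈ range n, τ j * lin N (inc N s v j) ω) := by
    calc _ = ∑ v ∈ F, exp (β * (Y - ε) * L) := by simp
      _ ≤ ∑ v ∈ F, exp (β * ∑ j ∈ range n, τ j * lin N (inc N s v j) ω) := by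
        refine sum_le_sum fun v hv => exp_le_exp.2 ?_
        rw [mul_assoc]
        refine mul_le_mul_of_nonneg_left ?_ hβ.le
        have k1 := g2 v (hFs hv)
        rw [Set.mem_ofPred_eq, not_lt] at k1
        have k2 : Y * L ≤ ∑ j ∈ Ico j0 n, τ j * lin N (inc N s v j) ω := by
          rw [hY, sum_mul]
          refine sum_le_sum fun j hj => ?_
          rw [mul_assoc]
          exact mul_le_mul_of_nonneg_left ((mem_filter.1 hv).2 j hj) (hτ j (mem_Ico.1 hj).2)
        rw [← sum_range_add_sum_Ico _ hj0]
        linarith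
      _ ≤ _ := sum_le_sum_of_subset_of_nonneg hFs fun _ _ _ => (exp_pos _).le
  have z2 : exp (2 * L) * exp (-ε * L) * exp (-(∑ j ∈ Ico j0 n, c j) * L) ≤ F.card := by
    refine le_trans (mul_le_mul_of_nonneg_right ?_ (exp_pos _).le) g1
    have := mul_le_mul_of_nonneg_left h2.le (exp_pos (2 * L)).le
    linarith
  have z3 := mul_le_mul_of_nonneg_right z2 (exp_pos (β * (Y - ε) * L)).le
  rw [← exp_add, ← exp_add, ← exp_add] at z3
  have e : 2 * L + -ε * L + -(∑ j ∈ Ico j0 n, c j) * L + β * (Y - ε) * L = (2 - ∑ j ∈ Ico j0 n, c j + β * Y - (β + 1) * ε) * L := by ring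
  rw [e] at z3
  linarith
end lower3
section partn
lemma Ptn.smono {n : ℕ} {s : ℕ → ℝ} (h : Ptn n s) {i j : ℕ} (hij : i < j) (hj : j ≤ n) : s i < s j :=
  (h.lt i (by omega)).trans_le (h.mono hij hj)
lemma Ptn.idx {n : ℕ} {s : ℕ → ℝ} (h : Ptn n s) {i j : ℕ} (hi : i ≤ n) (hij : s i < s j) : i < j := by
  by_contra hc
  exact absurd (h.mono (not_lt.1 hc) hi) (not_le.2 hij)
lemma Ptn.pos {n : ℕ} {s : ℕ → ℝ} (h : Ptn n s) : 0 < n := by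
  rcases Nat.eq_zero_or_pos n with rfl | h0
  · have := h.zero; rw [h.one] at this; norm_num at this
  · exact h0
lemma exists_ptn (S : Finset ℝ) (hS : ∀ x ∈ S, 0 ≤ x ∧ x ≤ 1) {κ : ℝ} (hκ : 0 < κ) :
    ∃ (n : ℕ) (s : ℕ → ℝ), Ptn n s ∧ (∀ j < n, s (j + 1) - s j ≤ κ) ∧ ∀ p ∈ S, ∃ k ≤ n, s k = p := by
  obtain ⟨K, hK⟩ := exists_nat_one_div_lt hκ
  set q : ℝ := (K:ℝ) + 1 with hq
  have hq0 : 0 < q := by positivity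
  set T : Finset ℝ := S ∪ {0, 1} ∪ (range (K + 2)).image (fun k : ℕ => (k:ℝ) / q) with hT
  have hT01 : ∀ x ∈ T, 0 ≤ x ∧ x ≤ 1 := by
    intro x hx
    rw [hT, mem_union, mem_union, mem_image] at hx
    rcases hx with (hx | hx) | ⟨k, hk, rfl⟩
    · exact hS x hx
    · simp at hx; rcases hx with rfl | rfl <;> norm_num
    · rw [mem_range] at hk
      refine ⟨by positivity, (div_le_one hq0).2 ?_⟩
      have : (k:ℝ) ≤ ((K + 1 : ℕ) : ℝ) := by exact_mod_cast (by omega : k ≤ K + 1)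
      push_cast at this; linarith
  have h0 : (0:ℝ) ∈ T := by simp [hT]
  have h1 : (1:ℝ) ∈ T := by simp [hT]
  obtain ⟨n, hn⟩ : ∃ n, T.card = n + 1 := ⟨T.card - 1, by have := Finset.card_pos.2 ⟨0, h0⟩; omega⟩
  set f := T.orderEmbOfFin hn with hf
  have hfm : ∀ i, f i ∈ T := fun i => Finset.orderEmbOfFin_mem T hn i
  have hfs : ∀ x ∈ T, ∃ i, f i = x := fun x hx => by
    have := Finset.range_orderEmbOfFin T hn
    have hx' : x ∈ Set.range (T.orderEmbOfFin hn) := by rw [this]; exact hx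
    exact hx'
  set s : ℕ → ℝ := fun j => if h : j < n + 1 then f ⟨j, h⟩ else 0 with hs
  have sv : ∀ i : Fin (n + 1), s i = f i := fun i => by simp only [hs]; rw [dif_pos i.2]
  have sm : ∀ i j : ℕ, i < j → j ≤ n → s i < s j := by
    intro i j hij hj
    simp only [hs]
    rw [dif_pos (by omega), dif_pos (by omega)]
    exact f.strictMono (by simpa using hij)
  have hP : Ptn n s := by
    refine ⟨?_, ?_, fun j hj => sm j (j + 1) (by omega) hj⟩
    · obtain ⟨i, hi⟩ := hfs 0 h0
      have : s 0 = f 0 := sv 0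
      rw [this]
      exact le_antisymm (hi ▸ f.monotone (Fin.zero_le i)) (hT01 _ (hfm 0)).1
    · obtain ⟨i, hi⟩ := hfs 1 h1
      have : s n = f (Fin.last n) := sv (Fin.last n)
      rw [this]
      exact le_antisymm (hT01 _ (hfm _)).2 (hi ▸ f.monotone (Fin.le_last i))
  have hTs : ∀ x ∈ T, ∃ k ≤ n, s k = x := fun x hx => by
    obtain ⟨i, hi⟩ := hfs x hx
    exact ⟨i, by have := i.2; omega, by rw [sv, hi]⟩
  refine ⟨n, s, hP, fun j hj => ?_, fun p hp => hTs p (by simp [hT, hp])⟩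
  have a0 := hP.nonneg (show j ≤ n by omega)
  have a1 : s j < 1 := by rw [← hP.one]; exact hP.smono hj le_rfl
  set k := ⌊s j * q⌋₊ with hk
  have k1 : (k:ℝ) ≤ s j * q := Nat.floor_le (by positivity)
  have k2 : s j * q < k + 1 := Nat.lt_floor_add_one _
  have k3 : k < K + 1 := by
    have : (k:ℝ) < q := by nlinarith
    rw [hq] at this
    exact_mod_cast this
  obtain ⟨i, hi, hi2⟩ := hTs (((k + 1 : ℕ) : ℝ) / q) (by
    rw [hT, mem_union]; right
    exact mem_image.2 ⟨k + 1, mem_range.2 (by omega), rfl⟩)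
  have hij : j < i := hP.idx (by omega) (by
    rw [hi2, lt_div_iff₀ hq0]; push_cast; exact k2)
  have := hP.mono (show j + 1 ≤ i from hij) hi
  rw [hi2] at this
  have e : ((k + 1 : ℕ) : ℝ) / q ≤ s j + 1 / q := by
    rw [div_le_iff₀ hq0, add_mul, div_mul_cancel₀ _ hq0.ne']; push_cast; linarith
  linarith
noncomputable def st (M : ℕ) (a lam : ℕ → ℝ) (r : ℝ) : ℝ := ∑ i ∈ Icc 1 M, if lam (i - 1) < r ∧ r ≤ lam i then a i else 0
lemma st_eq {M : ℕ} {lam : ℕ → ℝ} (h : Ptn M lam) (a : ℕ → ℝ) {i : ℕ} (hi : i ∈ Icc 1 M) {r : ℝ} (h1 : lam (i - 1) < r) (h2 : r ≤ lam i) :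
    st M a lam r = a i := by
  unfold st
  rw [Finset.sum_eq_single_of_mem i hi, if_pos ⟨h1, h2⟩]
  intro k hk hki
  rw [mem_Icc] at hi hk
  rw [if_neg]
  rintro ⟨b1, b2⟩
  rcases lt_or_gt_of_ne hki with hlt | hlt
  · exact absurd (h.mono (show k ≤ i - 1 by omega) (by omega)) (not_le.2 (by linarith))
  · exact absurd (h.mono (show i ≤ k - 1 by omega) (by omega)) (not_le.2 (by linarith))
lemma st_ex {M : ℕ} {lam : ℕ → ℝ} (h : Ptn M lam) {r : ℝ} (h0 : 0 < r) (h1 : r ≤ 1) :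
    ∃ i ∈ Icc 1 M, lam (i - 1) < r ∧ r ≤ lam i := by
  have hex : ∃ i, r ≤ lam i := ⟨M, by rw [h.one]; exact h1⟩
  have a := Nat.find_spec hex
  have b : Nat.find hex ≤ M := Nat.find_min' hex (by rw [h.one]; exact h1)
  have c : Nat.find hex ≠ 0 := fun e => by rw [e, h.zero] at a; linarith
  exact ⟨Nat.find hex, mem_Icc.2 ⟨by omega, b⟩, not_le.1 (Nat.find_min hex (by omega)), a⟩
variable {n : ℕ} {s : ℕ → ℝ}
lemma point_sum (hs : Ptn n s) (X : ℝ → ℝ) {k : ℕ} (hk : k ≤ n) :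
    X (s k) - X 0 = ∑ j ∈ range n, if s (j + 1) ≤ s k then X (s (j + 1)) - X (s j) else 0 := by
  rw [← sum_filter]
  have : (range n).filter (fun j => s (j + 1) ≤ s k) = range k := by
    ext j
    rw [mem_filter, mem_range, mem_range]
    constructor
    · rintro ⟨h1, h2⟩
      by_contra hc
      exact absurd h2 (not_le.2 (hs.smono (by omega) (by omega)))
    · intro h
      exact ⟨by omega, hs.mono (by omega) hk⟩
  rw [this, sum_range_sub (fun j => X (s j)), hs.zero]
lemma step_sum (hs : Ptn n s) {M : ℕ} {lam : ℕ → ℝ} (hl : Ptn M lam) (hp : ∀ i ≤ M, ∃ k ≤ n, s k = lam i) (a : ℕ → ℝ) (X : ℝ → ℝ) :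
    ∑ i ∈ Icc 1 M, a i * (X (lam i) - X (lam (i - 1))) = ∑ j ∈ range n, st M a lam (s (j + 1)) * (X (s (j + 1)) - X (s j)) := by
  have e : ∀ i ≤ M, X (lam i) - X 0 = ∑ j ∈ range n, if s (j + 1) ≤ lam i then X (s (j + 1)) - X (s j) else 0 := by
    intro i hi
    obtain ⟨k, hk, e⟩ := hp i hi
    rw [← e]; exact point_sum hs X hk
  simp only [st, sum_mul]
  rw [sum_comm]
  refine sum_congr rfl fun i hi => ?_
  rw [mem_Icc] at hi
  have e1 := e i hi.2
  have e2 := e (i - 1) (by omega)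
  have e3 : X (lam i) - X (lam (i - 1)) = (X (lam i) - X 0) - (X (lam (i - 1)) - X 0) := by ring
  rw [e3, e1, e2, ← sum_sub_distrib, mul_sum]
  refine sum_congr rfl fun j _ => ?_
  have := hl.lt (i - 1) (by omega)
  rw [Nat.sub_add_cancel hi.1] at this
  by_cases c1 : s (j + 1) ≤ lam i <;> by_cases c2 : s (j + 1) ≤ lam (i - 1)
  · rw [if_pos c1, if_pos c2, if_neg (by rintro ⟨q, _⟩; linarith)]; ring
  · rw [if_pos c1, if_neg c2, if_pos ⟨by linarith, c1⟩]; ring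
  · exfalso; exact c1 (by linarith)
  · rw [if_neg c1, if_neg c2, if_neg (by rintro ⟨_, q⟩; exact c1 q)]; ring
def Adp (n : ℕ) (s : ℕ → ℝ) (f : ℝ → ℝ) : Prop := ∀ j < n, ∀ r, s j < r → r ≤ s (j + 1) → f r = f (s (j + 1))
lemma st_adp (hs : Ptn n s) {M : ℕ} {lam : ℕ → ℝ} (hp : ∀ i ≤ M, ∃ k ≤ n, s k = lam i) (a : ℕ → ℝ) : Adp n s (st M a lam) := by
  intro j hj r h1 h2
  unfold st
  refine sum_congr rfl fun i hi => ?_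
  rw [mem_Icc] at hi
  have key : ∀ i ≤ M, (lam i < r ↔ lam i < s (j + 1)) := by
    intro i hi
    obtain ⟨k, hk, e⟩ := hp i hi
    rw [← e]
    constructor
    · intro h; linarith
    · intro h
      have := hs.idx hk h
      linarith [hs.mono (show k ≤ j by omega) (by omega)]
  have e1 := key (i - 1) (by omega)
  have e2 := key i hi.2
  have e3 : (r ≤ lam i ↔ s (j + 1) ≤ lam i) := by rw [← not_lt, ← not_lt, e2]
  simp only [e1, e3]
open MeasureTheory intervalIntegral in
lemma adp_cell {f : ℝ → ℝ} (h : Adp n s f) (hs : Ptn n s) {j : ℕ} (hj : j < n) :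
    IntervalIntegrable f volume (s j) (s (j + 1)) ∧ ∫ r in (s j)..(s (j + 1)), f r = f (s (j + 1)) * (s (j + 1) - s j) := by
  have hlt := hs.lt j hj
  have hEq : Set.EqOn (fun _ => f (s (j + 1))) f (Set.uIoc (s j) (s (j + 1))) := by
    intro r hr
    rw [Set.uIoc_of_le hlt.le] at hr
    exact (h j hj r hr.1 hr.2).symm
  constructor
  · exact (intervalIntegrable_congr hEq).1 intervalIntegrable_const
  · rw [← integral_congr_ae (ae_of_all _ fun r hr => hEq hr), intervalIntegral.integral_const, smul_eq_mul, mul_comm]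
open MeasureTheory intervalIntegral in
lemma adp_int {f : ℝ → ℝ} (h : Adp n s f) (hs : Ptn n s) {i k : ℕ} (hik : i ≤ k) (hk : k ≤ n) :
    IntervalIntegrable f volume (s i) (s k) ∧ ∫ r in (s i)..(s k), f r = ∑ j ∈ Ico i k, f (s (j + 1)) * (s (j + 1) - s j) := by
  constructor
  · exact IntervalIntegrable.trans_iterate_Ico hik fun j hj => (adp_cell h hs (by have := hj.2; omega)).1
  · rw [← sum_integral_adjacent_intervals_Ico (a := s) hik fun j hj => (adp_cell h hs (by have := hj.2; omega)).1]
    refine sum_congr rfl fun j hj => ?_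
    rw [mem_Ico] at hj
    exact (adp_cell h hs (by omega)).2
end partn
section sys
open MeasureTheory
structure Sys (n : ℕ) (s τ ς : ℕ → ℝ) : Prop where
  ptn : Ptn n s
  τpos : ∀ j < n, 0 < τ j
  ςpos : ∀ j < n, 0 < ς j
  anti : ∀ j, j + 1 < n → ς (j + 1) ≤ ς j
  le : ∀ k ≤ n, ∑ j ∈ range k, τ j ^ 2 * (s (j + 1) - s j) ≤ ∑ j ∈ range k, ς j ^ 2 * (s (j + 1) - s j)
  eq : ∑ j ∈ range n, τ j ^ 2 * (s (j + 1) - s j) = ∑ j ∈ range n, ς j ^ 2 * (s (j + 1) - s j)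
  jump : ∀ k, k + 1 < n → ς (k + 1) = ς k ∨
    ∑ j ∈ range (k + 1), τ j ^ 2 * (s (j + 1) - s j) = ∑ j ∈ range (k + 1), ς j ^ 2 * (s (j + 1) - s j)
variable {n : ℕ} {s τ ς : ℕ → ℝ}
lemma Sys.gsum (h : Sys n s τ ς) (g : ℝ → ℝ) (k : ℕ) (hk : k < n) :
    ∑ j ∈ range (k + 1), g (ς j) * (τ j ^ 2 * (s (j + 1) - s j)) = ∑ j ∈ range (k + 1), g (ς j) * (ς j ^ 2 * (s (j + 1) - s j)) +
      g (ς k) * (∑ j ∈ range (k + 1), τ j ^ 2 * (s (j + 1) - s j) - ∑ j ∈ range (k + 1), ς j ^ 2 * (s (j + 1) - s j)) := by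
  induction k with
  | zero => simp; ring
  | succ k ih =>
    have ih := ih (by omega)
    rw [sum_range_succ, ih, sum_range_succ _ (k + 1), sum_range_succ (fun j => τ j ^ 2 * _) (k + 1),
      sum_range_succ (fun j => ς j ^ 2 * _) (k + 1)]
    rcases h.jump k hk with e | e
    · rw [e]; ring
    · rw [e]; ring
lemma Sys.gsum_eq (h : Sys n s τ ς) (g : ℝ → ℝ) :
    ∑ j ∈ range n, g (ς j) * (τ j ^ 2 * (s (j + 1) - s j)) = ∑ j ∈ range n, g (ς j) * (ς j ^ 2 * (s (j + 1) - s j)) := by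
  obtain ⟨k, rfl⟩ : ∃ k, n = k + 1 := ⟨n - 1, by have := h.ptn.pos; omega⟩
  rw [h.gsum g k (by omega), h.eq]; ring
lemma Sys.gsum_le (h : Sys n s τ ς) (g : ℝ → ℝ) (hg : ∀ x, 0 ≤ g x) {k : ℕ} (hk : k ≤ n) :
    ∑ j ∈ range k, g (ς j) * (τ j ^ 2 * (s (j + 1) - s j)) ≤ ∑ j ∈ range k, g (ς j) * (ς j ^ 2 * (s (j + 1) - s j)) := by
  rcases k with _ | k
  · simp
  rw [h.gsum g k (by omega)]
  have := h.le (k + 1) hk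
  nlinarith [hg (ς k)]
noncomputable def th (β x : ℝ) : ℝ := min 1 (2 / (β * x))
noncomputable def Fv (n : ℕ) (s ς : ℕ → ℝ) (β : ℝ) : ℝ := ∑ j ∈ range n, fREM (ς j) β * (s (j + 1) - s j)
lemma th_cases {β x : ℝ} (hβ : 0 < β) (hx : 0 < x) :
    (β * x ≤ 2 ∧ th β x = 1 ∧ fREM x β = 1 + (β * x / 2) ^ 2) ∨ (2 < β * x ∧ th β x = 2 / (β * x) ∧ fREM x β = β * x) := by
  have hp : 0 < β * x := by positivity
  have e : β / (2 / x) = β * x / 2 := by field_simp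
  rcases le_or_gt (β * x) 2 with h | h
  · refine Or.inl ⟨h, min_eq_left ((one_le_div hp).2 h), ?_⟩
    unfold fREM
    rw [if_neg (not_lt.2 ((le_div_iff₀ hx).2 h)), e]
  · refine Or.inr ⟨h, min_eq_right ((div_le_one hp).2 h.le), ?_⟩
    unfold fREM
    rw [if_pos ((div_lt_iff₀ hx).2 h), e]; ring
lemma th_pos {β x : ℝ} (hβ : 0 < β) (hx : 0 < x) : 0 < th β x := lt_min one_pos (by positivity)
lemma Sys.upper (h : Sys n s τ ς) {β ε : ℝ} (hβ : 0 < β) (hε : 0 < ε) :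
    ∃ C δ : ℝ, 0 < δ ∧ ∀ N : ℕ, 1 ≤ N → ∀ G P, GF N G P →
      P.real {ω | exp ((2 * Fv n s ς β + ε) * log N)
        < ∑ v ∈ VN N, exp (β * ∑ j ∈ range n, τ j * lin N (inc N s v j) ω)} ≤ C * exp (-δ * log N) := by
  set ρ : ℕ → ℝ := fun j => if j < n then 1 / th β (ς j) else 1 with hρ
  have hth1 : ∀ x, th β x ≤ 1 := fun x => min_le_left _ _
  have hE : ∑ j ∈ range n, ρ j * (2 * (s (j + 1) - s j) + (β / ρ j * τ j) ^ 2 * (s (j + 1) - s j) / 2) = 2 * Fv n s ς β := by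
    have e1 : ∀ j ∈ range n, ρ j * (2 * (s (j + 1) - s j) + (β / ρ j * τ j) ^ 2 * (s (j + 1) - s j) / 2) =
        2 / th β (ς j) * (s (j + 1) - s j) + β ^ 2 / 2 * (th β (ς j) * (τ j ^ 2 * (s (j + 1) - s j))) := by
      intro j hj
      rw [mem_range] at hj
      have := th_pos hβ (h.ςpos j hj)
      simp only [hρ, if_pos hj]
      field_simp
    rw [sum_congr rfl e1, sum_add_distrib, ← mul_sum, h.gsum_eq (th β), mul_sum, ← sum_add_distrib, Fv, mul_sum]
    refine sum_congr rfl fun j hj => ?_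
    rw [mem_range] at hj
    have hx := h.ςpos j hj
    rcases th_cases hβ hx with ⟨_, a, b⟩ | ⟨_, a, b⟩
    · rw [a, b]; ring
    · rw [a, b]; field_simp; ring
  have := upper_bound h.ptn τ ρ β ?_ (by simp [hρ]) hε
  · rw [hE] at this
    exact this
  · intro k hk
    simp only [hρ, if_pos hk]
    have p := th_pos hβ (h.ςpos k hk)
    split_ifs with h1
    · have p1 := h.ςpos (k + 1) h1
      refine one_div_le_one_div_of_le p ?_
      have := h.anti k h1
      exact min_le_min le_rfl (by gcongr)
    · exact (one_le_div p).2 (hth1 _)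
lemma lower_arith {T β ε : ℝ} (hβ : 0 < β) (hT : 0 < T) (hε : 0 < ε) : ∃ η e δ κ : ℝ, 0 < η ∧ η < 1 ∧ 0 < e ∧ 0 < κ ∧ κ ≤ δ ∧ δ < 1 ∧
    T ^ 2 * (δ + κ) ≤ e ^ 2 / 18 ∧ 3 * (β ^ 2 * T ^ 2 / 2 * κ) < 2 * η * δ ∧ β ^ 2 * (e ^ 2 / 18) + η * (β ^ 2 * T ^ 2) + (β + 1) * e ≤ ε := by
  obtain ⟨e, he0, he1, he2⟩ : ∃ e : ℝ, 0 < e ∧ e ≤ 1 ∧ (β ^ 2 + β + 1) * e ≤ ε / 2 := by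
    refine ⟨min 1 (ε / 2 / (β ^ 2 + β + 1)), lt_min one_pos (by positivity), min_le_left _ _, ?_⟩
    rw [mul_comm, ← le_div_iff₀ (by positivity)]; exact min_le_right _ _
  obtain ⟨η, h0, h1, h2⟩ : ∃ η : ℝ, 0 < η ∧ η ≤ 1 / 2 ∧ η * (β ^ 2 * T ^ 2) ≤ ε / 2 := by
    refine ⟨min (1 / 2) (ε / 2 / (β ^ 2 * T ^ 2)), lt_min (by norm_num) (by positivity), min_le_left _ _, ?_⟩
    rw [← le_div_iff₀ (by positivity)]; exact min_le_right _ _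
  obtain ⟨δ, d0, d1, d2⟩ : ∃ δ : ℝ, 0 < δ ∧ δ ≤ 1 / 2 ∧ δ * (T ^ 2 * 2) ≤ e ^ 2 / 18 := by
    refine ⟨min (1 / 2) (e ^ 2 / 18 / (T ^ 2 * 2)), lt_min (by norm_num) (by positivity), min_le_left _ _, ?_⟩
    rw [← le_div_iff₀ (by positivity)]; exact min_le_right _ _
  obtain ⟨κ, k0, k1, k2⟩ : ∃ κ : ℝ, 0 < κ ∧ κ ≤ δ ∧ κ * (3 * (β ^ 2 * T ^ 2 / 2)) ≤ η * δ := by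
    refine ⟨min δ (η * δ / (3 * (β ^ 2 * T ^ 2 / 2))), lt_min d0 (by positivity), min_le_left _ _, ?_⟩
    rw [← le_div_iff₀ (by positivity)]; exact min_le_right _ _
  have : 0 < η * δ := by positivity
  refine ⟨η, e, δ, κ, h0, by linarith, he0, k0, k1, by linarith, by nlinarith, by linarith, ?_⟩
  have : e ^ 2 / 18 ≤ e := by nlinarith
  nlinarith [mul_le_mul_of_nonneg_left this (sq_nonneg β)]
lemma lower_exists {T β ε : ℝ} (hβ : 0 < β) (hT : 0 < T) (hε : 0 < ε) : ∃ κ : ℝ, 0 < κ ∧ ∀ (n : ℕ) (s τ ς : ℕ → ℝ), Sys n s τ ς → (∀ j < n, s (j + 1) - s j ≤ κ) →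
    (∀ j < n, τ j ≤ T) → ∃ b : ℕ → ℝ, Tendsto b atTop (nhds 0) ∧ ∀ᶠ N : ℕ in atTop, ∀ G P, GF N G P →
      P.real {ω | ∑ v ∈ VN N, exp (β * ∑ j ∈ range n, τ j * lin N (inc N s v j) ω) <
        exp ((2 * Fv n s ς β - ε) * log N)} ≤ b N := by
  obtain ⟨η, e, δ, κ, hη0, hη1, he, hκ, hκδ, hδ1, c1, c2, c3⟩ := lower_arith hβ hT hε
  refine ⟨κ, hκ, fun n s τ ς h hmesh hτT => ?_⟩
  have hP := h.ptn
  have hΔ : ∀ j < n, 0 < s (j + 1) - s j := fun j hj => sub_pos.2 (hP.lt j hj)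
  set t : ℕ → ℝ := fun j => β * th β (ς j) with ht
  have ht0 : ∀ j < n, 0 < t j := fun j hj => mul_pos hβ (th_pos hβ (h.ςpos j hj))
  have htβ : ∀ j, t j ≤ β := fun j => by
    have : th β (ς j) ≤ 1 := min_le_left _ _
    simp only [ht]; nlinarith
  set V : ℕ → ℝ := fun j => τ j ^ 2 * (s (j + 1) - s j) with hV
  have hV0 : ∀ j < n, 0 < V j := fun j hj => mul_pos (pow_pos (h.τpos j hj) 2) (hΔ j hj)
  have hVT : ∀ j < n, V j ≤ T ^ 2 * (s (j + 1) - s j) := fun j hj => by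
    have := pow_le_pow_left₀ (h.τpos j hj).le (hτT j hj) 2
    exact mul_le_mul_of_nonneg_right this (hΔ j hj).le
  have hex : ∃ j, δ ≤ s j := ⟨n, by rw [hP.one]; exact hδ1.le⟩
  set j0 := Nat.find hex with hj0
  have hj1 : δ ≤ s j0 := Nat.find_spec hex
  have hjn : j0 ≤ n := Nat.find_min' hex (by rw [hP.one]; exact hδ1.le)
  have hj0' : j0 ≠ 0 := fun e0 => by rw [e0, hP.zero] at hj1; linarith
  have hj2 : s j0 ≤ δ + κ := by
    have a := Nat.find_min hex (m := j0 - 1) (by omega)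
    have b := hmesh (j0 - 1) (by omega)
    rw [Nat.sub_add_cancel (by omega)] at b
    linarith
  have hlow : ∑ j ∈ range j0, V j ≤ e ^ 2 / 18 := by
    calc _ ≤ ∑ j ∈ range j0, T ^ 2 * (s (j + 1) - s j) := sum_le_sum fun j hj => hVT j (by rw [mem_range] at hj; omega)
      _ = T ^ 2 * s j0 := by rw [← mul_sum, sum_range_sub, hP.zero, sub_zero]
      _ ≤ T ^ 2 * (δ + κ) := by gcongr
      _ ≤ _ := c1
  have hpart : ∀ i ≤ n, ∑ j ∈ range i, t j ^ 2 * V j / 2 ≤ 2 * s i := by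
    intro i hi
    have a := h.gsum_le (fun x => (β * th β x) ^ 2) (fun x => sq_nonneg _) hi
    have b : ∑ j ∈ range i, (β * th β (ς j)) ^ 2 * (ς j ^ 2 * (s (j + 1) - s j)) ≤ ∑ j ∈ range i, 4 * (s (j + 1) - s j) := by
      refine sum_le_sum fun j hj => ?_
      rw [mem_range] at hj
      have hx := h.ςpos j (by omega)
      have hd := hΔ j (by omega)
      rw [← mul_assoc, ← mul_pow]
      refine mul_le_mul_of_nonneg_right ?_ hd.le
      have : β * th β (ς j) * ς j ≤ 2 := by
        have := min_le_right 1 (2 / (β * ς j))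
        calc β * th β (ς j) * ς j = th β (ς j) * (β * ς j) := by ring
          _ ≤ 2 / (β * ς j) * (β * ς j) := mul_le_mul_of_nonneg_right this (by positivity)
          _ = 2 := by field_simp
      have h0 : 0 ≤ β * th β (ς j) * ς j := mul_nonneg (ht0 j (by omega)).le hx.le
      nlinarith
    rw [← mul_sum, sum_range_sub, hP.zero, sub_zero] at b
    rw [← sum_div]
    simp only [ht, hV]
    linarith
  set y : ℕ → ℝ := fun j => (1 - η) * (t j * τ j * (s (j + 1) - s j)) with hy
  set c : ℕ → ℝ := fun j => (1 - η) * (t j ^ 2 * V j / 2) with hc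
  have hη' : 0 < 1 - η := by linarith
  obtain ⟨b, hb, hb2⟩ := lower_bound (β := β) (τ := τ) (y := y) (c := c) (μ := β ^ 2 * T ^ 2 / 2 * κ) (ε := e) (j0 := j0) hP hP.pos hjn
    (fun j hj => by
      have := ht0 j hj; have := h.τpos j hj; have := hΔ j hj
      simp only [hy]; positivity) (fun j hj => (h.τpos j hj).le) hβ he
    (fun j hj => by
      have h1 := ht0 j hj; have h2 := hV0 j hj; have h3 := hΔ j hj
      have e1 : y j ^ 2 / (2 * (s (j + 1) - s j)) = (1 - η) * ((1 - η) * (t j ^ 2 * V j / 2)) := by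
        simp only [hy, hV]; field_simp
      rw [e1]
      have : 0 < t j ^ 2 * V j / 2 := by positivity
      simp only [hc]
      nlinarith [mul_pos hη' this])
    (fun j hj => by
      have h1 := ht0 j hj; have h2 := hV0 j hj; have h3 := hΔ j hj
      have e1 : t j ^ 2 ≤ β ^ 2 := pow_le_pow_left₀ h1.le (htβ j) 2
      have e2 : V j ≤ T ^ 2 * κ := (hVT j hj).trans (mul_le_mul_of_nonneg_left (hmesh j hj) (sq_nonneg _))
      have e3 : t j ^ 2 * V j ≤ β ^ 2 * (T ^ 2 * κ) := mul_le_mul e1 e2 h2.le (sq_nonneg _)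
      have : 0 < t j ^ 2 * V j / 2 := by positivity
      simp only [hc]
      nlinarith)
    (fun i h1 h2 => by
      have a := hpart i h2.le
      have b := hP.mono h1 h2.le
      simp only [hc]
      rw [← mul_sum]
      nlinarith) hlow
  refine ⟨b, hb, ?_⟩
  filter_upwards [hb2, eventually_ge_atTop 1] with N h1 hN G P hG
  have := hG.prob
  refine le_trans (measureReal_mono ?_) (h1 G P hG)
  intro ω hω
  rw [Set.mem_ofPred_eq] at hω ⊢
  refine hω.trans_le (exp_le_exp.2 (mul_le_mul_of_nonneg_right ?_ (log_nonneg (by exact_mod_cast hN))))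
  have F1 : 2 * Fv n s ς β = 2 - ∑ j ∈ range n, t j ^ 2 * V j / 2 + β * ∑ j ∈ range n, t j * V j := by
    have a := h.gsum_eq (fun x => (β * th β x) ^ 2)
    have b := h.gsum_eq (fun x => (β * th β x))
    simp only [ht, hV]
    rw [← sum_div, a, b]
    have e2 : (2:ℝ) = ∑ j ∈ range n, 2 * (s (j + 1) - s j) := by
      rw [← mul_sum, sum_range_sub, hP.zero, hP.one]; ring
    rw [sum_div, mul_sum]
    nth_rw 2 [e2]
    rw [← sum_sub_distrib, ← sum_add_distrib, Fv, mul_sum]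
    refine sum_congr rfl fun j hj => ?_
    rw [mem_range] at hj
    have hx := h.ςpos j hj
    rcases th_cases hβ hx with ⟨_, a, b⟩ | ⟨_, a, b⟩
    · rw [a, b]; ring
    · rw [a, b]; field_simp; ring
  have S1 : ∑ j ∈ Ico j0 n, c j ≤ ∑ j ∈ range n, t j ^ 2 * V j / 2 := by
    rw [← sum_range_add_sum_Ico _ hjn]
    have p1 : 0 ≤ ∑ j ∈ range j0, t j ^ 2 * V j / 2 := sum_nonneg fun j hj => by
      have := hV0 j (by rw [mem_range] at hj; omega)
      positivity
    have p2 : ∑ j ∈ Ico j0 n, c j ≤ ∑ j ∈ Ico j0 n, t j ^ 2 * V j / 2 := sum_le_sum fun j hj => by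
      have := hV0 j (by rw [mem_Ico] at hj; omega)
      have : 0 ≤ t j ^ 2 * V j / 2 := by positivity
      simp only [hc]; nlinarith
    linarith
  have S2 : ∑ j ∈ Ico j0 n, τ j * y j = (1 - η) * ∑ j ∈ Ico j0 n, t j * V j := by
    rw [mul_sum]; exact sum_congr rfl fun j _ => by simp only [hy, hV]; ring
  have S3 : ∑ j ∈ range n, t j * V j = ∑ j ∈ range j0, t j * V j + ∑ j ∈ Ico j0 n, t j * V j :=
    (sum_range_add_sum_Ico _ hjn).symm
  have S4 : ∑ j ∈ range j0, t j * V j ≤ β * (e ^ 2 / 18) := by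
    refine le_trans ?_ (mul_le_mul_of_nonneg_left hlow hβ.le)
    rw [mul_sum]
    exact sum_le_sum fun j hj => mul_le_mul_of_nonneg_right (htβ j) (hV0 j (by rw [mem_range] at hj; omega)).le
  have S5 : ∑ j ∈ Ico j0 n, t j * V j ≤ β * T ^ 2 := by
    calc _ ≤ ∑ j ∈ Ico j0 n, β * (T ^ 2 * (s (j + 1) - s j)) := sum_le_sum fun j hj => by
            rw [mem_Ico] at hj
            exact mul_le_mul (htβ j) (hVT j hj.2) (hV0 j hj.2).le hβ.le
      _ = β * T ^ 2 * (s n - s j0) := by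
          rw [← mul_sum, ← mul_sum, sum_Ico_sub _ hjn]; ring
      _ ≤ β * T ^ 2 * 1 := by
          refine mul_le_mul_of_nonneg_left ?_ (by positivity)
          have := hP.nonneg hjn
          rw [hP.one]; linarith
      _ = _ := by ring
  rw [F1, S2, S3]
  have S4' := mul_le_mul_of_nonneg_left S4 hβ.le
  have S5' := mul_le_mul_of_nonneg_left S5 (show 0 ≤ η * β by positivity)
  linarith
end sys
section hull
lemma hull_bdd (J : ℝ → ℝ) {t : ℝ} (ht : t ∈ Set.Icc (0:ℝ) 1) : BddBelow {y | ∃ g : ℝ → ℝ, ConcaveOn ℝ (Set.Icc (0:ℝ) 1) g ∧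
    (∀ t ∈ Set.Icc (0:ℝ) 1, J t ≤ g t) ∧ y = g t} := by
  refine ⟨J t, ?_⟩
  rintro y ⟨g, _, h2, rfl⟩
  exact h2 t ht
lemma hull_le {J g : ℝ → ℝ} (h1 : ConcaveOn ℝ (Set.Icc (0:ℝ) 1) g) (h2 : ∀ t ∈ Set.Icc (0:ℝ) 1, J t ≤ g t) {t : ℝ} (ht : t ∈ Set.Icc (0:ℝ) 1) :
    concaveHull J t ≤ g t := csInf_le (hull_bdd J ht) ⟨g, h1, h2, rfl⟩
lemma le_hull {J : ℝ → ℝ} {K : ℝ} (hK : ∀ t ∈ Set.Icc (0:ℝ) 1, J t ≤ K) {t x : ℝ} (h : ∀ g : ℝ → ℝ, ConcaveOn ℝ (Set.Icc (0:ℝ) 1) g →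
    (∀ t ∈ Set.Icc (0:ℝ) 1, J t ≤ g t) → x ≤ g t) : x ≤ concaveHull J t := by
  refine le_csInf ⟨K, fun _ => K, concaveOn_const _ (convex_Icc _ _), hK, rfl⟩ ?_
  rintro y ⟨g, h1, h2, rfl⟩
  exact h g h1 h2
lemma hull_concave {J : ℝ → ℝ} {K : ℝ} (hK : ∀ t ∈ Set.Icc (0:ℝ) 1, J t ≤ K) : ConcaveOn ℝ (Set.Icc (0:ℝ) 1) (concaveHull J) := by
  refine ⟨convex_Icc _ _, fun x hx y hy a b ha hb hab => le_hull hK fun g h1 h2 => ?_⟩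
  have := h1.2 hx hy ha hb hab
  have q1 := hull_le h1 h2 hx
  have q2 := hull_le h1 h2 hy
  simp only [smul_eq_mul] at *
  nlinarith
lemma line_concave (u c p : ℝ) : ConcaveOn ℝ (Set.Icc (0:ℝ) 1) (fun t => u + c * (t - p)) := by
  refine ⟨convex_Icc _ _, fun x _ y _ a b _ _ hab => le_of_eq ?_⟩
  have : b = 1 - a := by linarith
  subst this
  simp only [smul_eq_mul]; ring
lemma touch {J : ℝ → ℝ} {K₀ K p a b : ℝ} (hK : ∀ t ∈ Set.Icc (0:ℝ) 1, J t ≤ K₀) (hp : p ∈ Set.Icc (0:ℝ) 1) (hK0 : 0 ≤ K)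
    (hL : ∀ t ∈ Set.Icc (0:ℝ) 1, J t ≤ J p + K * |t - p|) (hab : b < a)
    (h1 : ∀ t ∈ Set.Icc (0:ℝ) 1, t ≤ p → concaveHull J t ≤ concaveHull J p + a * (t - p))
    (h2 : ∀ t ∈ Set.Icc (0:ℝ) 1, p ≤ t → concaveHull J t ≤ concaveHull J p + b * (t - p)) : concaveHull J p = J p := by
  refine le_antisymm ?_ (le_hull hK fun g _ h => h p hp)
  by_contra hc
  rw [not_le] at hc
  set H := concaveHull J with hH
  set d := (a - b) / 2 with hd
  set c := (a + b) / 2 with hcd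
  have hd0 : 0 < d := by rw [hd]; linarith
  set q := 1 + (|c| + K) / d with hq
  have hq0 : 0 < q := by positivity
  set h := (H p - J p) / q with hh
  have hh0 : 0 < h := div_pos (by linarith) hq0
  have hgap : h + (|c| + K) * (h / d) = H p - J p := by
    have : h * q = H p - J p := div_mul_cancel₀ _ hq0.ne'
    rw [← this, hq]; field_simp
  have hg : ∀ t ∈ Set.Icc (0:ℝ) 1, J t ≤ (H ⊓ fun t => (H p - h) + c * (t - p)) t := by
    intro t ht
    rw [Pi.inf_apply]
    have hJH : J t ≤ H t := le_hull hK fun g _ h => h t ht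
    refine le_inf hJH ?_
    by_cases hfar : h / d ≤ |t - p|
    · rw [div_le_iff₀ hd0] at hfar
      refine hJH.trans ?_
      rcases le_total t p with htp | htp
      · rw [abs_of_nonpos (by linarith)] at hfar
        have := h1 t ht htp
        have e : a = c + d := by rw [hcd, hd]; ring
        rw [e] at this; linarith
      · rw [abs_of_nonneg (by linarith)] at hfar
        have := h2 t ht htp
        have e : b = c - d := by rw [hcd, hd]; ring
        rw [e] at this; linarith
    · rw [not_le] at hfar
      have := hL t ht
      have a1 : K * |t - p| ≤ K * (h / d) := mul_le_mul_of_nonneg_left hfar.le hK0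
      have a2 : |c| * |t - p| ≤ |c| * (h / d) := mul_le_mul_of_nonneg_left hfar.le (abs_nonneg _)
      have a3 := neg_abs_le (c * (t - p))
      rw [abs_mul] at a3
      linarith
  have := hull_le ((hull_concave hK).inf (line_concave _ _ _)) hg hp
  rw [Pi.inf_apply] at this
  have e := this.trans inf_le_right
  simp only [sub_self, mul_zero, add_zero] at e
  linarith
end hull
section eff
open MeasureTheory
variable {M : ℕ} {sigv lamv : ℕ → ℝ} {m : ℕ} {sigb lamb : ℕ → ℝ} {sigbar : ℝ → ℝ}
lemma ScaleParams.ptn (h : ScaleParams M sigv lamv) : Ptn M lamv := ⟨h.2.2.1, h.2.2.2.1, h.2.2.2.2⟩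
lemma EffParams.ptn (h : EffParams M sigv lamv m sigb lamb sigbar) : Ptn m lamb := ⟨h.2.2.1, h.2.2.2.1, h.2.2.2.2.1⟩
lemma stepFn_st {r : ℝ} (hr : r ≠ 0) : stepFn M sigv lamv r = st M sigv lamv r := by
  unfold stepFn st; rw [if_neg hr, zero_add]
lemma sigbar_st (h : EffParams M sigv lamv m sigb lamb sigbar) {r : ℝ} (h0 : 0 < r) (h1 : r ≤ 1) : sigbar r = st m sigb lamb r := by
  obtain ⟨i, hi, a, b⟩ := st_ex h.ptn h0 h1
  rw [st_eq h.ptn _ hi a b]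
  exact h.2.2.2.2.2.2.2.2.1 i hi r a b
lemma EffParams.anti (h : EffParams M sigv lamv m sigb lamb sigbar) {i j : ℕ} (hi : 1 ≤ i) (hij : i ≤ j) (hj : j ≤ m) : sigb j ≤ sigb i := by
  induction j, hij using Nat.le_induction with
  | base => exact le_rfl
  | succ j hij ih => exact (h.2.2.2.2.2.1 j (by omega) (by omega)).le.trans (ih (by omega))
lemma EffParams.pos (h : EffParams M sigv lamv m sigb lamb sigbar) {i : ℕ} (hi : 1 ≤ i) (hj : i ≤ m) : 0 < sigb i :=
  h.2.2.2.2.2.2.1 i (mem_Icc.2 ⟨hi, hj⟩)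
lemma sigbar_ge (h : EffParams M sigv lamv m sigb lamb sigbar) {l : ℕ} (hl : l ≤ m) {r : ℝ} (h0 : 0 < r) (h1 : r ≤ lamb l) : sigb l ≤ sigbar r := by
  obtain ⟨i, hi, a, b⟩ := st_ex h.ptn h0 (h1.trans (h.ptn.le_one hl))
  rw [h.2.2.2.2.2.2.2.2.1 i hi r a b]
  rw [mem_Icc] at hi
  have := h.ptn.idx (i := i - 1) (j := l) (by omega) (a.trans_le h1)
  exact h.anti hi.1 (by omega) hl
lemma sigbar_le (h : EffParams M sigv lamv m sigb lamb sigbar) {l : ℕ} (hl : l ≤ m) {r : ℝ} (h1 : lamb l < r) (h2 : r ≤ 1) : sigbar r ≤ sigb (l + 1) := by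
  have h0 := h.ptn.nonneg hl
  obtain ⟨i, hi, a, b⟩ := st_ex h.ptn (h0.trans_lt h1) h2
  rw [h.2.2.2.2.2.2.2.2.1 i hi r a b]
  rw [mem_Icc] at hi
  have := h.ptn.idx (i := l) (j := i) hl (h1.trans_le b)
  exact h.anti (by omega) (by omega) hi.2
lemma sigbar_pos (h : EffParams M sigv lamv m sigb lamb sigbar) {r : ℝ} (h0 : 0 < r) (h1 : r ≤ 1) : 0 < sigbar r := by
  obtain ⟨i, hi, a, b⟩ := st_ex h.ptn h0 h1
  rw [h.2.2.2.2.2.2.2.2.1 i hi r a b]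
  rw [mem_Icc] at hi
  exact h.pos hi.1 hi.2
noncomputable def Tmax (M : ℕ) (sigv : ℕ → ℝ) : ℝ := ∑ i ∈ Icc 1 M, sigv i
lemma stepFn_pos (h : ScaleParams M sigv lamv) {r : ℝ} (h0 : 0 < r) (h1 : r ≤ 1) : 0 < stepFn M sigv lamv r ∧ stepFn M sigv lamv r ≤ Tmax M sigv := by
  obtain ⟨i, hi, a, b⟩ := st_ex h.ptn h0 h1
  rw [stepFn_st h0.ne', st_eq h.ptn _ hi a b]
  exact ⟨h.2.1 i hi, single_le_sum (fun k hk => (h.2.1 k hk).le) hi⟩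
structure Fine (n : ℕ) (s : ℕ → ℝ) (M : ℕ) (lamv : ℕ → ℝ) (m : ℕ) (lamb : ℕ → ℝ) : Prop where
  ptn : Ptn n s
  v : ∀ i ≤ M, ∃ k ≤ n, s k = lamv i
  b : ∀ i ≤ m, ∃ k ≤ n, s k = lamb i
lemma exists_fine (hp : ScaleParams M sigv lamv) (he : EffParams M sigv lamv m sigb lamb sigbar) (S : Finset ℝ) (hS : ∀ x ∈ S, x ∈ Set.Icc (0:ℝ) 1)
    {κ : ℝ} (hκ : 0 < κ) : ∃ n s, Fine n s M lamv m lamb ∧ (∀ j < n, s (j + 1) - s j ≤ κ) ∧ ∀ p ∈ S, ∃ k ≤ n, s k = p := by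
  obtain ⟨n, s, h1, h2, h3⟩ := exists_ptn (S ∪ (range (M + 1)).image lamv ∪ (range (m + 1)).image lamb) (by
    intro x hx
    rw [mem_union, mem_union, mem_image, mem_image] at hx
    rcases hx with (hx | ⟨i, hi, rfl⟩) | ⟨i, hi, rfl⟩
    · exact hS x hx
    · rw [mem_range] at hi; exact ⟨hp.ptn.nonneg (by omega), hp.ptn.le_one (by omega)⟩
    · rw [mem_range] at hi; exact ⟨he.ptn.nonneg (by omega), he.ptn.le_one (by omega)⟩) hκ
  refine ⟨n, s, ⟨h1, fun i hi => h3 _ ?_, fun i hi => h3 _ ?_⟩, h2, fun p hp => h3 p ?_⟩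
  · rw [mem_union, mem_union]; left; right; exact Finset.mem_image_of_mem _ (mem_range.2 (by omega))
  · rw [mem_union]; right; exact Finset.mem_image_of_mem _ (mem_range.2 (by omega))
  · rw [mem_union, mem_union]; left; left; exact hp
variable {n : ℕ} {s : ℕ → ℝ}
lemma Fine.step (hf : Fine n s M lamv m lamb) : Adp n s (stepFn M sigv lamv) := by
  intro j hj r h1 h2
  have h0 := hf.ptn.nonneg (show j ≤ n by omega)
  rw [stepFn_st (by linarith), stepFn_st (by linarith)]
  exact st_adp hf.ptn hf.v _ j hj r h1 h2
lemma Fine.bar (he : EffParams M sigv lamv m sigb lamb sigbar) (hf : Fine n s M lamv m lamb) : Adp n s sigbar := by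
  intro j hj r h1 h2
  have h0 := hf.ptn.nonneg (show j ≤ n by omega)
  have h3 := hf.ptn.le_one (show j + 1 ≤ n by omega)
  rw [sigbar_st he (by linarith) (by linarith), sigbar_st he (by linarith) (by linarith)]
  exact st_adp hf.ptn hf.b _ j hj r h1 h2
lemma Adp.comp {f : ℝ → ℝ} (h : Adp n s f) (g : ℝ → ℝ) : Adp n s (fun r => g (f r)) := fun j hj r h1 h2 => by
  simp only [h j hj r h1 h2]
lemma Adp.mul {f g : ℝ → ℝ} (h : Adp n s f) (h' : Adp n s g) : Adp n s (fun r => f r * g r) := fun j hj r h1 h2 => by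
  simp only [h j hj r h1 h2, h' j hj r h1 h2]
lemma Fine.J (hf : Fine n s M lamv m lamb) {k : ℕ} (hk : k ≤ n) : Jsig2 M sigv lamv (s k) = ∑ j ∈ range k, stepFn M sigv lamv (s (j + 1)) ^ 2 * (s (j + 1) - s j) := by
  unfold Jsig2 Jint
  have := (adp_int ((hf.step (sigv := sigv)).comp (· ^ 2)) hf.ptn (Nat.zero_le k) hk).2
  rw [hf.ptn.zero] at this
  rw [this, range_eq_Ico]
lemma Fine.B (he : EffParams M sigv lamv m sigb lamb sigbar) (hf : Fine n s M lamv m lamb) {k : ℕ} (hk : k ≤ n) (hk0 : k ≠ 0) :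
    concaveHull (Jsig2 M sigv lamv) (s k) = ∑ j ∈ range k, sigbar (s (j + 1)) ^ 2 * (s (j + 1) - s j) := by
  have h0 : 0 < s k := by rw [← hf.ptn.zero]; exact hf.ptn.smono (by omega) hk
  rw [he.2.2.2.2.2.2.2.2.2 (s k) h0 (hf.ptn.le_one hk)]
  have := (adp_int ((hf.bar he).comp (· ^ 2)) hf.ptn (Nat.zero_le k) hk).2
  rw [hf.ptn.zero] at this
  rw [this, range_eq_Ico]
lemma J_lip (hp : ScaleParams M sigv lamv) (he : EffParams M sigv lamv m sigb lamb sigbar) {t p : ℝ} (ht : t ∈ Set.Icc (0:ℝ) 1) (hpp : p ∈ Set.Icc (0:ℝ) 1) :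
    Jsig2 M sigv lamv t ≤ Jsig2 M sigv lamv p + Tmax M sigv ^ 2 * |t - p| := by
  obtain ⟨n, s, hf, -, hS⟩ := exists_fine hp he {t, p} (by intro x hx; simp at hx; rcases hx with rfl | rfl <;> assumption) one_pos
  obtain ⟨i, hi, rfl⟩ := hS t (by simp)
  obtain ⟨k, hk, rfl⟩ := hS p (by simp)
  have hA := (hf.step (sigv := sigv)).comp (· ^ 2)
  have i1 := (adp_int hA hf.ptn (Nat.zero_le i) hi).1
  have i2 := (adp_int hA hf.ptn (Nat.zero_le k) hk).1
  rw [hf.ptn.zero] at i1 i2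
  have e := intervalIntegral.integral_interval_sub_left i1 i2
  have b := intervalIntegral.norm_integral_le_of_norm_le_const (a := s k) (b := s i) (C := Tmax M sigv ^ 2) (f := fun r => stepFn M sigv lamv r ^ 2) (by
    intro x hx
    rw [Set.mem_uIoc] at hx
    obtain ⟨q1, q2⟩ := stepFn_pos hp (r := x) (by rcases hx with hx | hx <;> [linarith [hpp.1]; linarith [ht.1]]) (by rcases hx with hx | hx <;> [linarith [ht.2]; linarith [hpp.2]])
    rw [Real.norm_of_nonneg (sq_nonneg _)]
    gcongr)
  rw [← e, norm_eq_abs] at b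
  have := le_abs_self ((∫ x in (0:ℝ)..(s i), stepFn M sigv lamv x ^ 2) - ∫ x in (0:ℝ)..(s k), stepFn M sigv lamv x ^ 2)
  unfold Jsig2 Jint
  linarith
lemma J_zero : Jsig2 M sigv lamv 0 = 0 := by unfold Jsig2 Jint; simp
lemma J_bdd (hp : ScaleParams M sigv lamv) (he : EffParams M sigv lamv m sigb lamb sigbar) {t : ℝ} (ht : t ∈ Set.Icc (0:ℝ) 1) :
    Jsig2 M sigv lamv t ≤ Tmax M sigv ^ 2 := by
  have := J_lip hp he ht (p := 0) (by simp)
  rw [J_zero, sub_zero, abs_of_nonneg ht.1] at this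
  nlinarith [ht.2, sq_nonneg (Tmax M sigv)]
lemma J_touch (hp : ScaleParams M sigv lamv) (he : EffParams M sigv lamv m sigb lamb sigbar) {l : ℕ} (h1 : 1 ≤ l) (hl : l ≤ m) :
    concaveHull (Jsig2 M sigv lamv) (lamb l) = Jsig2 M sigv lamv (lamb l) := by
  have hlp : 0 < lamb l := by rw [← he.ptn.zero]; exact he.ptn.smono (by omega) hl
  have hl1 := he.ptn.le_one hl
  have hpp : lamb l ∈ Set.Icc (0:ℝ) 1 := ⟨hlp.le, hl1⟩
  have a0 := he.pos h1 hl
  have left : ∀ t, 0 < t → t ≤ lamb l → concaveHull (Jsig2 M sigv lamv) t ≤ concaveHull (Jsig2 M sigv lamv) (lamb l) + sigb l ^ 2 * (t - lamb l) := by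
    intro t h0 htl
    obtain ⟨n, s, hf, -, hS⟩ := exists_fine hp he {t} (by intro x hx; simp at hx; subst hx; exact ⟨h0.le, htl.trans hl1⟩) one_pos
    obtain ⟨i, hi, rfl⟩ := hS t (by simp)
    obtain ⟨k, hk, ek⟩ := hf.b l hl
    rw [← ek] at htl hlp ⊢
    have ne : ∀ q, 0 < s q → q ≠ 0 := fun q hq e => by rw [e, hf.ptn.zero] at hq; exact lt_irrefl _ hq
    rw [hf.B he hi (ne i h0), hf.B he hk (ne k hlp)]
    have hik : i ≤ k := by
      by_contra hc
      linarith [hf.ptn.smono (not_le.1 hc) hi]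
    rw [← sum_range_add_sum_Ico _ hik]
    have : ∑ j ∈ Ico i k, sigb l ^ 2 * (s (j + 1) - s j) ≤ ∑ j ∈ Ico i k, sigbar (s (j + 1)) ^ 2 * (s (j + 1) - s j) := by
      refine sum_le_sum fun j hj => ?_
      rw [mem_Ico] at hj
      refine mul_le_mul_of_nonneg_right ?_ (sub_nonneg.2 (hf.ptn.lt j (by omega)).le)
      refine pow_le_pow_left₀ a0.le (sigbar_ge he hl ?_ ?_) 2
      · exact h0.trans_le (hf.ptn.mono (by omega) (by omega))
      · rw [← ek]; exact hf.ptn.mono (by omega) hk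
    rw [← mul_sum, sum_Ico_sub _ hik] at this
    linarith
  have left0 : ∀ t ∈ Set.Icc (0:ℝ) 1, t ≤ lamb l → concaveHull (Jsig2 M sigv lamv) t ≤ concaveHull (Jsig2 M sigv lamv) (lamb l) + sigb l ^ 2 * (t - lamb l) := by
    intro t ht htl
    rcases ht.1.eq_or_lt with e | e
    · subst e
      have hcv := hull_concave (J := Jsig2 M sigv lamv) (K := Tmax M sigv ^ 2) (fun t ht => J_bdd hp he ht)
      have c := hcv.2 (show (0:ℝ) ∈ Set.Icc (0:ℝ) 1 by simp) hpp (show (0:ℝ) ≤ 1 / 2 by norm_num) (show (0:ℝ) ≤ 1 / 2 by norm_num) (by norm_num)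
      simp only [smul_eq_mul, mul_zero, zero_add] at c
      have := left (1 / 2 * lamb l) (by linarith) (by linarith)
      linarith
    · exact left t e htl
  rcases hl.eq_or_lt with e | hlt
  · subst e
    refine touch (b := 0) (fun t ht => J_bdd hp he ht) hpp (sq_nonneg _) (fun t ht => J_lip hp he ht hpp) (pow_pos a0 2) left0 ?_
    intro t ht h
    rw [he.ptn.one] at *
    have : t = 1 := le_antisymm ht.2 h
    rw [this]; simp
  · have b0 := he.pos (show 1 ≤ l + 1 by omega) hlt
    have hlt' := he.2.2.2.2.2.1 l h1 hlt
    refine touch (b := sigb (l + 1) ^ 2) (fun t ht => J_bdd hp he ht) hpp (sq_nonneg _) (fun t ht => J_lip hp he ht hpp) (by gcongr) left0 ?_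
    intro t ht htl
    obtain ⟨n, s, hf, -, hS⟩ := exists_fine hp he {t} (by intro x hx; simp at hx; subst hx; exact ht) one_pos
    obtain ⟨i, hi, rfl⟩ := hS t (by simp)
    obtain ⟨k, hk, ek⟩ := hf.b l hl
    rw [← ek] at htl hlp ⊢
    have ne : ∀ q, 0 < s q → q ≠ 0 := fun q hq e => by rw [e, hf.ptn.zero] at hq; exact lt_irrefl _ hq
    rw [hf.B he hi (ne i (by linarith)), hf.B he hk (ne k hlp)]
    have hik : k ≤ i := by
      by_contra hc
      linarith [hf.ptn.smono (not_le.1 hc) hk]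
    rw [← sum_range_add_sum_Ico _ hik]
    have : ∑ j ∈ Ico k i, sigbar (s (j + 1)) ^ 2 * (s (j + 1) - s j) ≤ ∑ j ∈ Ico k i, sigb (l + 1) ^ 2 * (s (j + 1) - s j) := by
      refine sum_le_sum fun j hj => ?_
      rw [mem_Ico] at hj
      refine mul_le_mul_of_nonneg_right ?_ (sub_nonneg.2 (hf.ptn.lt j (by omega)).le)
      have q1 : lamb l < s (j + 1) := by rw [← ek]; exact hf.ptn.smono (by omega) (by omega)
      have q2 : s (j + 1) ≤ 1 := hf.ptn.le_one (by omega)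
      exact pow_le_pow_left₀ (sigbar_pos he (by linarith) q2).le (sigbar_le he hl q1 q2) 2
    rw [← mul_sum, sum_Ico_sub _ hik] at this
    linarith
lemma fine_sys (hp : ScaleParams M sigv lamv) (he : EffParams M sigv lamv m sigb lamb sigbar) (hf : Fine n s M lamv m lamb) :
    Sys n s (fun j => stepFn M sigv lamv (s (j + 1))) (fun j => sigbar (s (j + 1))) := by
  have hP := hf.ptn
  have p0 : ∀ j < n, 0 < s (j + 1) := fun j hj => by rw [← hP.zero]; exact hP.smono (by omega) (by omega)
  have p1 : ∀ j < n, s (j + 1) ≤ 1 := fun j hj => hP.le_one (by omega)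
  have eqat : ∀ l, 1 ≤ l → l ≤ m → ∀ k ≤ n, s k = lamb l → ∑ j ∈ range k, stepFn M sigv lamv (s (j + 1)) ^ 2 * (s (j + 1) - s j) =
      ∑ j ∈ range k, sigbar (s (j + 1)) ^ 2 * (s (j + 1) - s j) := by
    intro l h1 h2 k hk e
    have hk0 : k ≠ 0 := fun e0 => by
      rw [e0, hP.zero, ← he.ptn.zero] at e
      linarith [he.ptn.smono (show 0 < l by omega) h2]
    rw [← hf.J hk, ← hf.B he hk hk0, e, J_touch hp he h1 h2]
  refine ⟨hP, fun j hj => (stepFn_pos hp (p0 j hj) (p1 j hj)).1, fun j hj => sigbar_pos he (p0 j hj) (p1 j hj), ?_, ?_, ?_, ?_⟩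
  · intro j hj
    obtain ⟨i, hi, a, b⟩ := st_ex he.ptn (p0 j (by omega)) (p1 j (by omega))
    rw [he.2.2.2.2.2.2.2.2.1 i hi _ a b]
    rw [mem_Icc] at hi
    have := sigbar_le he (l := i - 1) (by omega) (r := s (j + 1 + 1)) (a.trans (hP.lt _ hj)) (p1 _ hj)
    rwa [Nat.sub_add_cancel hi.1] at this
  · intro k hk
    rcases k with _ | k
    · simp
    · rw [← hf.J hk, ← hf.B he hk (by omega)]
      exact le_hull (fun t ht => J_bdd hp he ht) fun g _ h => h _ ⟨hP.nonneg hk, hP.le_one hk⟩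
  · exact eqat m he.1 le_rfl n le_rfl (by rw [hP.one, he.ptn.one])
  · intro k hk
    obtain ⟨i, hi, a, b⟩ := st_ex he.ptn (p0 k (by omega)) (p1 k (by omega))
    have hi' := mem_Icc.1 hi
    rcases b.eq_or_lt with e | hlt
    · exact Or.inr (eqat i hi'.1 hi'.2 (k + 1) hk.le e)
    · left
      obtain ⟨q, hq, eq⟩ := hf.b i hi'.2
      rw [← eq] at hlt
      have := hP.idx (by omega) hlt
      have h2 : s (k + 1 + 1) ≤ lamb i := by rw [← eq]; exact hP.mono (by omega) hq
      rw [he.2.2.2.2.2.2.2.2.1 i hi _ a b, he.2.2.2.2.2.2.2.2.1 i hi _ (a.trans (hP.lt _ hk)) h2]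
lemma fine_F (he : EffParams M sigv lamv m sigb lamb sigbar) (hf : Fine n s M lamv m lamb) (β : ℝ) :
    Fv n s (fun j => sigbar (s (j + 1))) β = ∑ j ∈ Icc 1 m, fREM (sigb j) β * (lamb j - lamb (j - 1)) := by
  have := step_sum hf.ptn he.ptn hf.b (fun i => fREM (sigb i) β) (fun x => x)
  rw [this, Fv]
  refine sum_congr rfl fun j hj => ?_
  rw [mem_range] at hj
  obtain ⟨i, hi, a, b⟩ := st_ex he.ptn (r := s (j + 1)) (by rw [← hf.ptn.zero]; exact hf.ptn.smono (by omega) (by omega)) (hf.ptn.le_one (by omega))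
  rw [st_eq he.ptn _ hi a b, he.2.2.2.2.2.2.2.2.1 i hi _ a b]
lemma fine_psi (hp : ScaleParams M sigv lamv) (hf : Fine n s M lamv m lamb) {N : ℕ} {G : Vtx → Vtx → ℝ} {P : Measure FieldSp} (h : GF N G P) {v : Vtx} (hv : v ∈ VN N) :
    psiFld N M sigv lamv P v =ᵐ[P] fun ω => ∑ j ∈ range n, stepFn M sigv lamv (s (j + 1)) * lin N (inc N s v j) ω := by
  have hall : ∀ᵐ ω ∂P, ∀ i ∈ range (M + 1), phiScale N P v (lamv i) ω = lin N (hS N (lamv i) v) ω :=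
    (Finset.eventually_all _).2 fun i _ => h.phi_eq hv (lamv i)
  filter_upwards [hall] with ω hω
  unfold psiFld
  have e1 : ∑ i ∈ Icc 1 M, sigv i * (phiScale N P v (lamv i) ω - phiScale N P v (lamv (i - 1)) ω) =
      ∑ i ∈ Icc 1 M, sigv i * ((fun x => lin N (hS N x v) ω) (lamv i) - (fun x => lin N (hS N x v) ω) (lamv (i - 1))) := by
    refine sum_congr rfl fun i hi => ?_
    rw [mem_Icc] at hi
    rw [hω i (mem_range.2 (by omega)), hω (i - 1) (mem_range.2 (by omega))]
  refine e1.trans ((step_sum hf.ptn hp.ptn hf.v sigv (fun x => lin N (hS N x v) ω)).trans ?_)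
  refine sum_congr rfl fun j hj => ?_
  rw [mem_range] at hj
  have h0 : 0 < s (j + 1) := by rw [← hf.ptn.zero]; exact hf.ptn.smono (by omega) (by omega)
  rw [stepFn_st h0.ne']
  unfold inc
  rw [lin_sub]
end eff
section ent
open Finset
lemma ent_max {m : ℕ} (hm : 1 ≤ m) {a d : ℕ → ℝ} {β : ℝ} (hβ : 0 < β) (ha : ∀ j < m, 0 < a j) (hd : ∀ j < m, 0 < d j)
    (hanti : ∀ i j, i < j → j < m → a j < a i) (hsum : ∑ j ∈ range m, d j = 1) {A R D g : ℕ → ℝ} {E : ℝ → ℝ}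
    (hA : ∀ k, A k = ∑ j ∈ range k, a j * d j) (hR : ∀ q < m, R q = ∑ j ∈ Ico q m, a j ^ 2 * d j)
    (hD : ∀ q < m, D q = ∑ j ∈ Ico q m, d j) (hg0 : g 0 = 0) (hg : ∀ q < m, g (q + 1) = A q + R q / a q)
    (hE0 : E 0 = 1) (hE : ∀ q < m, ∀ γ, g q < γ → γ ≤ g (q + 1) → E γ = D q - (γ - A q) ^ 2 / R q) :
    IsGreatest ((fun γ => β * γ + E γ) '' Set.Icc 0 (A m)) (∑ j ∈ range m, fREM (a j) β * d j) := by
  have hRpos : ∀ q < m, 0 < R q := fun q hq => by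
    rw [hR q hq]
    refine sum_pos (fun j hj => ?_) ⟨q, by simp [hq]⟩
    rw [mem_Ico] at hj
    exact mul_pos (pow_pos (ha j hj.2) 2) (hd j hj.2)
  have hRs : ∀ p, p + 1 < m → R p = a p ^ 2 * d p + R (p + 1) := fun p hp => by
    rw [hR p (by omega), hR _ hp, sum_eq_sum_Ico_succ_bot (by omega)]
  have hAs : ∀ p, A (p + 1) = A p + a p * d p := fun p => by rw [hA, hA, sum_range_succ]
  have hA0 : ∀ q ≤ m, 0 ≤ A q := fun q hq => by
    rw [hA]
    refine sum_nonneg fun j hj => ?_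
    rw [mem_range] at hj
    exact (mul_pos (ha j (by omega)) (hd j (by omega))).le
  have hgs : ∀ p, p + 1 < m → g (p + 1) = A (p + 1) + R (p + 1) / a p := fun p hp => by
    have := ha p (by omega)
    rw [hg p (by omega), hRs p hp, hAs]; field_simp; ring
  have hsplit : ∀ q < m, ∑ j ∈ range m, fREM (a j) β * d j = ∑ j ∈ range q, fREM (a j) β * d j + ∑ j ∈ Ico q m, fREM (a j) β * d j := fun q hq =>
    (sum_range_add_sum_Ico _ hq.le).symm
  have hlow : ∀ q < m, β * A q ≤ ∑ j ∈ range q, fREM (a j) β * d j := fun q hq => by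
    rw [hA, mul_sum]
    refine sum_le_sum fun j hj => ?_
    rw [mem_range] at hj
    have h1 := hd j (by omega)
    rw [← mul_assoc]
    refine mul_le_mul_of_nonneg_right ?_ h1.le
    rcases th_cases hβ (ha j (by omega)) with h | h
    · rw [h.2.2]; nlinarith [sq_nonneg (β * a j / 2 - 1)]
    · rw [h.2.2]
  have hgm : g m = A m := by
    obtain ⟨q, rfl⟩ : ∃ q, m = q + 1 := ⟨m - 1, by omega⟩
    have := ha q (by omega)
    rw [hg q (by omega), hR q (by omega), hAs, Nat.Ico_succ_singleton, sum_singleton]; field_simp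
  constructor
  · by_cases hex : ∃ q, q < m ∧ β * a q ≤ 2
    · obtain ⟨hq, hb⟩ := Nat.find_spec hex
      have hmin : ∀ j < Nat.find hex, 2 < β * a j := fun j hj => by
        have := Nat.find_min hex hj
        push Not at this
        exact this (by omega)
      set q := Nat.find hex
      clear_value q
      have hbj : ∀ j ∈ Ico q m, β * a j ≤ 2 := fun j hj => by
        rw [mem_Ico] at hj
        rcases hj.1.eq_or_lt with e | e
        · rw [← e]; exact hb
        · exact (mul_le_mul_of_nonneg_left (hanti q j e hj.2).le hβ.le).trans hb
      have hR0 := hRpos q hq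
      have haq := ha q hq
      have hAm : A m = A q + ∑ j ∈ Ico q m, a j * d j := by
        rw [hA, hA, sum_range_add_sum_Ico _ hq.le]
      refine ⟨A q + β * R q / 2, ⟨by have := hA0 q hq.le; positivity, ?_⟩, ?_⟩
      · have : β * R q / 2 ≤ ∑ j ∈ Ico q m, a j * d j := by
          rw [hR q hq, mul_sum, sum_div]
          refine sum_le_sum fun j hj => ?_
          have h1 := hbj j hj
          rw [mem_Ico] at hj
          have := mul_pos (ha j hj.2) (hd j hj.2)
          nlinarith
        linarith
      · have h2 : g q < A q + β * R q / 2 := by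
          rcases Nat.eq_zero_or_pos q with e | e
          · have hgq : g q = 0 := by rw [e]; exact hg0
            rw [hgq]; have := hA0 q hq.le; positivity
          · obtain ⟨p, rfl⟩ : ∃ p, q = p + 1 := ⟨q - 1, by omega⟩
            have h3 := hmin p (by omega)
            have h4 := ha p (by omega)
            rw [hgs p hq]
            have : R (p + 1) / a p < β * R (p + 1) / 2 := by
              rw [div_lt_div_iff₀ h4 two_pos]; nlinarith
            linarith
        have h3 : A q + β * R q / 2 ≤ g (q + 1) := by
          rw [hg q hq]
          have : β * R q / 2 ≤ R q / a q := by
            rw [div_le_div_iff₀ two_pos haq]; nlinarith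
          linarith
        show β * (A q + β * R q / 2) + E _ = _
        rw [hE q hq _ h2 h3, hsplit q hq]
        have e1 : ∑ j ∈ range q, fREM (a j) β * d j = β * A q := by
          rw [hA, mul_sum]
          refine sum_congr rfl fun j hj => ?_
          rw [mem_range] at hj
          rcases th_cases hβ (ha j (by omega)) with h | h
          · have := hmin j hj; linarith
          · rw [h.2.2]; ring
        have e2 : ∑ j ∈ Ico q m, fREM (a j) β * d j = D q + β ^ 2 / 4 * R q := by
          rw [hD q hq, hR q hq, mul_sum, ← sum_add_distrib]
          refine sum_congr rfl fun j hj => ?_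
          have h5 := hbj j hj
          rw [mem_Ico] at hj
          rcases th_cases hβ (ha j hj.2) with h | h
          · rw [h.2.2]; ring
          · linarith
        rw [e1, e2]; field_simp; ring
    · push Not at hex
      obtain ⟨q, rfl⟩ : ∃ q, m = q + 1 := ⟨m - 1, by omega⟩
      have haq := ha q (by omega)
      have hdq := hd q (by omega)
      have hRq : R q = a q ^ 2 * d q := by
        rw [hR q (by omega), Nat.Ico_succ_singleton, sum_singleton]
      have hDq : D q = d q := by
        rw [hD q (by omega), Nat.Ico_succ_singleton, sum_singleton]
      refine ⟨A (q + 1), ⟨hA0 _ le_rfl, le_rfl⟩, ?_⟩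
      show β * A (q + 1) + E _ = _
      have h2 : g q < A (q + 1) := by
        have h6 := mul_pos haq hdq
        rcases Nat.eq_zero_or_pos q with e | e
        · have := hA0 q (by omega)
          have hgq : g q = 0 := by rw [e]; exact hg0
          rw [hAs, hgq]; linarith
        · obtain ⟨p, rfl⟩ : ∃ p, q = p + 1 := ⟨q - 1, by omega⟩
          have h4 := ha p (by omega)
          have h5 := hanti p (p + 1) (by omega) (by omega)
          rw [hgs p (by omega), hAs (p + 1), hRq]
          have : a (p + 1) ^ 2 * d (p + 1) / a p < a (p + 1) * d (p + 1) := by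
            rw [div_lt_iff₀ h4]; nlinarith
          linarith
      rw [hE q (by omega) _ h2 hgm.ge, hDq, hRq, hAs]
      have e1 : ∑ j ∈ range (q + 1), fREM (a j) β * d j = β * A (q + 1) := by
        rw [hA, mul_sum]
        refine sum_congr rfl fun j hj => ?_
        rw [mem_range] at hj
        rcases th_cases hβ (ha j (by omega)) with h | h
        · have := hex j hj; linarith
        · rw [h.2.2]; ring
      rw [e1, hAs]; field_simp; ring
  · rintro _ ⟨γ, ⟨h0, h1⟩, rfl⟩
    show β * γ + E γ ≤ _
    rcases h0.eq_or_lt with e | hpos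
    · rw [← e, hE0, mul_zero, zero_add, ← hsum]
      refine sum_le_sum fun j hj => ?_
      rw [mem_range] at hj
      have := hd j hj
      refine le_mul_of_one_le_left this.le ?_
      rcases th_cases hβ (ha j hj) with h | h
      · rw [h.2.2]; nlinarith [sq_nonneg (β * a j / 2)]
      · rw [h.2.2]; linarith
    · have hex : ∃ q, γ ≤ g q := ⟨m, hgm ▸ h1⟩
      have hsp := Nat.find_spec hex
      have hle : Nat.find hex ≤ m := Nat.find_min' hex (hgm ▸ h1)
      have hmin := fun j (hj : j < Nat.find hex) => Nat.find_min hex hj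
      set k := Nat.find hex
      clear_value k
      rcases Nat.eq_zero_or_pos k with e | e
      · rw [e, hg0] at hsp; linarith
      obtain ⟨q, rfl⟩ : ∃ p, k = p + 1 := ⟨k - 1, by omega⟩
      have hq : q < m := by omega
      have haq := ha q hq
      have hR0 := hRpos q hq
      rw [hE q hq γ (not_le.1 (hmin q (by omega))) hsp, hsplit q hq]
      rw [hg q hq] at hsp
      have hx : γ - A q ≤ R q / a q := by linarith
      have hγ : γ = A q + (γ - A q) := by ring
      set x := γ - A q
      have key : ∀ y : ℝ, -(x ^ 2 / R q) ≤ -(2 * x * y) + R q * y ^ 2 := fun y => by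
        have : 0 ≤ (x - R q * y) ^ 2 / R q := by positivity
        have e : (x - R q * y) ^ 2 / R q = x ^ 2 / R q - 2 * x * y + R q * y ^ 2 := by field_simp; ring
        linarith
      have hl := hlow q hq
      have haj : ∀ j ∈ Ico q m, a j ≤ a q := fun j hj => by
        rw [mem_Ico] at hj
        rcases hj.1.eq_or_lt with e | e
        · rw [← e]
        · exact (hanti q j e hj.2).le
      by_cases hb : β * a q ≤ 2
      · have := key (β / 2)
        have e2 : D q + β ^ 2 / 4 * R q ≤ ∑ j ∈ Ico q m, fREM (a j) β * d j := by
          rw [hD q hq, hR q hq, mul_sum, ← sum_add_distrib]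
          refine sum_le_sum fun j hj => ?_
          have h5 := haj j hj
          rw [mem_Ico] at hj
          rcases th_cases hβ (ha j hj.2) with h | h
          · rw [h.2.2]; apply le_of_eq; ring
          · nlinarith
        rw [hγ]; nlinarith
      · push Not at hb
        have := key (1 / a q)
        have h7 : (β - 2 / a q) * x ≤ (β - 2 / a q) * (R q / a q) := by
          refine mul_le_mul_of_nonneg_left hx ?_
          rw [sub_nonneg, div_le_iff₀ haq]; exact hb.le
        have e2 : D q + (β / a q - 1 / a q ^ 2) * R q ≤ ∑ j ∈ Ico q m, fREM (a j) β * d j := by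
          rw [hD q hq, hR q hq, mul_sum, ← sum_add_distrib]
          refine sum_le_sum fun j hj => ?_
          have h5 := haj j hj
          rw [mem_Ico] at hj
          have h8 := hd j hj.2
          have h9 := ha j hj.2
          have e3 : d j + (β / a q - 1 / a q ^ 2) * (a j ^ 2 * d j) = (1 + β * a j * (a j / a q) - (a j / a q) ^ 2) * d j := by
            field_simp; ring
          rw [e3]
          refine mul_le_mul_of_nonneg_right ?_ h8.le
          have ht : a j / a q ≤ 1 := (div_le_one haq).2 h5
          have ht0 : 0 < a j / a q := div_pos h9 haq
          set t := a j / a q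
          rcases th_cases hβ h9 with h | h
          · rw [h.2.2]; nlinarith [sq_nonneg (β * a j / 2 - t)]
          · rw [h.2.2]; nlinarith
        have e4 : (β - 2 / a q) * (R q / a q) = (β / a q - 1 / a q ^ 2) * R q - R q * (1 / a q) ^ 2 := by field_simp; ring
        have e5 : (β - 2 / a q) * x = β * x - 2 * x * (1 / a q) := by ring
        rw [hγ]; nlinarith
end ent
section ent2
open MeasureTheory intervalIntegral
variable {M m : ℕ} {sigv lamv sigb lamb : ℕ → ℝ} {sigbar : ℝ → ℝ}
lemma sig2_int (hp : ScaleParams M sigv lamv) (he : EffParams M sigv lamv m sigb lamb sigbar) {x y : ℝ} (hx : x ∈ Set.Icc (0:ℝ) 1) (hy : y ∈ Set.Icc (0:ℝ) 1) :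
    IntervalIntegrable (fun r => stepFn M sigv lamv r ^ 2) volume x y := by
  obtain ⟨n, s, hf, -, -⟩ := exists_fine hp he ∅ (by simp) one_pos
  have := (adp_int (hf.step (sigv := sigv) |>.comp fun x => x ^ 2) hf.ptn (Nat.zero_le n) le_rfl).1
  rw [hf.ptn.zero, hf.ptn.one] at this
  exact this.mono_set (Set.uIcc_subset_uIcc (by rwa [Set.uIcc_of_le zero_le_one]) (by rwa [Set.uIcc_of_le zero_le_one]))
lemma sig2_piece (hp : ScaleParams M sigv lamv) (he : EffParams M sigv lamv m sigb lamb sigbar) {j : ℕ} (hj : j < m) :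
    ∫ r in lamb j..lamb (j + 1), stepFn M sigv lamv r ^ 2 = sigb (j + 1) ^ 2 * (lamb (j + 1) - lamb j) := by
  have z : (0:ℝ) ∈ Set.Icc (0:ℝ) 1 := by simp
  have mem : ∀ i ≤ m, lamb i ∈ Set.Icc (0:ℝ) 1 := fun i hi => ⟨he.ptn.nonneg hi, he.ptn.le_one hi⟩
  have e1 := J_touch hp he (l := j + 1) (by omega) (by omega)
  have p1 : 0 < lamb (j + 1) := by rw [← he.ptn.zero]; exact he.ptn.smono (by omega) (by omega)
  have e2 : Jsig2 M sigv lamv (lamb (j + 1)) - Jsig2 M sigv lamv (lamb j) = ∫ r in lamb j..lamb (j + 1), stepFn M sigv lamv r ^ 2 := by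
    unfold Jsig2 Jint
    exact integral_interval_sub_left (sig2_int hp he z (mem _ hj)) (sig2_int hp he z (mem _ hj.le))
  have e3 : Jsig2 M sigv lamv (lamb j) = ∫ r in (0:ℝ)..lamb j, sigbar r ^ 2 := by
    rcases Nat.eq_zero_or_pos j with e | e
    · rw [e, he.ptn.zero, J_zero]; simp
    · have p2 : 0 < lamb j := by rw [← he.ptn.zero]; exact he.ptn.smono (by omega) (by omega)
      rw [← J_touch hp he e hj.le]
      exact he.2.2.2.2.2.2.2.2.2 _ p2 (mem j hj.le).2
  have e4 := he.2.2.2.2.2.2.2.2.2 _ p1 (mem _ hj).2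
  obtain ⟨n, s, hf, -, -⟩ := exists_fine hp he ∅ (by simp) one_pos
  have hi : ∀ x ∈ Set.Icc (0:ℝ) 1, IntervalIntegrable (fun r => sigbar r ^ 2) volume 0 x := fun x hx => by
    have := (adp_int (hf.bar he |>.comp fun x => x ^ 2) hf.ptn (Nat.zero_le n) le_rfl).1
    rw [hf.ptn.zero, hf.ptn.one] at this
    exact this.mono_set (Set.uIcc_subset_uIcc (by simp) (by rwa [Set.uIcc_of_le zero_le_one]))
  rw [← e2, ← e1, e4, e3, integral_interval_sub_left (hi _ (mem _ hj)) (hi _ (mem _ hj.le))]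
  have hlt := he.ptn.lt j hj
  rw [integral_congr_ae (g := fun _ => sigb (j + 1) ^ 2) (Eventually.of_forall fun r hr => ?_), intervalIntegral.integral_const, smul_eq_mul, mul_comm]
  rw [Set.uIoc_of_le hlt.le] at hr
  rw [he.2.2.2.2.2.2.2.2.1 (j + 1) (mem_Icc.2 ⟨by omega, hj⟩) r hr.1 hr.2]
lemma eff_int (hp : ScaleParams M sigv lamv) (he : EffParams M sigv lamv m sigb lamb sigbar) {h : ℝ → ℝ} {c : ℕ → ℝ} {i k : ℕ} (hik : i ≤ k) (hk : k ≤ m)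
    (hh : ∀ j, i ≤ j → j < k → ∀ r, lamb j < r → r ≤ lamb (j + 1) → h r = c j * stepFn M sigv lamv r ^ 2) :
    ∫ r in lamb i..lamb k, h r = ∑ j ∈ Ico i k, c j * (sigb (j + 1) ^ 2 * (lamb (j + 1) - lamb j)) := by
  have mem : ∀ i ≤ m, lamb i ∈ Set.Icc (0:ℝ) 1 := fun i hi => ⟨he.ptn.nonneg hi, he.ptn.le_one hi⟩
  have hpc : ∀ j, i ≤ j → j < k → Set.EqOn (fun r => c j * stepFn M sigv lamv r ^ 2) h (Set.uIoc (lamb j) (lamb (j + 1))) := fun j h1 h2 r hr => by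
    rw [Set.uIoc_of_le (he.ptn.lt j (by omega)).le] at hr
    exact (hh j h1 h2 r hr.1 hr.2).symm
  rw [← sum_integral_adjacent_intervals_Ico hik]
  · refine sum_congr rfl fun j hj => ?_
    rw [mem_Ico] at hj
    rw [← sig2_piece hp he (by omega : j < m), ← intervalIntegral.integral_const_mul]
    exact (integral_congr_ae (Eventually.of_forall fun r hr => hpc j hj.1 hj.2 hr)).symm
  · intro j hj
    exact ((sig2_int hp he (mem j (by have := hj.2; omega)) (mem (j + 1) (by have := hj.2; omega))).const_mul (c j)).congr (hpc j hj.1 hj.2)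
lemma ent_sup (hp : ScaleParams M sigv lamv) (he : EffParams M sigv lamv m sigb lamb sigbar) {E : ℝ → ℝ} (hE : IsEntropy M sigv lamv m lamb sigbar E) {β : ℝ} (hβ : 0 < β) :
    sSup ((fun γ => β * γ + E γ) '' Set.Icc 0 (gammaStar M sigv lamv sigbar)) = ∑ j ∈ Icc 1 m, fREM (sigb j) β * (lamb j - lamb (j - 1)) := by
  have hbar : ∀ j < m, ∀ r, lamb j < r → r ≤ lamb (j + 1) → sigbar r = sigb (j + 1) := fun j hj r h1 h2 =>
    he.2.2.2.2.2.2.2.2.1 (j + 1) (mem_Icc.2 ⟨by omega, hj⟩) r h1 h2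
  have ha : ∀ j < m, 0 < sigb (j + 1) := fun j hj => he.pos (by omega) (by omega)
  have l0 := he.ptn.zero
  have l1 := he.ptn.one
  have hA : ∀ k ≤ m, ∫ s in (0:ℝ)..lamb k, stepFn M sigv lamv s ^ 2 / sigbar s = ∑ j ∈ range k, sigb (j + 1) * (lamb (j + 1) - lamb j) := by
    intro k hk
    have := eff_int hp he (h := fun s => stepFn M sigv lamv s ^ 2 / sigbar s) (c := fun j => (sigb (j + 1))⁻¹) (Nat.zero_le k) hk (fun j _ h2 r h3 h4 => by
      simp only [hbar j (by omega) r h3 h4]; ring)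
    rw [l0] at this
    rw [this, range_eq_Ico]
    refine sum_congr rfl fun j hj => ?_
    rw [mem_Ico] at hj
    have := ha j (by omega)
    field_simp
  have hR : ∀ q < m, Jint2 (fun r => (stepFn M sigv lamv r) ^ 2) (lamb q) 1 = ∑ j ∈ Ico q m, sigb (j + 1) ^ 2 * (lamb (j + 1) - lamb j) := by
    intro q hq
    have := eff_int hp he (h := fun s => stepFn M sigv lamv s ^ 2) (c := fun j => 1) hq.le le_rfl (fun j _ h2 r h3 h4 => by ring)
    rw [l1] at this
    unfold Jint2
    rw [this]
    simp
  have hg : ∀ q < m, gammaL M sigv lamv lamb sigbar (q + 1) = (∑ j ∈ range q, sigb (j + 1) * (lamb (j + 1) - lamb j)) + Jint2 (fun r => (stepFn M sigv lamv r) ^ 2) (lamb q) 1 / sigb (q + 1) := by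
    intro q hq
    unfold gammaL
    rw [if_neg (by omega)]
    have := eff_int hp he (h := fun s => stepFn M sigv lamv s ^ 2 / sigbar (min s (lamb (q + 1)))) (c := fun j => (sigb (min j q + 1))⁻¹) (Nat.zero_le m) le_rfl (fun j _ h2 r h3 h4 => by
      rcases le_or_gt j q with hjq | hjq
      · rw [min_eq_left hjq, min_eq_left (h4.trans (he.ptn.mono (by omega) (by omega))), hbar j (by omega) r h3 h4]; ring
      · rw [min_eq_right hjq.le, min_eq_right ((he.ptn.mono (by omega) (by omega)).trans h3.le), hbar q (by omega) _ (he.ptn.lt q hq) le_rfl]; ring)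
    rw [l0, l1] at this
    rw [this, hR q hq, ← range_eq_Ico, ← sum_range_add_sum_Ico _ hq.le, sum_div]
    congr 1
    · refine sum_congr rfl fun j hj => ?_
      rw [mem_range] at hj
      have := ha j (by omega)
      rw [min_eq_left hj.le]; field_simp
    · refine sum_congr rfl fun j hj => ?_
      rw [mem_Ico] at hj
      rw [min_eq_right hj.1]; ring
  have hD : ∀ q < m, 1 - lamb q = ∑ j ∈ Ico q m, (lamb (j + 1) - lamb j) := fun q hq => by
    rw [sum_Ico_sub _ hq.le, l1]
  have key := ent_max (m := m) he.1 (a := fun j => sigb (j + 1)) (d := fun j => lamb (j + 1) - lamb j) hβ ha (fun j hj => sub_pos.2 (he.ptn.lt j hj))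
    (fun i j hij hj => by
      have h1 : sigb (i + 1 + 1) < sigb (i + 1) := he.2.2.2.2.2.1 (i + 1) (by omega) (by omega)
      exact (he.anti (by omega) (by omega : i + 1 + 1 ≤ j + 1) (by omega)).trans_lt h1)
    (by rw [sum_range_sub, l0, l1, sub_zero]) (A := fun k => ∑ j ∈ range k, sigb (j + 1) * (lamb (j + 1) - lamb j))
    (R := fun q => Jint2 (fun r => (stepFn M sigv lamv r) ^ 2) (lamb q) 1) (D := fun q => 1 - lamb q) (g := gammaL M sigv lamv lamb sigbar) (E := E)
    (fun k => rfl) hR hD (by simp [gammaL]) hg hE.1 (fun q hq γ h1 h2 => by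
      have := hE.2 (q + 1) (mem_Icc.2 ⟨by omega, hq⟩) γ h1 h2
      rw [Nat.add_sub_cancel, hA q hq.le] at this
      exact this)
  have hs := hA m le_rfl
  rw [l1] at hs
  unfold gammaStar
  rw [hs, key.csSup_eq, Finset.sum_bij (fun j _ => j + 1)]
  · intro j hj; rw [mem_range] at hj; rw [mem_Icc]; omega
  · intro i _ j _ h; omega
  · intro j hj; rw [mem_Icc] at hj; exact ⟨j - 1, mem_range.2 (by omega), by omega⟩
  · intro j _; rw [Nat.add_sub_cancel]
end ent2
section lpconv
open MeasureTheory
lemma rpow_le_exp {q : ℝ} (hq : 0 ≤ q) : ∃ C : ℝ, 0 < C ∧ ∀ x : ℝ, 0 ≤ x → x ^ q ≤ C * exp x := by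
  obtain ⟨n, hn⟩ := exists_nat_ge q
  refine ⟨1 + n.factorial, by positivity, fun x hx => ?_⟩
  have h1 := Real.pow_div_factorial_le_exp x hx n
  rw [div_le_iff₀ (by positivity)] at h1
  have h2 := Real.one_le_exp hx
  have h3 : (0:ℝ) < n.factorial := by positivity
  rcases le_total x 1 with h | h
  · have := Real.rpow_le_one hx h hq
    nlinarith
  · have := rpow_le_rpow_of_exponent_le h hn
    rw [Real.rpow_natCast] at this
    nlinarith
lemma lp_of {Ω : Type*} [MeasurableSpace Ω] (P : ℕ → Measure Ω) (hP : ∀ N, IsProbabilityMeasure (P N)) (X : ℕ → Ω → ℝ)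
    (hX : ∀ ε : ℝ, 0 < ε → Tendsto (fun N => P N {ω | ε < |X N ω|}) atTop (nhds 0)) {K : ℝ} (hK : 0 ≤ K)
    (hW : ∀ᶠ N in atTop, AEMeasurable (X N) (P N) ∧ ∃ W : Ω → ℝ, Integrable W (P N) ∧ ∫ ω, W ω ∂(P N) ≤ K ∧ ∀ᵐ ω ∂(P N), 0 ≤ W ω ∧ |X N ω| ≤ K + log (1 + W ω))
    {p : ℝ} (hp : 1 ≤ p) : Tendsto (fun N => ∫ ω, |X N ω| ^ p ∂(P N)) atTop (nhds 0) := by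
  obtain ⟨C, hC, hCx⟩ := rpow_le_exp (q := 2 * p) (by linarith)
  have hp0 : 0 < p := by linarith
  rw [tendsto_order]
  refine ⟨fun b hb => Eventually.of_forall fun N => hb.trans_le (integral_nonneg fun ω => by positivity), fun η hη => ?_⟩
  set D := C * exp K with hD
  have hD0 : 0 < D := by positivity
  set κ := η / (4 * (D * (1 + K))) with hκ
  have hκ0 : 0 < κ := by positivity
  set ε := (η / 4) ^ (1 / p) with hε
  have hε0 : 0 < ε := by positivity
  have hεp : ε ^ p = η / 4 := by rw [hε, ← Real.rpow_mul (by positivity), one_div_mul_cancel hp0.ne', Real.rpow_one]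
  have h1 := (hX ε hε0).eventually (gt_mem_nhds (show (0 : ENNReal) < ENNReal.ofReal (η * κ) by rw [ENNReal.ofReal_pos]; positivity))
  filter_upwards [h1, hW] with N hN ⟨hm, W, hWi, hWK, hWb⟩
  have := hP N
  have hset : NullMeasurableSet {ω | ε < |X N ω|} (P N) :=
    nullMeasurableSet_lt aemeasurable_const (continuous_abs.measurable.comp_aemeasurable hm)
  have hreal : (P N).real {ω | ε < |X N ω|} ≤ η * κ := by
    rw [Measure.real]
    exact ENNReal.toReal_le_of_le_ofReal (by positivity) hN.le
  have hind : Integrable ({ω | ε < |X N ω|}.indicator fun _ => 1 / (4 * κ)) (P N) := (integrable_const _).indicator₀ hset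
  have hint2 : Integrable (fun ω => κ * (D * (1 + W ω))) (P N) := (((integrable_const _).add hWi).const_mul _).const_mul _
  have hint1 : Integrable (fun ω => ε ^ p + κ * (D * (1 + W ω))) (P N) := (integrable_const _).add hint2
  have hle : ∫ ω, |X N ω| ^ p ∂(P N) ≤ ∫ ω, ((ε ^ p + κ * (D * (1 + W ω))) + {ω | ε < |X N ω|}.indicator (fun _ => 1 / (4 * κ)) ω) ∂(P N) := by
    refine integral_mono_of_nonneg (ae_of_all _ fun ω => by positivity) (hint1.add hind) ?_
    filter_upwards [hWb] with ω ⟨hw0, hw⟩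
    have hx : |X N ω| ^ (2 * p) ≤ D * (1 + W ω) := by
      refine (hCx _ (abs_nonneg _)).trans ?_
      rw [hD, mul_assoc]
      refine mul_le_mul_of_nonneg_left ?_ hC.le
      refine (exp_le_exp.2 hw).trans ?_
      rw [exp_add, exp_log (by linarith)]
    by_cases hc : ε < |X N ω|
    · rw [Set.indicator_of_mem (by exact hc)]
      have e : |X N ω| ^ (2 * p) = (|X N ω| ^ p) ^ 2 := by
        rw [mul_comm, Real.rpow_mul (abs_nonneg _)]; norm_cast
      rw [e] at hx
      set y := |X N ω| ^ p
      have h2 : y ≤ κ * y ^ 2 + 1 / (4 * κ) := by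
        have : 0 ≤ (2 * κ * y - 1) ^ 2 / (4 * κ) := by positivity
        have e2 : (2 * κ * y - 1) ^ 2 / (4 * κ) = κ * y ^ 2 - y + 1 / (4 * κ) := by field_simp; ring
        linarith
      have h3 := mul_le_mul_of_nonneg_left hx hκ0.le
      rw [hεp]; linarith
    · rw [Set.indicator_of_notMem (by exact hc), add_zero]
      have h2 : |X N ω| ^ p ≤ ε ^ p := Real.rpow_le_rpow (abs_nonneg _) (not_lt.1 hc) hp0.le
      have : 0 ≤ κ * (D * (1 + W ω)) := by positivity
      linarith
  refine hle.trans_lt ?_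
  rw [integral_add hint1 hind, integral_add (integrable_const _) hint2, integral_const_mul, integral_const_mul, integral_add (integrable_const _) hWi,
    integral_indicator₀ hset, setIntegral_const, hεp]
  simp only [integral_const, probReal_univ, smul_eq_mul, one_mul]
  have h5 : κ * (D * (1 + ∫ ω, W ω ∂(P N))) ≤ η / 4 := by
    calc _ ≤ κ * (D * (1 + K)) := by gcongr
      _ = _ := by rw [hκ]; field_simp
  have h6 : (P N).real {ω | ε < |X N ω|} * (1 / (4 * κ)) ≤ η / 4 := by
    calc _ ≤ η * κ * (1 / (4 * κ)) := by gcongr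
      _ = _ := by field_simp
  linarith
end lpconv
section assemble
open MeasureTheory
variable {n : ℕ} {s : ℕ → ℝ}
lemma Z_mean (hs : Ptn n s) (a : ℕ → ℝ) {N : ℕ} (hN : 1 ≤ N) {G : Vtx → Vtx → ℝ} {P : Measure FieldSp} (h : GF N G P) :
    ∫ ω, ∑ v ∈ VN N, exp (lin N (SS N s a n v) ω) ∂P ≤ 4 * exp (150 * ∑ j ∈ range n, a j ^ 2) * exp (Ak s a n * log N) := by
  rw [integral_finsetSum _ (fun v _ => h.expInt _)]
  set B := 150 * ∑ j ∈ range n, a j ^ 2 with hB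
  set L := log N
  calc _ ≤ ∑ v ∈ VN N, exp ((Ak s a n - 2) * L + B) := sum_le_sum fun v hv => by
        rw [h.mgf]
        have := var_half hs a le_rfl hN h.gr hv
        rw [hs.one, mul_one] at this
        exact exp_le_exp.2 this
    _ = ((VN N).card : ℝ) * exp ((Ak s a n - 2) * L + B) := by simp
    _ ≤ 4 * exp (2 * L) * exp ((Ak s a n - 2) * L + B) := mul_le_mul_of_nonneg_right (card_VN_le hN) (exp_pos _).le
    _ = _ := by
      rw [mul_assoc, mul_assoc, ← exp_add, ← exp_add]; congr 2; ring
lemma W_exists (hs : Ptn n s) (a : ℕ → ℝ) (c : ℝ) : ∃ K : ℝ, 0 ≤ K ∧ ∀ᶠ N : ℕ in atTop, ∀ G P, GF N G P → ∃ W : FieldSp → ℝ,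
    Integrable W P ∧ ∫ ω, W ω ∂P ≤ K ∧ ∀ ω, 0 ≤ W ω ∧
      |(log ((N:ℝ) ^ 2))⁻¹ * log (∑ v ∈ VN N, exp (lin N (SS N s a n v) ω)) - c| ≤ K + log (1 + W ω) := by
  set B := 150 * ∑ j ∈ range n, a j ^ 2 with hB
  set A := Ak s a n with hA
  refine ⟨|A| + |c| + 8 * exp B, by positivity, ?_⟩
  filter_upwards [eventually_ge_atTop 1, tendsto_logN.eventually_ge_atTop 1] with N hN hL G P h
  set L := log N with hLd
  set Z : FieldSp → ℝ := fun ω => ∑ v ∈ VN N, exp (lin N (SS N s a n v) ω) with hZ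
  set Y : FieldSp → ℝ := fun ω => ∑ v ∈ VN N, exp (lin N (SS N s (fun j => - a j) n v) ω) with hY
  have hZi : Integrable Z P := integrable_finsetSum _ fun v _ => h.expInt _
  have hYi : Integrable Y P := integrable_finsetSum _ fun v _ => h.expInt _
  have e1 : ∫ ω, Z ω ∂P ≤ 4 * exp B * exp (A * L) := Z_mean hs a hN h
  have e2 : ∫ ω, Y ω ∂P ≤ 4 * exp B * exp (A * L) := by
    have := Z_mean hs (fun j => - a j) hN h
    simp only [neg_sq] at this
    have e : Ak s (fun j => - a j) n = A := by rw [hA]; simp [Ak]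
    rw [e] at this
    exact this
  refine ⟨fun ω => (Z ω + Y ω) * exp (-(A * L)), (hZi.add hYi).mul_const _, ?_, fun ω => ?_⟩
  · rw [integral_mul_const, integral_add hZi hYi]
    calc _ ≤ (4 * exp B * exp (A * L) + 4 * exp B * exp (A * L)) * exp (-(A * L)) := by gcongr
      _ = 8 * exp B := by rw [Real.exp_neg]; field_simp; ring
      _ ≤ _ := by have := abs_nonneg A; have := abs_nonneg c; linarith
  · have v0 : ((0, 0) : Vtx) ∈ VN N := by unfold VN; simp
    have z1 : exp (lin N (SS N s a n (0, 0)) ω) ≤ Z ω := single_le_sum (f := fun v => exp (lin N (SS N s a n v) ω)) (fun v _ => (exp_pos _).le) v0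
    have y1 : exp (lin N (SS N s (fun j => - a j) n (0, 0)) ω) ≤ Y ω := single_le_sum (f := fun v => exp (lin N (SS N s (fun j => - a j) n v) ω)) (fun v _ => (exp_pos _).le) v0
    have en : lin N (SS N s (fun j => - a j) n (0, 0)) ω = - lin N (SS N s a n (0, 0)) ω := by
      rw [lin_SS, lin_SS, ← sum_neg_distrib]; exact sum_congr rfl fun j _ => by ring
    have Z0 : 0 < Z ω := (exp_pos _).trans_le z1
    have Y0 : 0 < Y ω := (exp_pos _).trans_le y1
    have w0 : 0 < (Z ω + Y ω) * exp (-(A * L)) := by positivity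
    refine ⟨w0.le, ?_⟩
    have hlog : log (Z ω + Y ω) ≤ A * L + log (1 + (Z ω + Y ω) * exp (-(A * L))) := by
      have : log ((Z ω + Y ω) * exp (-(A * L))) ≤ log (1 + (Z ω + Y ω) * exp (-(A * L))) := log_le_log w0 (by linarith)
      rw [log_mul (by positivity) (exp_pos _).ne', Real.log_exp] at this
      linarith
    set l := log (1 + (Z ω + Y ω) * exp (-(A * L)))
    have l0 : 0 ≤ l := log_nonneg (by linarith)
    have a1 : log (Z ω) ≤ A * L + l := (log_le_log Z0 (by linarith)).trans hlog
    have a2 : - log (Z ω) ≤ A * L + l := by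
      have q1 := (Real.le_log_iff_exp_le Z0).2 z1
      have q2 := (Real.le_log_iff_exp_le Y0).2 y1
      have q3 : log (Y ω) ≤ log (Z ω + Y ω) := log_le_log Y0 (by linarith)
      linarith
    have a3 : |log (Z ω)| ≤ A * L + l := abs_le.2 ⟨by linarith, a1⟩
    have L2 : log ((N:ℝ) ^ 2) = 2 * L := by rw [Real.log_pow, hLd]; norm_num
    have a4 : |(log ((N:ℝ) ^ 2))⁻¹ * log (Z ω)| ≤ |A| + l := by
      rw [L2, abs_mul, abs_of_nonneg (by positivity), inv_mul_le_iff₀ (by positivity)]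
      have := le_abs_self A
      have := abs_nonneg A
      nlinarith
    have a5 := abs_sub (((log ((N:ℝ) ^ 2))⁻¹ * log (Z ω))) c
    have := exp_pos B
    change |((log ((N:ℝ) ^ 2))⁻¹ * log (Z ω)) - c| ≤ _
    linarith
variable {M m : ℕ} {sigv lamv sigb lamb : ℕ → ℝ} {sigbar : ℝ → ℝ}
lemma fine_Z (hp : ScaleParams M sigv lamv) (hf : Fine n s M lamv m lamb) {N : ℕ} {G : Vtx → Vtx → ℝ} {P : Measure FieldSp} (h : GF N G P) (β : ℝ) :
    ZN N M sigv lamv P β =ᵐ[P] fun ω => ∑ v ∈ VN N, exp (β * ∑ j ∈ range n, stepFn M sigv lamv (s (j + 1)) * lin N (inc N s v j) ω) := by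
  have hall := (Finset.eventually_all (VN N)).2 fun v hv => fine_psi hp hf h hv
  filter_upwards [hall] with ω hω
  unfold ZN
  exact sum_congr rfl fun v hv => by rw [hω v hv]
lemma fe_prob (hp : ScaleParams M sigv lamv) (he : EffParams M sigv lamv m sigb lamb sigbar) (P : ℕ → Measure FieldSp) (hGFF : ∀ N, IsGFF N (P N))
    {β : ℝ} (hβ : 0 < β) : TendstoInProb P (fun N => freeEnergy N M sigv lamv (P N) β) (∑ j ∈ Icc 1 m, fREM (sigb j) β * (lamb j - lamb (j - 1))) := by
  intro ε hε
  have hT : 0 < Tmax M sigv := by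
    have := stepFn_pos hp (r := 1) one_pos le_rfl
    linarith
  obtain ⟨κ, hκ, hlow⟩ := lower_exists hβ hT (ε := 2 * ε) (by positivity)
  obtain ⟨n, s, hf, hmesh, -⟩ := exists_fine hp he ∅ (by simp) hκ
  have hsys := fine_sys hp he hf
  obtain ⟨b, hb, hlow⟩ := hlow n s _ _ hsys hmesh (fun j hj => (stepFn_pos hp (by rw [← hf.ptn.zero]; exact hf.ptn.smono (by omega) (by omega)) (hf.ptn.le_one (by omega))).2)
  obtain ⟨C, δ, hδ, hup⟩ := hsys.upper hβ (ε := 2 * ε) (by positivity)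
  rw [fine_F he hf] at hlow hup
  set c := ∑ j ∈ Icc 1 m, fREM (sigb j) β * (lamb j - lamb (j - 1)) with hc
  have hlim : Tendsto (fun N : ℕ => ENNReal.ofReal (C * exp (-δ * log N)) + ENNReal.ofReal (b N)) atTop (nhds 0) := by
    have h1 := (tendsto_exp_neg (a := -δ) (by linarith)).const_mul C
    have h2 := (ENNReal.tendsto_ofReal h1).add (ENNReal.tendsto_ofReal hb)
    simpa using h2
  refine tendsto_of_tendsto_of_tendsto_of_le_of_le' tendsto_const_nhds hlim (Eventually.of_forall fun N => zero_le) ?_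
  filter_upwards [eventually_ge_atTop 1, tendsto_logN.eventually_ge_atTop 1, hlow] with N hN hL hl
  obtain ⟨G, h⟩ := (hGFF N).gf
  have := h.prob
  have b1 := hup N hN G _ h
  have b2 := hl G _ h
  set Z : FieldSp → ℝ := fun ω => ∑ v ∈ VN N, exp (β * ∑ j ∈ range n, stepFn M sigv lamv (s (j + 1)) * lin N (inc N s v j) ω) with hZ
  have hmono : P N {ω | ε < |freeEnergy N M sigv lamv (P N) β ω - c|} ≤ P N ({ω | exp ((2 * c + 2 * ε) * log N) < Z ω} ∪ {ω | Z ω < exp ((2 * c - 2 * ε) * log N)}) := by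
    refine measure_mono_ae ?_
    filter_upwards [fine_Z hp hf h β] with ω hω hbad
    change ε < |freeEnergy N M sigv lamv (P N) β ω - c| at hbad
    change exp ((2 * c + 2 * ε) * log N) < Z ω ∨ Z ω < exp ((2 * c - 2 * ε) * log N)
    unfold freeEnergy at hbad
    rw [hω] at hbad
    change ε < |(log ((N:ℝ) ^ 2))⁻¹ * log (Z ω) - c| at hbad
    have L2 : log ((N:ℝ) ^ 2) = 2 * log N := by rw [Real.log_pow]; norm_num
    have Z0 : 0 < Z ω := Finset.sum_pos (fun v _ => exp_pos _) ⟨(0, 0), by unfold VN; simp⟩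
    rw [L2] at hbad
    have hf : (2 * log N)⁻¹ * log (Z ω) * (2 * log N) = log (Z ω) := by field_simp
    set f := (2 * log N)⁻¹ * log (Z ω)
    rcases lt_abs.1 hbad with h1 | h1
    · left; rw [← Real.lt_log_iff_exp_lt Z0, ← hf]; nlinarith
    · right; rw [← Real.log_lt_iff_lt_exp Z0, ← hf]; nlinarith
  refine hmono.trans ((measure_union_le _ _).trans (add_le_add ?_ ?_))
  · rw [← ofReal_measureReal]; exact ENNReal.ofReal_le_ofReal b1
  · rw [← ofReal_measureReal]; exact ENNReal.ofReal_le_ofReal b2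
lemma fe_lp (hp : ScaleParams M sigv lamv) (he : EffParams M sigv lamv m sigb lamb sigbar) (P : ℕ → Measure FieldSp) (hGFF : ∀ N, IsGFF N (P N))
    {β : ℝ} (hβ : 0 < β) {p : ℝ} (hp1 : 1 ≤ p) : TendstoLp P (fun N => freeEnergy N M sigv lamv (P N) β) p (∑ j ∈ Icc 1 m, fREM (sigb j) β * (lamb j - lamb (j - 1))) := by
  obtain ⟨n, s, hf, -, -⟩ := exists_fine hp he ∅ (by simp) one_pos
  have hpr := fe_prob hp he P hGFF hβ
  set c := ∑ j ∈ Icc 1 m, fREM (sigb j) β * (lamb j - lamb (j - 1)) with hc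
  obtain ⟨K, hK, hW⟩ := W_exists hf.ptn (fun j => β * stepFn M sigv lamv (s (j + 1))) c
  refine lp_of P (fun N => (hGFF N).1) (fun N ω => freeEnergy N M sigv lamv (P N) β ω - c) hpr hK ?_ hp1
  filter_upwards [hW] with N hN
  obtain ⟨G, h⟩ := (hGFF N).gf
  obtain ⟨W, w1, w2, w3⟩ := hN G _ h
  have heq : ∀ᵐ ω ∂(P N), freeEnergy N M sigv lamv (P N) β ω - c =
      (log ((N:ℝ) ^ 2))⁻¹ * log (∑ v ∈ VN N, exp (lin N (SS N s (fun j => β * stepFn M sigv lamv (s (j + 1))) n v) ω)) - c := by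
    filter_upwards [fine_Z hp hf h β] with ω hω
    unfold freeEnergy
    rw [hω]
    congr 4
    funext v
    rw [lin_SS, mul_sum]
    congr 1
    exact sum_congr rfl fun j _ => by ring
  refine ⟨⟨_, ?_, heq⟩, W, w1, w2, ?_⟩
  · have hm : ∀ v, Measurable (fun ω => exp (lin N (SS N s (fun j => β * stepFn M sigv lamv (s (j + 1))) n v) ω)) := fun v => Real.measurable_exp.comp (lin_meas _)
    have : Measurable (fun ω => ∑ v ∈ VN N, exp (lin N (SS N s (fun j => β * stepFn M sigv lamv (s (j + 1))) n v) ω)) := Finset.measurable_fun_sum _ fun v _ => hm v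
    exact ((Real.measurable_log.comp this).const_mul _).sub_const _
  · filter_upwards [heq] with ω hω
    rw [hω]; exact w3 ω
end assemble

end mine

theorem free_energy_limit_VN
    (M : ℕ) (sigv lamv : ℕ → ℝ) (hparams : ScaleParams M sigv lamv)
    (m : ℕ) (sigb lamb : ℕ → ℝ) (sigbar : ℝ → ℝ)
    (heff : EffParams M sigv lamv m sigb lamb sigbar)
    (EntE : ℝ → ℝ) (hent : IsEntropy M sigv lamv m lamb sigbar EntE)
    (P : ℕ → MeasureTheory.Measure FieldSp) (hGFF : ∀ N, IsGFF N (P N))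
    (β : ℝ) (hβ : 0 < β) :
    TendstoInProb P (fun N => freeEnergy N M sigv lamv (P N) β)
      (sSup ((fun γ => β * γ + EntE γ) '' Set.Icc 0 (gammaStar M sigv lamv sigbar))) ∧
    (∀ p : ℝ, 1 ≤ p →
      TendstoLp P (fun N => freeEnergy N M sigv lamv (P N) β) p
        (sSup ((fun γ => β * γ + EntE γ) '' Set.Icc 0 (gammaStar M sigv lamv sigbar)))) ∧
    sSup ((fun γ => β * γ + EntE γ) '' Set.Icc 0 (gammaStar M sigv lamv sigbar)) =
      ∑ j ∈ Finset.Icc 1 m, fREM (sigb j) β * (lamb j - lamb (j - 1)) := by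
  have hsup := ent_sup hparams heff hent hβ
  rw [hsup]
  exact ⟨fe_prob hparams heff P hGFF hβ, fun p hp => fe_lp hparams heff P hGFF hβ hp, rfl⟩
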